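/- arXiv:2207.01715 — 2 statements merged into one kernel-verified Lean document; each statement's English description precedes it below -/
import Mathlib

section
/- Let (V, E) be a finite graph and β > 0, and let μ be the Ising measure on {−1,1}^V with μ(σ) proportional to exp(β Σ_{{u,v} ∈ E} σ_u σ_v). A current is a function n : E → ℕ; its weight is w(n) = Π_{e ∈ E} β^{n(e)} / n(e)! and its source set is ∂n = {x ∈ V : Σ_{e ∈ E, x ∈ e} n(e) is odd}. Then for every A ⊆ V, the sums Σ_{n : ∂n = A} w(n) and Σ_{n : ∂n = ∅} w(n) (over the countable set of all currents) converge, Σ_{n : ∂n = ∅} w(n) > 0, and ⟨Π_{a ∈ A} σ_a⟩_μ = (Σ_{n : ∂n = A} w(n)) / (Σ_{n : ∂n = ∅} w(n)), where ⟨·⟩_μ denotes expectation under μ. -/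
open scoped Classical

noncomputable section

variable {V : Type*}

/-- The spin value `±1` attached to a Boolean. -/
def spin (b : Bool) : ℝ := if b then 1 else -1

/-- The term `σ_u σ_v` attached to an unordered edge `{u,v}`. -/
def edgeTerm (σ : V → Bool) : Sym2 V → ℝ :=
  Sym2.lift ⟨fun u v => spin (σ u) * spin (σ v), fun _ _ => mul_comm _ _⟩

/-- The Ising Boltzmann weight `exp(β ∑_{{u,v}∈E} σ_u σ_v)` on the finite graph `(V,E)`. -/
def isingWeight (E : Finset (Sym2 V)) (β : ℝ) (σ : V → Bool) : ℝ :=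
  Real.exp (β * ∑ e ∈ E, edgeTerm σ e)

/-- Expectation under the Ising measure on `{-1,1}^V` at inverse temperature `β` on the
finite graph `(V,E)`. -/
def isingExp [Fintype V] (E : Finset (Sym2 V)) (β : ℝ) (f : (V → Bool) → ℝ) : ℝ :=
  (∑ σ : V → Bool, isingWeight E β σ * f σ) / ∑ σ : V → Bool, isingWeight E β σ

/-- The weight `w(n) = ∏_{e∈E} β^{n(e)}/n(e)!` of a current `n : E → ℕ`. -/
def currentWeight (E : Finset (Sym2 V)) (β : ℝ) (n : {e // e ∈ E} → ℕ) : ℝ :=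
  ∏ e ∈ E.attach, β ^ n e / (Nat.factorial (n e) : ℝ)

/-- The source set `∂n = {x : ∑_{e ∋ x} n(e) is odd}` of a current `n : E → ℕ`. -/
def currentSources [Fintype V] (E : Finset (Sym2 V)) (n : {e // e ∈ E} → ℕ) : Finset V :=
  Finset.univ.filter fun x =>
    Odd (∑ e ∈ E.attach, if x ∈ (e : Sym2 V) then n e else 0)

theorem hasSum_mul_prod {ι κ : Type*} {f : ι → ℝ} {g : κ → ℝ} {a b : ℝ}
    (hf : HasSum f a) (hg : HasSum g b) : HasSum (fun p : ι × κ => f p.1 * g p.2) (a * b) :=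
  hf.mul hg (summable_mul_of_summable_norm hf.summable.norm hg.summable.norm)

theorem hasSum_fin_prod {κ : Type*} {m : ℕ} {f : Fin m → κ → ℝ} {a : Fin m → ℝ}
    (h : ∀ i, HasSum (f i) (a i)) :
    HasSum (fun n : Fin m → κ => ∏ i, f i (n i)) (∏ i, a i) := by
  induction m with
  | zero => simp
  | succ m ih =>
    have ht := ih fun i => h i.succ
    have := hasSum_mul_prod (h 0) ht
    rw [← (Fin.consEquiv fun _ => κ).hasSum_iff, Fin.prod_univ_succ]
    exact this.congr_fun fun n => by simp [Fin.prod_univ_succ, Fin.consEquiv]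

/-- A finite product of convergent real series is the sum over tuples of indices of the products
of the terms. -/
theorem hasSum_pi_prod {ι κ : Type*} [Fintype ι] {f : ι → κ → ℝ} {a : ι → ℝ}
    (h : ∀ i, HasSum (f i) (a i)) :
    HasSum (fun n : ι → κ => ∏ i, f i (n i)) (∏ i, a i) := by
  let e := (Fintype.equivFin ι).symm
  rw [← e.prod_comp, ← (e.arrowCongr (Equiv.refl κ)).hasSum_iff]
  exact (hasSum_fin_prod fun i => h (e i)).congr_fun fun n => by simp [← e.prod_comp]

theorem edgeTerm_eq_prod [Fintype V] (σ : V → Bool) {e : Sym2 V} (he : ¬ e.IsDiag) :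
    edgeTerm σ e = ∏ x, if x ∈ e then spin (σ x) else 1 := by
  induction e with
  | h u v =>
    have huv : u ≠ v := by simpa using he
    rw [Finset.prod_ite, Finset.prod_const_one, mul_one]
    have : Finset.univ.filter (fun x => x ∈ s(u, v)) = {u, v} := by ext; simp
    rw [this, Finset.prod_pair huv]
    rfl

/-- The degree `∑_{e ∋ x} n(e)` of a vertex `x` in the current `n`. -/
def currentDegree (E : Finset (Sym2 V)) (n : {e // e ∈ E} → ℕ) (x : V) : ℕ :=
  ∑ e ∈ E.attach, if x ∈ (e : Sym2 V) then n e else 0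

theorem prod_edgeTerm_pow [Fintype V] (E : Finset (Sym2 V)) (hE : ∀ e ∈ E, ¬ e.IsDiag)
    (n : {e // e ∈ E} → ℕ) (σ : V → Bool) :
    ∏ e ∈ E.attach, edgeTerm σ e ^ n e = ∏ x, spin (σ x) ^ currentDegree E n x := by
  simp_rw [currentDegree, ← Finset.prod_pow_eq_pow_sum]
  rw [Finset.prod_comm]
  refine Finset.prod_congr rfl fun e _ => ?_
  rw [edgeTerm_eq_prod σ (hE e e.2), ← Finset.prod_pow]
  refine Finset.prod_congr rfl fun x _ => ?_
  split_ifs <;> simp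

/-- Expansion of the Boltzmann weight as a sum over currents. -/
theorem hasSum_isingWeight [Fintype V] (E : Finset (Sym2 V)) (hE : ∀ e ∈ E, ¬ e.IsDiag)
    (β : ℝ) (σ : V → Bool) :
    HasSum (fun n : {e // e ∈ E} → ℕ =>
      currentWeight E β n * ∏ x, spin (σ x) ^ currentDegree E n x) (isingWeight E β σ) := by
  have h := hasSum_pi_prod fun e : {e // e ∈ E} =>
    NormedSpace.expSeries_div_hasSum_exp (β * edgeTerm σ e)
  convert h using 2 with n
  · rw [← prod_edgeTerm_pow E hE, currentWeight, ← Finset.prod_mul_distrib]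
    refine Finset.prod_congr (by ext; simp) fun e _ => ?_
    rw [mul_pow]
    ring
  · rw [isingWeight, ← Finset.sum_attach, Finset.mul_sum, Real.exp_sum, Real.exp_eq_exp_ℝ]
    exact Finset.prod_congr (by ext; simp) fun _ _ => rfl

theorem sum_spin_pow (k : ℕ) : ∑ b : Bool, spin b ^ k = if Even k then 2 else 0 := by
  rcases k.even_or_odd with h | h
  · simp [spin, h, h.neg_one_pow]
  · simp [spin, Nat.not_even_iff_odd.mpr h, h.neg_one_pow]

/-- Summing over spins selects the currents with source set `A`. -/
theorem sum_prod_spin [Fintype V] (E : Finset (Sym2 V)) (n : {e // e ∈ E} → ℕ) (A : Finset V) :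
    ∑ σ : V → Bool, (∏ x, spin (σ x) ^ currentDegree E n x) * ∏ a ∈ A, spin (σ a) =
      if currentSources E n = A then 2 ^ Fintype.card V else 0 := by
  have h (σ : V → Bool) : (∏ x, spin (σ x) ^ currentDegree E n x) * ∏ a ∈ A, spin (σ a) =
      ∏ x, spin (σ x) ^ (currentDegree E n x + if x ∈ A then 1 else 0) := by
    simp_rw [pow_add, Finset.prod_mul_distrib]
    simp
  have hA : currentSources E n = A ↔
      ∀ x, Even (currentDegree E n x + if x ∈ A then 1 else 0) := by
    rw [Finset.ext_iff]
    refine forall_congr' fun x => ?_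
    have : x ∈ currentSources E n ↔ Odd (currentDegree E n x) := by
      simp [currentSources, currentDegree]
    rw [this]
    by_cases hx : x ∈ A <;> simp [hx, Nat.even_add_one]
  simp_rw [h]
  rw [← Fintype.prod_sum (fun (x : V) (b : Bool) =>
    spin b ^ (currentDegree E n x + if x ∈ A then 1 else 0))]
  simp_rw [sum_spin_pow]
  split_ifs with hs
  · simp [hA.mp hs]
  · obtain ⟨x, hx⟩ := not_forall.mp (mt hA.mpr hs)
    exact Finset.prod_eq_zero (Finset.mem_univ x) (if_neg hx)

/-- The sum of the weights of the currents with source set `A` is the unnormalized correlation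
of the spins in `A`, up to the factor `2 ^ |V|`. -/
theorem hasSum_currentWeight [Fintype V] (E : Finset (Sym2 V)) (hE : ∀ e ∈ E, ¬ e.IsDiag)
    (β : ℝ) (A : Finset V) :
    HasSum (fun n : {e // e ∈ E} → ℕ => if currentSources E n = A then currentWeight E β n else 0)
      ((∑ σ : V → Bool, isingWeight E β σ * ∏ a ∈ A, spin (σ a)) / 2 ^ Fintype.card V) := by
  have h := (hasSum_sum (s := Finset.univ) fun (σ : V → Bool) _ =>
    (hasSum_isingWeight E hE β σ).mul_right (∏ a ∈ A, spin (σ a))).div_const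
      (2 ^ Fintype.card V)
  refine h.congr_fun fun n => ?_
  simp_rw [mul_assoc, ← Finset.mul_sum, sum_prod_spin]
  split_ifs <;> simp

/-- random-current representation of Ising correlations.  Let `(V,E)` be
a finite graph and `β > 0`.  Then the sums of `w(n)` over currents with sources `A`, resp.
`∅`, converge, the latter is positive, and
`⟨∏_{a∈A} σ_a⟩ = (∑_{∂n=A} w(n)) / (∑_{∂n=∅} w(n))`. -/
theorem random_current_representation [Fintype V]
    (E : Finset (Sym2 V)) (hE : ∀ e ∈ E, ¬ e.IsDiag)
    (β : ℝ) (hβ : 0 < β) (A : Finset V) :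
    Summable (fun n : {e // e ∈ E} → ℕ =>
      if currentSources E n = A then currentWeight E β n else 0) ∧
    Summable (fun n : {e // e ∈ E} → ℕ =>
      if currentSources E n = (∅ : Finset V) then currentWeight E β n else 0) ∧
    0 < (∑' n : {e // e ∈ E} → ℕ,
      if currentSources E n = (∅ : Finset V) then currentWeight E β n else 0) ∧
    isingExp E β (fun σ => ∏ a ∈ A, spin (σ a)) =
      (∑' n : {e // e ∈ E} → ℕ,
        if currentSources E n = A then currentWeight E β n else 0) /
      (∑' n : {e // e ∈ E} → ℕ,
        if currentSources E n = (∅ : Finset V) then currentWeight E β n else 0) := by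
  have hS := hasSum_currentWeight E hE β A
  have hS₀ := hasSum_currentWeight E hE β ∅
  simp only [Finset.prod_empty, mul_one] at hS₀
  refine ⟨hS.summable, hS₀.summable, ?_, ?_⟩
  · rw [hS₀.tsum_eq]
    exact div_pos (Finset.sum_pos (fun σ _ => Real.exp_pos _) Finset.univ_nonempty)
      (by positivity)
  · rw [hS.tsum_eq, hS₀.tsum_eq, isingExp, div_div_div_cancel_right₀ (by positivity)]

end
end

section
/- Let q ≥ 5 be an integer. Work on ℤ². For N ≥ 1 let Λ_N = {−N,…,N}², and let μ¹_{β,N} be the q-state Potts measure on {1,…,q}^{Λ_N} with boundary condition 1: μ¹_{β,N}(σ) is proportional to exp(β [Σ 𝟙_{σ_u = σ_v} + Σ' 𝟙_{σ_u = 1}]), where the first sum is over unordered pairs {u,v} ⊆ Λ_N with ‖u−v‖₁ = 1 and the second sum Σ' is over pairs (u,v) with u ∈ Λ_N, v ∈ ℤ² ∖ Λ_N and ‖u−v‖₁ = 1. Define m_N(β) = μ¹_{β,N}(σ_0 = 1) − 1/q and m*(β) = limsup_{N→∞} m_N(β). Then at the critical point β_c(q) = log(1 + √q) one has m*(β_c(q))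 > 0: the phase transition of the planar q-state Potts model is discontinuous for q ≥ 5. -/
open scoped Classical
open Filter

noncomputable section

/-- The `ℓ¹`-distance on `ℤ^d`. -/
def dist1 {d : ℕ} (u v : Fin d → ℤ) : ℤ := ∑ i, |u i - v i|

/-- The box `Λ_N = {-N,…,N}² ⊆ ℤ²`. -/
def cube (N : ℕ) : Finset (Fin 2 → ℤ) :=
  Fintype.piFinset fun _ => Finset.Icc (-(N : ℤ)) N

/-- The set of nearest neighbours of `u` in `ℤ²`. -/
def nbrs (u : Fin 2 → ℤ) : Finset (Fin 2 → ℤ) :=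
  (Fintype.piFinset fun i => Finset.Icc (u i - 1) (u i + 1)).filter fun v => dist1 u v = 1

/-- The number of nearest neighbours of `u` lying outside `Λ_N` (counted with
multiplicity). -/
def bCount (N : ℕ) (u : Fin 2 → ℤ) : ℕ := (nbrs u \ cube N).card

/-- The Boltzmann weight
`exp(β[∑_{{u,v}⊆Λ_N, ‖u-v‖₁=1} 𝟙_{σ_u=σ_v} + ∑_{u∈Λ_N, v∉Λ_N, ‖u-v‖₁=1} 𝟙_{σ_u=c₀}])`
of a `q`-state Potts configuration `σ` on `Λ_N` with boundary colour `c₀` (the sum over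
unordered pairs is written as half the sum over ordered pairs). -/
def pottsWeight (q N : ℕ) (c₀ : Fin q) (β : ℝ) (σ : {x // x ∈ cube N} → Fin q) : ℝ :=
  Real.exp (β * ((1 / 2) * (∑ u ∈ (cube N).attach, ∑ v ∈ (cube N).attach,
      if dist1 (u : Fin 2 → ℤ) (v : Fin 2 → ℤ) = 1 then
        (if σ u = σ v then (1 : ℝ) else 0) else 0) +
    ∑ u ∈ (cube N).attach,
      (bCount N (u : Fin 2 → ℤ) : ℝ) * (if σ u = c₀ then (1 : ℝ) else 0)))

lemma origin_mem_cube (N : ℕ) : (fun _ => (0 : ℤ)) ∈ cube N := by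
  simp only [cube, Fintype.mem_piFinset, Finset.mem_Icc]
  intro i
  omega

/-- `m_N(β) = μ¹_{β,N}(σ_0 = c₀) - 1/q` for the `q`-state Potts model on `Λ_N ⊆ ℤ²` with
boundary colour `c₀`. -/
def pottsMag (q N : ℕ) (c₀ : Fin q) (β : ℝ) : ℝ :=
  (∑ σ : {x // x ∈ cube N} → Fin q,
      pottsWeight q N c₀ β σ *
        (if σ ⟨fun _ => 0, origin_mem_cube N⟩ = c₀ then (1 : ℝ) else 0)) /
    (∑ σ : {x // x ∈ cube N} → Fin q, pottsWeight q N c₀ β σ) - 1 / q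

/-- The spontaneous magnetisation `m*(β) = limsup_N m_N(β)`. -/
def pottsMstar (q : ℕ) (c₀ : Fin q) (β : ℝ) : ℝ :=
  atTop.limsup fun N => pottsMag q N c₀ β

end

namespace Potts
open Relation

theorem mk_eq_iff {V : Type*} (r : V → V → Prop) {a b : V} :
    Quot.mk r a = Quot.mk r b ↔ EqvGen r a b :=
  ⟨Quot.eqvGen_exact, Quot.eqvGen_sound⟩

theorem eqvGen_lift {V W : Type*} {r : V → V → Prop} {s : W → W → Prop} (f : V → W)
    (h : ∀ x y, r x y → EqvGen s (f x) (f y)) {x y : V} (hxy : EqvGen r x y) :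
    EqvGen s (f x) (f y) := by
  induction hxy with
  | rel x y h' => exact h x y h'
  | refl x => exact .refl _
  | symm x y _ ih => exact .symm _ _ ih
  | trans x y z _ _ ih1 ih2 => exact .trans _ _ _ ih1 ih2

theorem eqvGen_le {V : Type*} {r s : V → V → Prop}
    (h : ∀ x y, r x y → EqvGen s x y) {x y : V} (hxy : EqvGen r x y) : EqvGen s x y :=
  eqvGen_lift id h hxy

/-- A function constant along `r` is constant on classes. -/
theorem eqvGen_const {V A : Type*} {r : V → V → Prop} (f : V → A)
    (h : ∀ x y, r x y → f x = f y) {x y : V} (hxy : EqvGen r x y) : f x = f y := by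
  induction hxy with
  | rel x y h' => exact h x y h'
  | refl x => rfl
  | symm x y _ ih => exact ih.symm
  | trans x y z _ _ ih1 ih2 => exact ih1.trans ih2

theorem eqvGen_dichotomy {V : Type*} {r s : V → V → Prop} (N : Set V)
    (h1 : ∀ x y, s x y → EqvGen r x y ∨ ((∃ n ∈ N, EqvGen r n x) ∧ (∃ n ∈ N, EqvGen r n y)))
    {x y : V} (h : EqvGen s x y) :
    EqvGen r x y ∨ ((∃ n ∈ N, EqvGen r n x) ∧ (∃ n ∈ N, EqvGen r n y)) := by
  induction h with
  | rel x y h' => exact h1 x y h'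
  | refl x => exact Or.inl (.refl _)
  | symm x y _ ih =>
    rcases ih with h | ⟨h, h'⟩
    · exact Or.inl (.symm _ _ h)
    · exact Or.inr ⟨h', h⟩
  | trans x y z _ _ ih1 ih2 =>
    rcases ih1 with h | ⟨⟨n, hn, h⟩, ⟨m, hm, h'⟩⟩ <;> rcases ih2 with k | ⟨⟨n', hn', k⟩, ⟨m', hm', k'⟩⟩
    · exact Or.inl (.trans _ _ _ h k)
    · exact Or.inr ⟨⟨n', hn', .trans _ _ _ k (.symm _ _ h)⟩, ⟨m', hm', k'⟩⟩
    · exact Or.inr ⟨⟨n, hn, h⟩, ⟨m, hm, .trans _ _ _ h' k⟩⟩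
    · exact Or.inr ⟨⟨n, hn, h⟩, ⟨m', hm', k'⟩⟩

/-- Merging all the classes met by `N` into one. -/
theorem card_collapse {V : Type*} (r s : V → V → Prop) (N : Set V) (hN : N.Nonempty)
    [Finite (Quot r)]
    (h1 : ∀ x y, s x y → EqvGen r x y ∨ ((∃ n ∈ N, EqvGen r n x) ∧ (∃ n ∈ N, EqvGen r n y)))
    (h2 : ∀ x y, r x y → EqvGen s x y)
    (h3 : ∀ x ∈ N, ∀ y ∈ N, EqvGen s x y) :
    Nat.card (Quot r) + 1 = Nat.card (Quot s) + ((Quot.mk r) '' N).ncard := by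
  obtain ⟨n0, hn0⟩ := hN
  let f : Quot r → Quot s := Quot.lift (Quot.mk s) (fun a b h => Quot.eqvGen_sound (h2 a b h))
  have fsurj : Function.Surjective f := by
    rintro ⟨x⟩; exact ⟨Quot.mk r x, rfl⟩
  have : Finite (Quot s) := Finite.of_surjective f fsurj
  set A := (Quot.mk r) '' N with hA
  have memA : ∀ x, Quot.mk r x ∈ A ↔ ∃ n ∈ N, EqvGen r n x := by
    intro x
    simp only [hA, Set.mem_image, mk_eq_iff]
  have hinj : Set.InjOn f Aᶜ := by
    rintro ⟨x⟩ hx ⟨y⟩ hy hxy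
    rcases eqvGen_dichotomy N h1 ((mk_eq_iff s).1 hxy) with h | ⟨h, -⟩
    · exact Quot.eqvGen_sound h
    · exact absurd ((memA x).2 h) hx
  have him : f '' Aᶜ = {Quot.mk s n0}ᶜ := by
    ext c
    constructor
    · rintro ⟨⟨x⟩, hx, rfl⟩ hc
      rcases eqvGen_dichotomy N h1 ((mk_eq_iff s).1 (hc : Quot.mk s x = Quot.mk s n0)) with h | ⟨h, -⟩
      · exact hx ((memA x).2 ⟨n0, hn0, .symm _ _ h⟩)
      · exact hx ((memA x).2 h)
    · intro hc
      obtain ⟨⟨x⟩, rfl⟩ := fsurj c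
      refine ⟨Quot.mk r x, fun hx => hc ?_, rfl⟩
      obtain ⟨n, hn, h⟩ := (memA x).1 hx
      exact Quot.eqvGen_sound (.trans _ _ _ (eqvGen_le h2 (.symm _ _ h)) (h3 n hn n0 hn0))
  have e1 := Set.ncard_add_ncard_compl A
  have e2 := Set.ncard_add_ncard_compl ({Quot.mk s n0} : Set (Quot s))
  rw [← him, Set.InjOn.ncard_image hinj, Set.ncard_singleton] at e2
  omega

theorem finite_quot {V : Type*} (r : V → V → Prop) (F : Set V) (hF : F.Finite)
    (h : ∀ x y, x ∉ F → y ∉ F → EqvGen r x y) : Finite (Quot r) := by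
  have : (Set.univ : Set (Quot r)).Finite := by
    by_cases hne : ∃ x, x ∉ F
    · obtain ⟨x0, hx0⟩ := hne
      refine ((hF.image (Quot.mk r)).union (Set.finite_singleton (Quot.mk r x0))).subset ?_
      rintro ⟨x⟩ -
      by_cases hx : x ∈ F
      · exact Or.inl ⟨x, hx, rfl⟩
      · exact Or.inr (Quot.eqvGen_sound (h x x0 hx hx0))
    · push Not at hne
      refine (hF.image (Quot.mk r)).subset ?_
      rintro ⟨x⟩ -
      exact ⟨x, hne x, rfl⟩
  exact Set.finite_univ_iff.1 this

/-- Adding one edge joining distinct classes lowers the number of classes by one. -/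
theorem card_add_edge {V : Type*} (r s : V → V → Prop) [Finite (Quot r)] (a b : V)
    (h1 : ∀ x y, s x y → EqvGen r x y ∨ (x = a ∧ y = b) ∨ (x = b ∧ y = a))
    (h2 : ∀ x y, r x y → EqvGen s x y) (h3 : EqvGen s a b) :
    Nat.card (Quot r) = Nat.card (Quot s) + (if EqvGen r a b then 0 else 1) := by
  have key := card_collapse r s {a, b} ⟨a, by simp⟩ ?_ h2 ?_
  · rw [Set.image_pair] at key
    split_ifs with h
    · rw [(mk_eq_iff r).2 h] at key
      simp at key
      omega
    · rw [Set.ncard_pair (fun h' => h ((mk_eq_iff r).1 h'))] at key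
      omega
  · intro x y hxy
    rcases h1 x y hxy with h | ⟨rfl, rfl⟩ | ⟨rfl, rfl⟩
    · exact Or.inl h
    · exact Or.inr ⟨⟨x, by simp, .refl _⟩, ⟨y, by simp, .refl _⟩⟩
    · exact Or.inr ⟨⟨x, by simp, .refl _⟩, ⟨y, by simp, .refl _⟩⟩
  · rintro x (rfl | rfl) y (rfl | rfl)
    · exact .refl _
    · exact h3
    · exact .symm _ _ h3
    · exact .refl _

/-- The tilted square `|v - z|_1 < R`. -/
def dom (z : ℤ × ℤ) (R : ℤ) (v : ℤ × ℤ) : Prop :=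
  -R < v.1 + v.2 - (z.1 + z.2) ∧ v.1 + v.2 - (z.1 + z.2) < R ∧
    -R < v.1 - v.2 - (z.1 - z.2) ∧ v.1 - v.2 - (z.1 - z.2) < R

/-- The unit squares, indexed by their lower left corner, whose centre lies in the tilted
square. -/
def act (z : ℤ × ℤ) (R : ℤ) (s : ℤ × ℤ) : Prop :=
  -R < s.1 + s.2 + 1 - (z.1 + z.2) ∧ s.1 + s.2 + 1 - (z.1 + z.2) < R ∧
    -R < s.1 - s.2 - (z.1 - z.2) ∧ s.1 - s.2 - (z.1 - z.2) < R

/-- Vertices of class `τ`. -/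
def par (τ : ℤ) (v : ℤ × ℤ) : Prop := (v.1 + v.2 + τ) % 2 = 0

/-- First end of the diagonal of class `τ` of the square `s`. -/
def e1 (τ : ℤ) (s : ℤ × ℤ) : ℤ × ℤ := if (s.1 + s.2 + τ) % 2 = 0 then s else (s.1 + 1, s.2)

/-- Second end of the diagonal of class `τ` of the square `s`. -/
def e2 (τ : ℤ) (s : ℤ × ℤ) : ℤ × ℤ :=
  if (s.1 + s.2 + τ) % 2 = 0 then (s.1 + 1, s.2 + 1) else (s.1, s.2 + 1)

/-- Connections along open diagonals of both classes, all outer vertices being wired. -/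
def rel (z : ℤ × ℤ) (R τ : ℤ) (O : Set (ℤ × ℤ)) (v w : ℤ × ℤ) : Prop :=
  (∃ s, act z R s ∧ s ∈ O ∧ v = e1 τ s ∧ w = e2 τ s) ∨
  (∃ s, act z R s ∧ s ∉ O ∧ v = e1 (1 - τ) s ∧ w = e2 (1 - τ) s) ∨
  (¬ dom z R v ∧ ¬ dom z R w)

/-- Connections along open diagonals of class `τ`, everything else being wired. -/
def relc (z : ℤ × ℤ) (R τ : ℤ) (X : Set (ℤ × ℤ)) (v w : ℤ × ℤ) : Prop :=
  (∃ s, act z R s ∧ s ∈ X ∧ v = e1 τ s ∧ w = e2 τ s) ∨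
  (¬ (dom z R v ∧ par τ v) ∧ ¬ (dom z R w ∧ par τ w))

theorem par_e1 (τ : ℤ) (s : ℤ × ℤ) : par τ (e1 τ s) := by
  unfold par e1; split_ifs <;> grind

theorem par_e2 (τ : ℤ) (s : ℤ × ℤ) : par τ (e2 τ s) := by
  unfold par e2; split_ifs <;> grind

theorem par_compl (τ : ℤ) (v : ℤ × ℤ) : par (1 - τ) v ↔ ¬ par τ v := by
  unfold par; omega

theorem finite_box (A B C D : ℤ) :
    {v : ℤ × ℤ | A < v.1 + v.2 ∧ v.1 + v.2 < B ∧ C < v.1 - v.2 ∧ v.1 - v.2 < D}.Finite := by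
  refine (Set.finite_Icc ((-(|A| + |B| + |C| + |D|), -(|A| + |B| + |C| + |D|)) : ℤ × ℤ)
    (|A| + |B| + |C| + |D|, |A| + |B| + |C| + |D|)).subset ?_
  rintro ⟨a, b⟩ ⟨h1, h2, h3, h4⟩
  have := neg_abs_le A
  have := le_abs_self B
  have := neg_abs_le C
  have := le_abs_self D
  have := abs_nonneg A
  have := abs_nonneg B
  have := abs_nonneg C
  have := abs_nonneg D
  simp only [Set.mem_Icc, Prod.mk_le_mk] at *
  omega

theorem finite_dom (z : ℤ × ℤ) (R : ℤ) : {v | dom z R v}.Finite := by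
  refine (finite_box (-R + (z.1 + z.2)) (R + (z.1 + z.2)) (-R + (z.1 - z.2))
    (R + (z.1 - z.2))).subset ?_
  rintro v h
  simp only [Set.mem_ofPred_eq, dom] at *
  omega

theorem finite_act (z : ℤ × ℤ) (R : ℤ) : {v | act z R v}.Finite := by
  refine (finite_box (-R + (z.1 + z.2) - 1) (R + (z.1 + z.2)) (-R + (z.1 - z.2))
    (R + (z.1 - z.2))).subset ?_
  rintro v h
  simp only [Set.mem_ofPred_eq, act] at *
  omega

instance finite_rel (z : ℤ × ℤ) (R τ : ℤ) (O : Set (ℤ × ℤ)) : Finite (Quot (rel z R τ O)) :=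
  finite_quot _ _ (finite_dom z R) fun _ _ hx hy => .rel _ _ (Or.inr (Or.inr ⟨hx, hy⟩))

instance finite_relc (z : ℤ × ℤ) (R τ : ℤ) (O : Set (ℤ × ℤ)) : Finite (Quot (relc z R τ O)) :=
  finite_quot _ _ (finite_dom z R) fun _ _ hx hy =>
    .rel _ _ (Or.inr ⟨fun h => hx h.1, fun h => hy h.1⟩)

/-- Inactive squares have a diagonal whose two ends are outer. -/
theorem not_act_out {z : ℤ × ℤ} {R τ : ℤ} (hR : R % 2 = 0) (hz : par τ z) {s : ℤ × ℤ}
    (hs : ¬ act z R s) : ¬ dom z R (e1 τ s) ∧ ¬ dom z R (e2 τ s) := by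
  unfold act par dom e1 e2 at *
  split_ifs <;> simp only <;> omega

theorem act_in_other {z : ℤ × ℤ} {R τ : ℤ} (hR : R % 2 = 0) (hz : par τ z) {s : ℤ × ℤ}
    (hs : act z R s) : dom z R (e1 (1 - τ) s) ∧ dom z R (e2 (1 - τ) s) := by
  unfold act par dom e1 e2 at *
  split_ifs <;> simp only <;> omega

theorem act_in {z : ℤ × ℤ} {R τ : ℤ} (hR : R % 2 = 0) (hz : par τ z) {s : ℤ × ℤ}
    (hs : act z R s) : dom z R (e1 τ s) ∨ dom z R (e2 τ s) := by
  unfold act par dom e1 e2 at *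
  split_ifs <;> simp only <;> omega

theorem finsum_shift_sub (f : ℤ × ℤ → ℤ) (hf : (Function.support f).Finite) (e : ℤ × ℤ) :
    ∑ᶠ s, (f (s + e) - f s) = 0 := by
  have h1 : ∑ᶠ s, f (s + e) = ∑ᶠ s, f s := finsum_comp_equiv (Equiv.addRight e)
  have h2 : (Function.support fun s => f (s + e)).Finite :=
    hf.preimage (f := fun s => s + e) (fun x _ y _ h => add_right_cancel h)
  rw [finsum_sub_distrib h2 hf, h1, sub_self]

/-- Discrete Stokes formula on `ℤ²`. -/
theorem stokes (φ : ℤ × ℤ → ℤ) (hφ : (Function.support φ).Finite) :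
    ∑ᶠ s : ℤ × ℤ, (if (s.1 + s.2) % 2 = 0 then (1 : ℤ) else -1) *
      ((φ (s.1 + 1, s.2 + 1) - φ s) * (φ (s.1 + 1, s.2) - φ (s.1, s.2 + 1))) = 0 := by
  set v : ℤ × ℤ → ℤ := fun s => -((if (s.1 + s.2) % 2 = 0 then (1 : ℤ) else -1) *
    (φ s * φ (s.1, s.2 + 1))) with hv
  set u : ℤ × ℤ → ℤ := fun s => (if (s.1 + s.2) % 2 = 0 then (1 : ℤ) else -1) *
    (φ s * φ (s.1 + 1, s.2)) with hu
  have fv : (Function.support v).Finite := hφ.subset fun s hs h => hs (by simp [hv, h])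
  have fu : (Function.support u).Finite := hφ.subset fun s hs h => hs (by simp [hu, h])
  have fv' : (Function.support fun s => v (s + (1, 0))).Finite :=
    fv.preimage (f := fun s => s + (1, 0)) (fun x _ y _ h => add_right_cancel h)
  have fu' : (Function.support fun s => u (s + (0, 1))).Finite :=
    fu.preimage (f := fun s => s + (0, 1)) (fun x _ y _ h => add_right_cancel h)
  have h1 := finsum_shift_sub v fv (1, 0)
  have h2 := finsum_shift_sub u fu (0, 1)
  have key := finsum_add_distrib (f := fun s => v (s + (1, 0)) - v s)
    (g := fun s => u (s + (0, 1)) - u s)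
    ((fv'.union fv).subset (Function.support_sub _ _))
    ((fu'.union fu).subset (Function.support_sub _ _))
  rw [h1, h2, add_zero] at key
  refine (finsum_congr fun s => ?_).trans key
  obtain ⟨a, b⟩ := s
  simp only [hv, hu, Prod.mk_add_mk, add_zero]
  have : ∀ x y : ℤ, (if (a + 1 + b) % 2 = 0 then x else y) = if (a + b) % 2 = 0 then y else x := by
    intro x y; split_ifs <;> first | rfl | omega
  have h' : ∀ x y : ℤ, (if (a + (b + 1)) % 2 = 0 then x else y)
      = if (a + b) % 2 = 0 then y else x := by
    intro x y; split_ifs <;> first | rfl | omega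
  rw [this, h']
  split_ifs <;> ring

theorem diag_mul (τ : ℤ) (s : ℤ × ℤ) (φ : ℤ × ℤ → ℤ) :
    (φ (e2 τ s) - φ (e1 τ s)) * (φ (e2 (1 - τ) s) - φ (e1 (1 - τ) s)) =
      -((φ (s.1 + 1, s.2 + 1) - φ s) * (φ (s.1 + 1, s.2) - φ (s.1, s.2 + 1))) := by
  unfold e1 e2
  split_ifs <;> first | omega | ring

theorem stokes_single (φ : ℤ × ℤ → ℤ) (hφ : (Function.support φ).Finite) (τ : ℤ) (s0 : ℤ × ℤ)
    (h : ∀ s, s ≠ s0 → φ (e2 τ s) - φ (e1 τ s) = 0 ∨ φ (e2 (1 - τ) s) - φ (e1 (1 - τ) s) = 0) :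
    φ (e2 τ s0) - φ (e1 τ s0) = 0 ∨ φ (e2 (1 - τ) s0) - φ (e1 (1 - τ) s0) = 0 := by
  have h0 := stokes φ hφ
  rw [finsum_eq_single _ s0] at h0
  · rw [← mul_eq_zero, diag_mul, neg_eq_zero]
    rcases mul_eq_zero.1 h0 with h1 | h1
    · split_ifs at h1
      all_goals simp at h1
    · exact h1
  · intro s hs
    have := h s hs
    rw [← mul_eq_zero, diag_mul, neg_eq_zero] at this
    rw [this, mul_zero]

/-- If `x ≁ y`, one of the two classes avoids the outer vertices. -/
theorem exists_bump (z : ℤ × ℤ) (R τ : ℤ) (X : Set (ℤ × ℤ)) (x y : ℤ × ℤ)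
    (h : ¬ EqvGen (relc z R τ X) x y) :
    ∃ f : ℤ × ℤ → ℤ, (∀ v w, relc z R τ X v w → f v = f w) ∧
      (∀ v, ¬ (dom z R v ∧ par τ v) → f v = 0) ∧ f y - f x ≠ 0 := by
  have main : ∀ x y, ¬ EqvGen (relc z R τ X) x y →
      (∀ v, ¬ (dom z R v ∧ par τ v) → ¬ EqvGen (relc z R τ X) x v) →
      ∃ f : ℤ × ℤ → ℤ, (∀ v w, relc z R τ X v w → f v = f w) ∧
      (∀ v, ¬ (dom z R v ∧ par τ v) → f v = 0) ∧ f y - f x ≠ 0 := by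
    intro x y h hx
    refine ⟨fun v => if EqvGen (relc z R τ X) x v then 1 else 0, ?_, ?_, ?_⟩
    · intro v w hvw
      have : EqvGen (relc z R τ X) x v ↔ EqvGen (relc z R τ X) x w :=
        ⟨fun h => .trans _ _ _ h (.rel _ _ hvw), fun h => .trans _ _ _ h (.symm _ _ (.rel _ _ hvw))⟩
      simp [this]
    · intro v hv
      simp [hx v hv]
    · simp [h, EqvGen.refl x]
  by_cases hx : ∀ v, ¬ (dom z R v ∧ par τ v) → ¬ EqvGen (relc z R τ X) x v
  · exact main x y h hx
  · push Not at hx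
    obtain ⟨v, hv, hxv⟩ := hx
    obtain ⟨f, h1, h2, h3⟩ := main y x (fun h' => h (.symm _ _ h')) (by
      intro w hw hyw
      exact h (.trans _ _ _ hxv (.trans _ _ _ (.rel _ _ (Or.inr ⟨by tauto, hw⟩))
        (.symm _ _ hyw))))
    exact ⟨f, h1, h2, fun h => h3 (by omega)⟩

/-- Planarity: the ends of one of the two diagonals of a square are connected without
using the square. -/
theorem not_neither {z : ℤ × ℤ} {R τ : ℤ} (hR : R % 2 = 0) (O : Set (ℤ × ℤ)) (s0 : ℤ × ℤ) :
    EqvGen (relc z R τ (O \ {s0})) (e1 τ s0) (e2 τ s0) ∨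
    EqvGen (relc z R (1 - τ) (Oᶜ \ {s0})) (e1 (1 - τ) s0) (e2 (1 - τ) s0) := by
  by_contra! hcon
  obtain ⟨f, f1, f2, f3⟩ := exists_bump _ _ _ _ _ _ hcon.1
  obtain ⟨g, g1, g2, g3⟩ := exists_bump _ _ _ _ _ _ hcon.2
  have hfg : ∀ s, (f + g) (e2 τ s) - (f + g) (e1 τ s) = f (e2 τ s) - f (e1 τ s) := by
    intro s
    have a := g2 (e1 τ s) (fun h => (par_compl _ _).1 h.2 (par_e1 τ s))
    have b := g2 (e2 τ s) (fun h => (par_compl _ _).1 h.2 (par_e2 τ s))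
    simp [a, b]
  have hfg' : ∀ s, (f + g) (e2 (1 - τ) s) - (f + g) (e1 (1 - τ) s) =
      g (e2 (1 - τ) s) - g (e1 (1 - τ) s) := by
    intro s
    have a := f2 (e1 (1 - τ) s) (fun h => (par_compl _ _).1 (par_e1 (1 - τ) s) h.2)
    have b := f2 (e2 (1 - τ) s) (fun h => (par_compl _ _).1 (par_e2 (1 - τ) s) h.2)
    simp [a, b]
  have key := stokes_single (f + g) ?_ τ s0 ?_
  · rw [hfg, hfg'] at key
    exact key.elim f3 g3
  · refine (finite_dom z R).subset fun v hv => ?_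
    by_contra h
    refine hv ?_
    simp [f2 v (fun h' => h h'.1), g2 v (fun h' => h h'.1)]
  · intro s hs
    rw [hfg, hfg']
    by_cases ha : act z R s
    · by_cases hO : s ∈ O
      · left
        rw [f1 _ _ (Or.inl ⟨s, ha, ⟨hO, hs⟩, rfl, rfl⟩), sub_self]
      · right
        rw [g1 _ _ (Or.inl ⟨s, ha, ⟨hO, hs⟩, rfl, rfl⟩), sub_self]
    · by_cases hz : par τ z
      · left
        have := not_act_out hR hz ha
        rw [f2 _ (fun h => this.1 h.1), f2 _ (fun h => this.2 h.1), sub_self]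
      · right
        have := not_act_out hR ((par_compl _ _).2 hz) ha
        rw [g2 _ (fun h => this.1 h.1), g2 _ (fun h => this.2 h.1), sub_self]

def out (z : ℤ × ℤ) (R : ℤ) : ℤ × ℤ := (z.1 + R, z.2)

theorem not_dom_out (z : ℤ × ℤ) (R : ℤ) : ¬ dom z R (out z R) := by
  unfold dom out; simp only; omega

/-- Number of classes of `relc`. -/
noncomputable def kc (z : ℤ × ℤ) (R τ : ℤ) (X : Set (ℤ × ℤ)) : ℕ := Nat.card (Quot (relc z R τ X))

theorem relc_congr {z : ℤ × ℤ} {R τ : ℤ} {X Y : Set (ℤ × ℤ)}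
    (h : ∀ s, act z R s → (s ∈ X ↔ s ∈ Y)) : relc z R τ X = relc z R τ Y := by
  funext v w
  refine propext (or_congr_left (exists_congr fun s => ?_))
  constructor <;> rintro ⟨h1, h2, h3⟩
  exacts [⟨h1, (h s h1).1 h2, h3⟩, ⟨h1, (h s h1).2 h2, h3⟩]

theorem kc_congr {z : ℤ × ℤ} {R τ : ℤ} {X Y : Set (ℤ × ℤ)}
    (h : ∀ s, act z R s → (s ∈ X ↔ s ∈ Y)) : kc z R τ X = kc z R τ Y := by
  unfold kc; rw [relc_congr h]

theorem relc_mono {z : ℤ × ℤ} {R τ : ℤ} {X Y : Set (ℤ × ℤ)} (h : X ⊆ Y) {v w : ℤ × ℤ}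
    (hvw : relc z R τ X v w) : relc z R τ Y v w := by
  rcases hvw with ⟨s, h1, h2, h3⟩ | h'
  · exact Or.inl ⟨s, h1, h h2, h3⟩
  · exact Or.inr h'

theorem kc_insert {z : ℤ × ℤ} {R τ : ℤ} (X : Set (ℤ × ℤ)) {s : ℤ × ℤ} (hs : act z R s) :
    kc z R τ X = kc z R τ (insert s X) +
      (if EqvGen (relc z R τ X) (e1 τ s) (e2 τ s) then 0 else 1) := by
  refine card_add_edge _ _ _ _ ?_ ?_ ?_
  · rintro x y (⟨t, h1, h2, rfl, rfl⟩ | h)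
    · rcases h2 with rfl | h2
      · exact Or.inr (Or.inl ⟨rfl, rfl⟩)
      · exact Or.inl (.rel _ _ (Or.inl ⟨t, h1, h2, rfl, rfl⟩))
    · exact Or.inl (.rel _ _ (Or.inr h))
  · exact fun x y h => .rel _ _ (relc_mono (Set.subset_insert _ _) h)
  · exact .rel _ _ (Or.inl ⟨s, hs, Set.mem_insert _ _, rfl, rfl⟩)

noncomputable def jc (z : ℤ × ℤ) (R τ : ℤ) (O : Set (ℤ × ℤ)) : ℤ := kc z R (1 - τ) Oᶜ - kc z R τ O

theorem jc_congr {z : ℤ × ℤ} {R τ : ℤ} {X Y : Set (ℤ × ℤ)}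
    (h : ∀ s, act z R s → (s ∈ X ↔ s ∈ Y)) : jc z R τ X = jc z R τ Y := by
  unfold jc
  rw [kc_congr h, kc_congr (X := Xᶜ) (Y := Yᶜ)]
  intro s hs
  simp [h s hs]

theorem jc_insert {z : ℤ × ℤ} {R τ : ℤ} (hR : R % 2 = 0) (O : Set (ℤ × ℤ)) (s : ℤ × ℤ) :
    jc z R τ (insert s O) ≤ jc z R τ O + 1 := by
  by_cases hO : s ∈ O
  · rw [Set.insert_eq_of_mem hO]; omega
  by_cases hs : act z R s
  · have h1 := kc_insert (τ := τ) O hs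
    have h2 := kc_insert (τ := 1 - τ) (Oᶜ \ {s}) hs
    rw [Set.insert_sdiff_self_of_mem (by simpa using hO)] at h2
    have e : (insert s O)ᶜ = Oᶜ \ {s} := by ext t; simp; tauto
    have key := not_neither (z := z) (τ := τ) hR O s
    rw [Set.sdiff_singleton_eq_self hO] at key
    unfold jc
    rw [e]
    split_ifs at h1 h2 <;> first | omega | (exfalso; tauto)
  · rw [jc_congr (Y := O)]
    · omega
    · intro t ht
      simp only [Set.mem_insert_iff, or_iff_right_iff_imp]
      rintro rfl; exact absurd ht hs

theorem jc_union {z : ℤ × ℤ} {R τ : ℤ} (hR : R % 2 = 0) (O : Set (ℤ × ℤ)) (B : Finset (ℤ × ℤ)) :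
    jc z R τ (O ∪ B) ≤ jc z R τ O + B.card := by
  induction B using Finset.induction_on with
  | empty => simp
  | insert s B hs ih =>
    have := jc_insert (z := z) (τ := τ) hR (O ∪ B) s
    rw [Finset.coe_insert, Set.union_insert, Finset.card_insert_of_notMem hs]
    push_cast
    omega

theorem kc_empty_ge (z : ℤ × ℤ) (R τ : ℤ) (X : Set (ℤ × ℤ)) (hX : ∀ s, act z R s → s ∉ X) :
    {v | dom z R v ∧ par τ v}.ncard + 1 ≤ kc z R τ X := by
  let f : Quot (relc z R τ X) → Option {v | dom z R v ∧ par τ v} :=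
    Quot.lift (fun v => if h : dom z R v ∧ par τ v then some ⟨v, h⟩ else none) (by
      rintro v w (⟨s, h1, h2, -⟩ | ⟨h1, h2⟩)
      · exact absurd h2 (hX s h1)
      · simp only [h1, h2, dite_false])
  have hf : Function.Surjective f := by
    rintro (_ | ⟨v, hv⟩)
    · exact ⟨Quot.mk _ (out z R), dif_neg fun h => not_dom_out z R h.1⟩
    · exact ⟨Quot.mk _ v, dif_pos hv⟩
  have : Finite {v | dom z R v ∧ par τ v} := (finite_dom z R).subset fun v hv => hv.1
  have key := Nat.card_le_card_of_surjective f hf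
  rw [Finite.card_option] at key
  exact key

theorem kc_full_even (R : ℤ) (X : Set (ℤ × ℤ)) (hR : R % 2 = 0) (hX : ∀ s, act 0 R s → s ∈ X) :
    kc 0 R 0 X ≤ 1 := by
  have key : ∀ n : ℕ, ∀ v : ℤ × ℤ, (R - v.1 - v.2).toNat ≤ n →
      EqvGen (relc 0 R 0 X) v (out 0 R) := by
    intro n
    induction n with
    | zero =>
      intro v hv
      refine .rel _ _ (Or.inr ⟨fun h => ?_, fun h => not_dom_out _ _ h.1⟩)
      have := h.1
      unfold dom at this; simp at this; omega
    | succ n ih =>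
      intro v hv
      by_cases h : dom 0 R v ∧ par 0 v
      · refine .trans _ _ _ (.rel _ _ (Or.inl ⟨v, ?_, hX v ?_, ?_, rfl⟩)) (ih (e2 0 v) ?_)
        · unfold dom act par at *; simp at *; omega
        · unfold dom act par at *; simp at *; omega
        · have := h.2; unfold par at this; simp [e1]; intro h'; omega
        · have := h.1; have h2 := h.2; unfold par dom at *; simp [e2] at *
          rw [if_pos (by omega)]; simp; omega
      · exact .rel _ _ (Or.inr ⟨h, fun h => not_dom_out _ _ h.1⟩)
  have : Subsingleton (Quot (relc 0 R 0 X)) := ⟨by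
    rintro ⟨v⟩ ⟨w⟩
    exact Quot.eqvGen_sound (.trans _ _ _ (key _ v le_rfl) (.symm _ _ (key _ w le_rfl)))⟩
  exact Finite.card_le_one_iff_subsingleton.2 this

theorem kc_full_odd (R : ℤ) (X : Set (ℤ × ℤ)) (hR : R % 2 = 0) (hX : ∀ s, act 0 R s → s ∈ X) :
    kc 0 R 1 X ≤ 2 := by
  have key : ∀ n : ℕ, ∀ v : ℤ × ℤ, dom 0 R v ∧ par 1 v → (R - v.1).toNat ≤ n →
      EqvGen (relc 0 R 1 X) v (R - 1, 0) := by
    intro n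
    induction n with
    | zero =>
      intro v h hv
      unfold dom par at h; simp at h; omega
    | succ n ih =>
      intro v h hv
      by_cases h1 : v.1 + v.2 < R - 1
      · have e : e2 1 v = (v.1 + 1, v.2 + 1) := by
          have := h.2; unfold par at this; simp only [e2, if_pos this]
        refine .trans _ _ _ (.rel _ _ (Or.inl ⟨v, ?_, hX v ?_, ?_, rfl⟩)) (ih (e2 1 v) ?_ ?_)
        · unfold dom act par at *; simp at *; omega
        · unfold dom act par at *; simp at *; omega
        · have := h.2; unfold par at this; simp only [e1, if_pos this]
        · rw [e]; unfold dom par at *; simp at *; omega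
        · rw [e]; unfold dom par at *; simp at *; omega
      · by_cases h2 : v.1 - v.2 < R - 1
        · have h3 : ¬ (v.1 + (v.2 - 1) + 1) % 2 = 0 := by have := h.2; unfold par at this; omega
          have e : e1 1 (v.1, v.2 - 1) = (v.1 + 1, v.2 - 1) := by
            simp only [e1, if_neg h3]
          have e' : e2 1 (v.1, v.2 - 1) = v := by
            simp only [e2, if_neg h3]; simp
          refine .trans _ _ _ (.symm _ _ (.rel _ _ (Or.inl ⟨(v.1, v.2 - 1), ?_, hX _ ?_, rfl, e'.symm⟩)))
            (ih _ ?_ ?_)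
          · unfold dom act par at *; simp at *; omega
          · unfold dom act par at *; simp at *; omega
          · rw [e]; unfold dom par at *; simp at *; omega
          · rw [e]; unfold dom par at *; simp at *; omega
        · have : v = (R - 1, 0) := by
            unfold dom par at h; simp at h; ext <;> simp <;> omega
          rw [this]; exact .refl _
  have hs : Function.Surjective (fun b : Bool => Quot.mk (relc 0 R 1 X)
      (if b then (R - 1, 0) else out 0 R)) := by
    rintro ⟨v⟩
    by_cases h : dom 0 R v ∧ par 1 v
    · exact ⟨true, Quot.eqvGen_sound (.symm _ _ (key _ v h le_rfl))⟩
    · exact ⟨false, Quot.sound (Or.inr ⟨fun h => not_dom_out _ _ h.1, h⟩)⟩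
  have := Nat.card_le_card_of_surjective _ hs
  simpa [kc] using this

theorem card_act_lt (R : ℤ) (hR : R % 2 = 0) (h2 : 2 ≤ R) :
    {s | act 0 R s}.ncard + 1 ≤ {v | dom 0 R v}.ncard := by
  have hp : ((R - 1, 0) : ℤ × ℤ) ∈ {v | dom 0 R v} := by
    simp [dom]; omega
  rw [← Set.ncard_sdiff_singleton_add_one hp (finite_dom 0 R)]
  refine Nat.add_le_add_right (Set.ncard_le_ncard_of_injOn
    (fun s => if -R < s.1 + s.2 then s else (R - 1 + s.1, -s.1)) ?_ ?_
    ((finite_dom 0 R).subset Set.sdiff_subset)) 1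
  · rintro ⟨a, b⟩ h
    simp only [Set.mem_ofPred_eq, act, dom, Set.mem_sdiff, Set.mem_singleton_iff, Prod.fst_zero,
      Prod.snd_zero] at *
    split_ifs <;> simp only [Prod.mk.injEq] <;> omega
  · rintro ⟨a, b⟩ h ⟨c, d⟩ h' heq
    simp only [Set.mem_ofPred_eq, act, Prod.fst_zero, Prod.snd_zero] at *
    split_ifs at heq <;> simp only [Prod.mk.injEq] at * <;> omega

theorem card_dom_split (R : ℤ) : {v | dom 0 R v}.ncard =
    {v | dom 0 R v ∧ par 0 v}.ncard + {v | dom 0 R v ∧ par 1 v}.ncard := by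
  rw [← Set.ncard_union_eq ?_ ((finite_dom 0 R).subset fun v hv => hv.1)
    ((finite_dom 0 R).subset fun v hv => hv.1)]
  · congr 1; ext v
    have := par_compl 0 v
    simp only [sub_zero] at this
    simp only [Set.mem_ofPred_eq, Set.mem_union, this]
    tauto
  · rw [Set.disjoint_left]
    intro v h1 h2
    exact (par_compl 0 v).1 (by simpa using h2.2) h1.2

theorem euler_zero (R : ℤ) (hR : R % 2 = 0) (h2 : 2 ≤ R) (O : Set (ℤ × ℤ)) :
    jc 0 R 0 O = jc 0 R 0 ∅ + {s | act 0 R s ∧ s ∈ O}.ncard := by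
  have fa : {s | act 0 R s ∧ s ∈ O}.Finite := (finite_act 0 R).subset fun v hv => hv.1
  have fb : {s | act 0 R s ∧ s ∉ O}.Finite := (finite_act 0 R).subset fun v hv => hv.1
  have h1 := jc_union (z := 0) (τ := 0) hR ∅ fa.toFinset
  have h3 := jc_union (z := 0) (τ := 0) hR O fb.toFinset
  rw [← Set.ncard_eq_toFinset_card _ fa, Set.Finite.coe_toFinset,
    jc_congr (X := ∅ ∪ {s | act 0 R s ∧ s ∈ O}) (Y := O) (by simp; tauto)] at h1
  rw [← Set.ncard_eq_toFinset_card _ fb, Set.Finite.coe_toFinset,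
    jc_congr (X := O ∪ {s | act 0 R s ∧ s ∉ O}) (Y := Set.univ) (by simp; tauto)] at h3
  have hc : {s | act 0 R s}.ncard = {s | act 0 R s ∧ s ∈ O}.ncard +
      {s | act 0 R s ∧ s ∉ O}.ncard := by
    rw [← Set.ncard_union_eq _ fa fb]
    · congr 1; ext v; simp; tauto
    · rw [Set.disjoint_left]; exact fun v h1 h2 => h2.2 h1.2
  have k1 := kc_full_even R Set.univ hR (by simp)
  have k2 := kc_full_odd R Set.univ hR (by simp)
  have k3 := kc_empty_ge 0 R 0 ∅ (by simp)
  have k4 := kc_empty_ge 0 R 1 ∅ (by simp)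
  have c1 := card_act_lt R hR h2
  have c2 := card_dom_split R
  have ju : jc 0 R 0 Set.univ = kc 0 R 1 ∅ - kc 0 R 0 Set.univ := by simp [jc]
  have je : jc 0 R 0 ∅ = kc 0 R 1 Set.univ - kc 0 R 0 ∅ := by simp [jc]
  omega

theorem euler (R : ℤ) (hR : R % 2 = 0) (h2 : 2 ≤ R) (τ : ℤ) (hτ : τ = 0 ∨ τ = 1) :
    ∃ c : ℤ, ∀ O, jc 0 R τ O = c + {s | act 0 R s ∧ s ∈ O}.ncard := by
  rcases hτ with rfl | rfl
  · exact ⟨_, euler_zero R hR h2⟩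
  · refine ⟨-jc 0 R 0 ∅ - {s | act 0 R s}.ncard, fun O => ?_⟩
    have h := euler_zero R hR h2 Oᶜ
    have fa : {s | act 0 R s ∧ s ∈ O}.Finite := (finite_act 0 R).subset fun v hv => hv.1
    have fb : {s | act 0 R s ∧ s ∈ Oᶜ}.Finite := (finite_act 0 R).subset fun v hv => hv.1
    have hc : {s | act 0 R s}.ncard = {s | act 0 R s ∧ s ∈ O}.ncard +
        {s | act 0 R s ∧ s ∈ Oᶜ}.ncard := by
      rw [← Set.ncard_union_eq _ fa fb]
      · congr 1; ext v; simp; tauto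
      · rw [Set.disjoint_left]; exact fun v h1 h2 => h2.2 h1.2
    have : jc 0 R 1 O = - jc 0 R 0 Oᶜ := by simp [jc]
    omega

theorem rel_le_relc {z : ℤ × ℤ} {R τ : ℤ} {O : Set (ℤ × ℤ)} {x y : ℤ × ℤ}
    (h : rel z R τ O x y) : relc z R τ O x y := by
  rcases h with ⟨s, h1, h2, rfl, rfl⟩ | ⟨s, h1, h2, rfl, rfl⟩ | ⟨h1, h2⟩
  · exact Or.inl ⟨s, h1, h2, rfl, rfl⟩
  · exact Or.inr ⟨fun h => (par_compl _ _).1 (par_e1 _ _) h.2,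
      fun h => (par_compl _ _).1 (par_e2 _ _) h.2⟩
  · exact Or.inr ⟨fun h => h1 h.1, fun h => h2 h.1⟩

theorem rel_swap (z : ℤ × ℤ) (R τ : ℤ) (O : Set (ℤ × ℤ)) :
    rel z R (1 - τ) Oᶜ = rel z R τ O := by
  funext v w
  simp only [rel, Set.mem_compl_iff, not_not, sub_sub_cancel]
  exact propext or_left_comm

theorem relc_lift {z : ℤ × ℤ} {R τ : ℤ} {O : Set (ℤ × ℤ)} {x y : ℤ × ℤ}
    (hx : dom z R x → par τ x) (hy : dom z R y → par τ y) (h : EqvGen (relc z R τ O) x y) :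
    EqvGen (rel z R τ O) x y := by
  let π : ℤ × ℤ → ℤ × ℤ := fun v => if dom z R v ∧ par τ v then v else out z R
  have hd : ∀ x, (dom z R x → par τ x) → EqvGen (rel z R τ O) (π x) x := by
    intro x hx
    by_cases h : dom z R x
    · simp only [π, h, hx h, and_self, if_true]; exact .refl _
    · simp only [π, h, false_and, if_false]
      exact .rel _ _ (Or.inr (Or.inr ⟨not_dom_out z R, h⟩))
  refine .trans _ _ _ (.symm _ _ (hd x hx)) (.trans _ _ _ (eqvGen_lift π ?_ h) (hd y hy))
  rintro x y (⟨s, h1, h2, rfl, rfl⟩ | ⟨h1, h2⟩)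
  · exact .trans _ _ _ (hd _ fun _ => par_e1 _ _) (.trans _ _ _
      (.rel _ _ (Or.inl ⟨s, h1, h2, rfl, rfl⟩)) (.symm _ _ (hd _ fun _ => par_e2 _ _)))
  · simp only [π, h1, h2, if_false]; exact .refl _

/-- Vertices of class `τ` are connected in `rel` iff they are connected in `relc`. -/
theorem rel_iff_relc {z : ℤ × ℤ} {R τ : ℤ} {O : Set (ℤ × ℤ)} {x y : ℤ × ℤ}
    (hx : dom z R x → par τ x) (hy : dom z R y → par τ y) :
    EqvGen (rel z R τ O) x y ↔ EqvGen (relc z R τ O) x y :=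
  ⟨eqvGen_le fun _ _ h => .rel _ _ (rel_le_relc h), relc_lift hx hy⟩

theorem ncard_image_relc {z : ℤ × ℤ} {R τ : ℤ} {O : Set (ℤ × ℤ)} {N : Set (ℤ × ℤ)}
    (hN : ∀ x ∈ N, dom z R x → par τ x) :
    (Quot.mk (rel z R τ O) '' N).ncard = (Quot.mk (relc z R τ O) '' N).ncard := by
  let g : Quot (rel z R τ O) → Quot (relc z R τ O) :=
    Quot.lift (Quot.mk _) (fun a b h => Quot.sound (rel_le_relc h))
  have ginj : Set.InjOn g (Quot.mk _ '' N) := by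
    rintro _ ⟨x, hx, rfl⟩ _ ⟨y, hy, rfl⟩ hxy
    exact Quot.eqvGen_sound (relc_lift (hN x hx) (hN y hy) ((mk_eq_iff _).1 hxy))
  rw [← Set.InjOn.ncard_image ginj, Set.image_image]

theorem kappa_add_one (z : ℤ × ℤ) (R τ : ℤ) (O : Set (ℤ × ℤ)) :
    Nat.card (Quot (rel z R τ O)) + 1 = kc z R τ O + kc z R (1 - τ) Oᶜ := by
  set N := {v | ¬ (dom z R v ∧ par τ v)} with hNdef
  have key := card_collapse (rel z R τ O) (relc z R τ O) N
    ⟨out z R, fun h => not_dom_out z R h.1⟩ ?_ (fun _ _ h => .rel _ _ (rel_le_relc h))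
    (fun x hx y hy => .rel _ _ (Or.inr ⟨hx, hy⟩))
  · have hN : ∀ x ∈ N, dom z R x → par (1 - τ) x := fun x hx h =>
      (par_compl _ _).2 fun hp => hx ⟨h, hp⟩
    have e := ncard_image_relc (O := Oᶜ) hN
    rw [rel_swap] at e
    have hu : Quot.mk (relc z R (1 - τ) Oᶜ) '' N = Set.univ := by
      refine Set.eq_univ_of_forall ?_
      rintro ⟨x⟩
      by_cases h : dom z R x ∧ par (1 - τ) x
      · exact ⟨x, fun h' => (par_compl _ _).1 h.2 h'.2, rfl⟩
      · exact ⟨out z R, fun h' => not_dom_out z R h'.1,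
          Quot.sound (Or.inr ⟨fun h' => not_dom_out z R h'.1, h⟩)⟩
    rw [key, e, kc, kc, hu, Set.ncard_univ]
  · rintro x y (⟨s, h1, h2, rfl, rfl⟩ | ⟨h1, h2⟩)
    · exact Or.inl (.rel _ _ (Or.inl ⟨s, h1, h2, rfl, rfl⟩))
    · exact Or.inr ⟨⟨x, h1, .refl _⟩, ⟨y, h2, .refl _⟩⟩

theorem exists_primitive (f : ℤ → ℤ) : ∃ F : ℤ → ℤ, ∀ a, F (a + 1) - F a = f a := by
  refine ⟨fun a => ∑ k ∈ Finset.range a.toNat, f k -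
    ∑ k ∈ Finset.range (-a).toNat, f (-(k : ℤ) - 1), fun a => ?_⟩
  rcases le_or_gt 0 a with h | h
  · obtain ⟨n, rfl⟩ := Int.eq_ofNat_of_zero_le h
    have h1 : ((n : ℤ) + 1).toNat = n + 1 := by omega
    have h2 : (-((n : ℤ) + 1)).toNat = 0 := by omega
    have h3 : (-(n : ℤ)).toNat = 0 := by omega
    have h4 : (n : ℤ).toNat = n := by omega
    simp only [h1, h2, h3, h4, Finset.sum_range_succ, Finset.sum_range_zero]
    ring
  · obtain ⟨n, rfl⟩ : ∃ n : ℕ, a = -(n : ℤ) - 1 := ⟨(-a - 1).toNat, by omega⟩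
    have h1 : (-(n : ℤ) - 1 + 1).toNat = 0 := by omega
    have h2 : (-(-(n : ℤ) - 1)).toNat = n + 1 := by omega
    have h3 : (-(-(n : ℤ) - 1 + 1)).toNat = n := by omega
    have h4 : (-(n : ℤ) - 1).toNat = 0 := by omega
    simp only [h1, h2, h3, h4, Finset.sum_range_succ, Finset.sum_range_zero]
    ring

/-- A closed discrete form on `ℤ²` is exact. -/
theorem exists_potential (α β : ℤ → ℤ → ℤ)
    (h : ∀ a b, α a b + β (a + 1) b = β a b + α a (b + 1)) :
    ∃ F : ℤ × ℤ → ℤ, (∀ a b, F (a + 1, b) - F (a, b) = α a b) ∧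
      ∀ a b, F (a, b + 1) - F (a, b) = β a b := by
  obtain ⟨A, hA⟩ := exists_primitive fun a => α a 0
  choose B hB using fun a => exists_primitive fun b => β a b
  refine ⟨fun v => A v.1 + (B v.1 v.2 - B v.1 0), ?_, ?_⟩
  · intro a b
    induction b using Int.induction_on with
    | zero => have := hA a; simp only; linarith
    | succ b ih =>
      have h1 := hB a b; have h2 := hB (a + 1) b; have h3 := h a b
      simp only at ih ⊢; linarith
    | pred b ih =>
      have h1 := hB a (-(b : ℤ) - 1); have h2 := hB (a + 1) (-(b : ℤ) - 1); have h3 := h a (-(b : ℤ) - 1)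
      simp only [sub_add_cancel] at *; linarith
  · intro a b
    have := hB a b; simp only; linarith

/-- Nearest neighbours in `ℤ²`. -/
def nn (v w : ℤ × ℤ) : Prop :=
  w = (v.1 + 1, v.2) ∨ w = (v.1 - 1, v.2) ∨ w = (v.1, v.2 + 1) ∨ w = (v.1, v.2 - 1)

theorem nn_symm {v w : ℤ × ℤ} (h : nn v w) : nn w v := by
  rcases h with rfl | rfl | rfl | rfl <;> simp [nn]

theorem const_right {A : Type*} (R : ℤ) (h : ℤ × ℤ → A)
    (hh : ∀ v w, nn v w → ¬ dom 0 R v → ¬ dom 0 R w → h v = h w) :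
    ∀ n : ℕ, ∀ v : ℤ × ℤ, v.2.natAbs ≤ n → R ≤ v.1 + v.2 ∨ R ≤ v.1 - v.2 → h v = h (R, 0) := by
  have dn : ∀ v : ℤ × ℤ, R ≤ v.1 + v.2 ∨ R ≤ v.1 - v.2 → ¬ dom 0 R v := by
    intro v hv; unfold dom; simp; omega
  intro n
  induction n with
  | zero =>
    rintro ⟨a, b⟩ h1 h2
    have hb : b = 0 := by simpa using h1
    subst hb
    obtain ⟨m, rfl⟩ : ∃ m : ℕ, a = R + m := ⟨(a - R).toNat, by simp at h2; omega⟩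
    clear h1 h2
    induction m with
    | zero => simp
    | succ m ih =>
      rw [← ih]
      refine hh _ _ (Or.inr (Or.inl ?_)) (dn _ ?_) (dn _ ?_)
      · simp; ring
      · left; simp only; omega
      · left; simp only; omega
  | succ n ih =>
    rintro ⟨a, b⟩ h1 h2
    simp only at h1 h2
    rcases lt_trichotomy b 0 with hb | rfl | hb
    · rw [← ih (a + 1, b + 1) (by simp only; omega) (by right; simp only; omega)]
      rw [hh (a, b) (a + 1, b) (Or.inl rfl) (dn _ h2) (dn _ (by simp only; omega))]
      exact hh _ _ (Or.inr (Or.inr (Or.inl rfl))) (dn _ (by simp only; omega))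
        (dn _ (by simp only; omega))
    · exact ih _ (by simp) h2
    · rw [← ih (a + 1, b - 1) (by simp only; omega) (by left; simp only; omega)]
      rw [hh (a, b) (a + 1, b) (Or.inl rfl) (dn _ h2) (dn _ (by simp only; omega))]
      exact hh _ _ (Or.inr (Or.inr (Or.inr rfl))) (dn _ (by simp only; omega))
        (dn _ (by simp only; omega))

/-- The complement of the tilted square is connected. -/
theorem const_out {A : Type*} {R : ℤ} (h : ℤ × ℤ → A)
    (hh : ∀ v w, nn v w → ¬ dom 0 R v → ¬ dom 0 R w → h v = h w) (v w : ℤ × ℤ)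
    (hv : ¬ dom 0 R v) (hw : ¬ dom 0 R w) : h v = h w := by
  have hr := const_right R h hh
  have hl := const_right R (fun v => h (-v.1, v.2)) (by
    intro v w hvw h1 h2
    refine hh _ _ ?_ ?_ ?_
    · rcases hvw with rfl | rfl | rfl | rfl <;> simp [nn] <;> omega
    · unfold dom at *; simp at *; omega
    · unfold dom at *; simp at *; omega)
  have key : ∀ v, ¬ dom 0 R v → h v = h (R, 0) := by
    rintro ⟨a, b⟩ hv
    by_cases hc : R ≤ a + b ∨ R ≤ a - b
    · exact hr _ _ le_rfl hc
    · have h1 := hl _ (-a, b) le_rfl (by unfold dom at hv; simp at *; omega)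
      have h2 := hl _ (0, R) le_rfl (by left; simp)
      have h3 := hr _ (0, R) le_rfl (by left; simp)
      simp only [neg_neg, neg_zero] at h1 h2
      rw [h1, ← h2, h3]
  rw [key v hv, key w hw]

abbrev Cl (R : ℤ) (O : Set (ℤ × ℤ)) := Quot (rel 0 R 0 O)

abbrev cl (R : ℤ) (O : Set (ℤ × ℤ)) (v : ℤ × ℤ) : Cl R O := Quot.mk _ v

def clRoot (R : ℤ) (O : Set (ℤ × ℤ)) : Cl R O := Quot.mk _ (out 0 R)

theorem cl_eq_root {R : ℤ} {O : Set (ℤ × ℤ)} {v : ℤ × ℤ} (h : ¬ dom 0 R v) : cl R O v = clRoot R O :=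
  Quot.sound (Or.inr (Or.inr ⟨h, not_dom_out _ _⟩))

/-- In every unit square one of the two diagonals joins equivalent vertices. -/
theorem square_cl {R : ℤ} (hR : R % 2 = 0) (O : Set (ℤ × ℤ)) (s : ℤ × ℤ) :
    cl R O s = cl R O (s.1 + 1, s.2 + 1) ∨ cl R O (s.1 + 1, s.2) = cl R O (s.1, s.2 + 1) := by
  have key : ∃ τ, cl R O (e1 τ s) = cl R O (e2 τ s) := by
    by_cases h : act 0 R s
    · by_cases hO : s ∈ O
      · exact ⟨0, Quot.sound (Or.inl ⟨s, h, hO, rfl, rfl⟩)⟩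
      · exact ⟨1, Quot.sound (Or.inr (Or.inl ⟨s, h, hO, rfl, rfl⟩))⟩
    · have := not_act_out (τ := 0) hR (by simp [par]) h
      exact ⟨0, by rw [cl_eq_root this.1, cl_eq_root this.2]⟩
  obtain ⟨τ, h⟩ := key
  unfold e1 e2 at h
  split_ifs at h
  · exact Or.inl h
  · exact Or.inr h

/-- The graph of adjacent classes. -/
def tree (R : ℤ) (O : Set (ℤ × ℤ)) : SimpleGraph (Cl R O) where
  Adj c d := c ≠ d ∧ ∃ v w, nn v w ∧ cl R O v = c ∧ cl R O w = d
  symm := ⟨fun _ _ ⟨h, v, w, h1, h2, h3⟩ => ⟨h.symm, w, v, nn_symm h1, h3, h2⟩⟩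
  loopless := ⟨fun _ h => h.1 rfl⟩

theorem diag_eq {A : Type*} [AddCommGroup A] {R : ℤ} (O : Set (ℤ × ℤ)) (h : ℤ × ℤ → A)
    (θ : Cl R O → Cl R O → A) (hθ : ∀ x y, θ x y = - θ y x)
    (hh : ∀ v w, nn v w → h w - h v = θ (cl R O v) (cl R O w)) (τ : ℤ) (s : ℤ × ℤ)
    (hs : cl R O (e1 τ s) = cl R O (e2 τ s)) : h (e1 τ s) = h (e2 τ s) := by
  have key : ∃ x, nn (e1 τ s) x ∧ nn x (e2 τ s) := by
    unfold e1 e2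
    split_ifs
    · exact ⟨(s.1 + 1, s.2), Or.inl rfl, Or.inr (Or.inr (Or.inl rfl))⟩
    · exact ⟨s, Or.inr (Or.inl (by simp)), Or.inr (Or.inr (Or.inl rfl))⟩
  obtain ⟨x, h1, h2⟩ := key
  have a := hh _ _ h1
  have b := hh _ _ h2
  rw [← hs, hθ, ← a] at b
  have : h (e2 τ s) - h x + (h x - h (e1 τ s)) = 0 := by rw [b]; abel
  rw [sub_add_sub_cancel, sub_eq_zero] at this
  exact this.symm

theorem tree_connected (R : ℤ) (O : Set (ℤ × ℤ)) : (tree R O).Connected := by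
  have step : ∀ v w, nn v w → (tree R O).Reachable (cl R O v) (cl R O w) := by
    intro v w h
    by_cases he : cl R O v = cl R O w
    · rw [he]
    · exact SimpleGraph.Adj.reachable ⟨he, v, w, h, rfl, rfl⟩
  have key : ∀ a b : ℤ, (tree R O).Reachable (cl R O (0, 0)) (cl R O (a, b)) := by
    intro a b
    have h1 : (tree R O).Reachable (cl R O (0, 0)) (cl R O (a, 0)) := by
      induction a using Int.induction_on with
      | zero => exact .refl _
      | succ n ih => exact ih.trans (step _ _ (Or.inl rfl))
      | pred n ih => exact ih.trans (step _ _ (Or.inr (Or.inl rfl)))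
    induction b using Int.induction_on with
    | zero => exact h1
    | succ n ih => exact ih.trans (step _ _ (Or.inr (Or.inr (Or.inl rfl))))
    | pred n ih => exact ih.trans (step _ _ (Or.inr (Or.inr (Or.inr rfl))))
  have : Nonempty (Cl R O) := ⟨clRoot R O⟩
  refine ⟨?_⟩
  rintro ⟨a, b⟩ ⟨c, d⟩
  exact (key a b).symm.trans (key c d)

/-- An antisymmetric function of adjacent classes is a gradient. -/
theorem exists_gradient {R : ℤ} (hR : R % 2 = 0) (O : Set (ℤ × ℤ))
    (θ : Cl R O → Cl R O → ℤ) (hθ : ∀ x y, θ x y = - θ y x) :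
    ∃ g : Cl R O → ℤ, ∀ c d, (tree R O).Adj c d → g d - g c = θ c d := by
  obtain ⟨h, ha, hb⟩ := exists_potential (fun a b => θ (cl R O (a, b)) (cl R O (a + 1, b)))
    (fun a b => θ (cl R O (a, b)) (cl R O (a, b + 1))) (by
      intro a b
      rcases square_cl hR O (a, b) with h | h
      · simp only at h
        rw [h, hθ _ (cl R O (a + 1, b)), hθ _ (cl R O (a, b + 1))]; simp
      · simp only at h
        rw [h])
  have hh : ∀ v w, nn v w → h w - h v = θ (cl R O v) (cl R O w) := by
    rintro ⟨a, b⟩ w (rfl | rfl | rfl | rfl)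
    · exact ha a b
    · have := ha (a - 1) b
      rw [hθ, sub_add_cancel] at this
      simp only; linarith
    · exact hb a b
    · have := hb a (b - 1)
      rw [hθ, sub_add_cancel] at this
      simp only; linarith
  have θ0 : ∀ x, θ x x = 0 := fun x => by have := hθ x x; omega
  have hc : ∀ v w, rel 0 R 0 O v w → h v = h w := by
    intro v w hvw
    have hq : cl R O v = cl R O w := Quot.sound hvw
    rcases hvw with ⟨s, -, -, rfl, rfl⟩ | ⟨s, -, -, rfl, rfl⟩ | ⟨h1, h2⟩
    · exact diag_eq O h θ hθ hh _ _ hq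
    · exact diag_eq O h θ hθ hh _ _ hq
    · refine const_out h ?_ v w h1 h2
      intro v w hvw h1 h2
      have := hh v w hvw
      rw [cl_eq_root h1, cl_eq_root h2, θ0] at this
      omega
  refine ⟨Quot.lift h hc, ?_⟩
  rintro c d ⟨-, v, w, hvw, rfl, rfl⟩
  exact hh v w hvw

theorem tree_isTree {R : ℤ} (hR : R % 2 = 0) (O : Set (ℤ × ℤ)) : (tree R O).IsTree := by
  refine ⟨tree_connected R O, SimpleGraph.isAcyclic_iff_forall_adj_isBridge.2 ?_⟩
  intro c d hcd
  obtain ⟨g, hg⟩ := exists_gradient hR O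
    (fun x y => (if x = c ∧ y = d then 1 else 0) - (if y = c ∧ x = d then 1 else 0))
    (by intro x y; ring)
  rw [SimpleGraph.isBridge_iff]
  have key : ∀ x y, ((tree R O).deleteEdges {s(c, d)}).Reachable x y → g x = g y := by
    rintro x y ⟨p⟩
    induction p with
    | nil => rfl
    | cons h p ih =>
      rw [← ih]
      rw [SimpleGraph.deleteEdges_adj] at h
      have h1 := hg _ _ h.1
      have h2 := h.2
      simp only [Set.mem_singleton_iff, Sym2.eq_iff, not_or] at h2
      rw [if_neg h2.1, if_neg (fun h' => h2.2 ⟨h'.2, h'.1⟩)] at h1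
      omega
  intro hr
  have h1 := hg _ _ hcd
  have h2 := key _ _ hr
  rw [if_pos ⟨rfl, rfl⟩, if_neg (fun h => hcd.1 h.1.symm)] at h1
  omega

theorem tree_parent {C : Type*} {G : SimpleGraph C} (hG : G.IsTree) (ρ : C) :
    ∃ p : C → C, p ρ = ρ ∧ (∀ c, c ≠ ρ → G.Adj c (p c) ∧ G.dist ρ c = G.dist ρ (p c) + 1) ∧
      ∀ c d, G.Adj c d → (c ≠ ρ ∧ d = p c) ∨ (d ≠ ρ ∧ c = p d) := by
  have hc : G.Connected := hG.1
  choose P hP hl using fun c => hc.exists_path_of_dist ρ c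
  have pen : ∀ c d, G.Adj c d → G.dist ρ d = G.dist ρ c + 1 → c = (P d).penultimate := by
    intro c d h hd
    have hq : ((P c).concat h).IsPath := SimpleGraph.Walk.isPath_of_length_eq_dist _ (by
      rw [SimpleGraph.Walk.length_concat, hl, hd])
    have := (hG.2.subsingleton_path ρ d).elim ⟨_, hq⟩ ⟨_, hP d⟩
    have := congrArg (fun p : G.Path ρ d => p.1.penultimate) this
    simpa using this
  refine ⟨fun c => if c = ρ then ρ else (P c).penultimate, if_pos rfl, ?_, ?_⟩
  · intro c hne
    simp only [if_neg hne]
    have hn : ¬ (P c).Nil := fun h => hne h.eq.symm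
    have hadj := (P c).adj_penultimate hn
    refine ⟨hadj.symm, ?_⟩
    have h1 := SimpleGraph.dist_le (P c).dropLast
    have h2 := (P c).length_dropLast_add_one hn
    rw [hl] at h2
    rcases hG.dist_eq_dist_add_one_of_adj ρ hadj with h | h <;> omega
  · intro c d h
    rcases hG.dist_eq_dist_add_one_of_adj ρ h with h' | h'
    · have hc : c ≠ ρ := by rintro rfl; simp at h'
      exact Or.inl ⟨hc, by simp only [if_neg hc]; exact pen _ _ h.symm h'⟩
    · have hd : d ≠ ρ := by rintro rfl; simp at h'
      exact Or.inr ⟨hd, by simp only [if_neg hd]; exact pen _ _ h h'⟩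

theorem nn_par {τ : ℤ} {v w : ℤ × ℤ} (h : nn v w) (hv : par τ v) : par (1 - τ) w := by
  unfold par at *
  rcases h with rfl | rfl | rfl | rfl <;> simp only <;> omega

theorem nn_e1 (τ : ℤ) (s : ℤ × ℤ) :
    nn (e1 τ s) (e1 (1 - τ) s) ∧ nn (e1 τ s) (e2 (1 - τ) s) ∧
    nn (e2 τ s) (e1 (1 - τ) s) ∧ nn (e2 τ s) (e2 (1 - τ) s) := by
  unfold e1 e2 nn
  split_ifs <;> first | omega | simp

/-- The diagonals of the other class in the four squares around a vertex form a cycle through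
its neighbours. -/
theorem nbrs_linked {τ : ℤ} {w : ℤ × ℤ} (hw : par τ w) (P : ℤ × ℤ → ℤ × ℤ → Prop)
    (hP : ∀ s, w = e1 τ s ∨ w = e2 τ s → EqvGen P (e1 (1 - τ) s) (e2 (1 - τ) s))
    {x y : ℤ × ℤ} (hx : nn w x) (hy : nn w y) : EqvGen P x y := by
  obtain ⟨a, b⟩ := w
  unfold par at hw
  simp only at hw
  have h1 : EqvGen P (a + 1, b) (a, b + 1) := by
    have := hP (a, b) (Or.inl (by simp [e1, hw]))
    simp only [e1, e2] at this
    rwa [if_neg (by omega), if_neg (by omega)] at this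
  have h2 : EqvGen P (a, b - 1) (a - 1, b) := by
    have := hP (a - 1, b - 1) (Or.inr (by simp only [e2]; rw [if_pos (by omega)]; simp))
    simp only [e1, e2] at this
    rwa [if_neg (by omega), if_neg (by omega), sub_add_cancel, sub_add_cancel] at this
  have h3 : EqvGen P (a - 1, b) (a, b + 1) := by
    have := hP (a - 1, b) (Or.inl (by simp only [e1]; rw [if_neg (by omega)]; simp))
    simp only [e1, e2] at this
    rwa [if_pos (by omega), if_pos (by omega), sub_add_cancel] at this
  have h4 : EqvGen P (a, b - 1) (a + 1, b) := by
    have := hP (a, b - 1) (Or.inr (by simp only [e2]; rw [if_neg (by omega)]; simp))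
    simp only [e1, e2] at this
    rwa [if_pos (by omega), if_pos (by omega), sub_add_cancel] at this
  have key : ∀ x, nn (a, b) x → EqvGen P (a, b + 1) x := by
    rintro x (rfl | rfl | rfl | rfl)
    · exact h1.symm
    · exact h3.symm
    · exact .refl _
    · exact .trans _ _ _ h1.symm h4.symm
  exact (key x hx).symm.trans _ _ _ (key y hy)

theorem degree_formula {R : ℤ} (hR : R % 2 = 0) (h2R : 2 ≤ R) {τ : ℤ} (hτ : τ = 0 ∨ τ = 1)
    (X : Set (ℤ × ℤ)) (x0 : ℤ × ℤ)
    (hW : ∀ v, EqvGen (rel 0 R τ X) x0 v → dom 0 R v ∧ par τ v) :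
    {v | EqvGen (rel 0 R τ X) x0 v}.ncard +
      (Quot.mk (rel 0 R τ X) '' {v | ∃ w, EqvGen (rel 0 R τ X) x0 w ∧ nn w v}).ncard =
    {s | act 0 R s ∧ s ∈ X ∧ EqvGen (rel 0 R τ X) x0 (e1 τ s)}.ncard + 2 := by
  set W := {v | EqvGen (rel 0 R τ X) x0 v} with hWdef
  set N := {v | ∃ w, EqvGen (rel 0 R τ X) x0 w ∧ nn w v} with hN
  set E := {s | act 0 R s ∧ s ∈ X ∧ EqvGen (rel 0 R τ X) x0 (e1 τ s)} with hE
  have x0W : x0 ∈ W := .refl _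
  have edgeW : ∀ s, act 0 R s → s ∈ X → (e1 τ s ∈ W ↔ e2 τ s ∈ W) := by
    intro s h1 h2
    have h : EqvGen (rel 0 R τ X) (e1 τ s) (e2 τ s) := .rel _ _ (Or.inl ⟨s, h1, h2, rfl, rfl⟩)
    exact ⟨fun h' => .trans _ _ _ h' h, fun h' => .trans _ _ _ h' h.symm⟩
  have hNW : ∀ v ∈ N, dom 0 R v → par (1 - τ) v := by
    rintro v ⟨w, hw, h⟩ -
    exact nn_par h (hW w hw).2
  have ha : kc 0 R τ (X \ E) + 1 = kc 0 R τ X + W.ncard := by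
    have hinj : Set.InjOn (Quot.mk (relc 0 R τ (X \ E))) W := by
      intro v hv w hw hvw
      have := eqvGen_const (fun v => if v ∈ W then some v else none) ?_ ((mk_eq_iff _).1 hvw)
      · simpa [hv, hw] using this
      · rintro x y (⟨s, h1, h2, rfl, rfl⟩ | ⟨h1, h2⟩)
        · have h3 : e1 τ s ∉ W := fun h => h2.2 ⟨h1, h2.1, h⟩
          have h4 : e2 τ s ∉ W := fun h => h3 ((edgeW s h1 h2.1).2 h)
          simp only [h3, h4, if_false]
        · have h3 : x ∉ W := fun h => h1 (hW x h)
          have h4 : y ∉ W := fun h => h2 (hW y h)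
          simp only [h3, h4, if_false]
    rw [← Set.InjOn.ncard_image hinj]
    refine card_collapse _ _ W ⟨x0, x0W⟩ ?_ ?_ ?_
    · rintro x y (⟨s, h1, h2, rfl, rfl⟩ | h)
      · by_cases hs : s ∈ E
        · exact Or.inr ⟨⟨_, hs.2.2, .refl _⟩, ⟨_, (edgeW s h1 h2).1 hs.2.2, .refl _⟩⟩
        · exact Or.inl (.rel _ _ (Or.inl ⟨s, h1, ⟨h2, hs⟩, rfl, rfl⟩))
      · exact Or.inl (.rel _ _ (Or.inr h))
    · exact fun x y h => .rel _ _ (relc_mono Set.sdiff_subset h)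
    · intro x hx y hy
      exact eqvGen_le (fun _ _ h => .rel _ _ (rel_le_relc h)) (.trans _ _ _ hx.symm hy)
  have hlink : ∀ w ∈ W, ∀ s, w = e1 τ s ∨ w = e2 τ s →
      EqvGen (relc 0 R (1 - τ) (X \ E)ᶜ) (e1 (1 - τ) s) (e2 (1 - τ) s) := by
    intro w hw s hs
    by_cases hact : act 0 R s
    · refine .rel _ _ (Or.inl ⟨s, hact, ?_, rfl, rfl⟩)
      rintro ⟨h1, h2⟩
      refine h2 ⟨hact, h1, ?_⟩
      rcases hs with rfl | rfl
      · exact hw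
      · exact (edgeW s hact h1).2 hw
    · by_cases hz : par τ 0
      · have h1 := not_act_out hR hz hact
        have h2 := (hW w hw).1
        rcases hs with rfl | rfl
        · exact absurd h2 h1.1
        · exact absurd h2 h1.2
      · have h1 := not_act_out hR ((par_compl _ _).2 hz) hact
        exact .rel _ _ (Or.inr ⟨fun h => h1.1 h.1, fun h => h1.2 h.1⟩)
  have hnb : ∀ w ∈ W, ∀ x y, nn w x → nn w y → EqvGen (relc 0 R (1 - τ) (X \ E)ᶜ) x y :=
    fun w hw x y hx hy => nbrs_linked (hW w hw).2 _ (hlink w hw) hx hy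
  have hconn : ∀ x y, EqvGen (rel 0 R τ X) x y → x ∈ W →
      EqvGen (relc 0 R (1 - τ) (X \ E)ᶜ) (x.1 + 1, x.2) (y.1 + 1, y.2) := by
    intro x y h
    induction h with
    | rel x y h =>
      intro hx
      rcases h with ⟨s, h1, h2, rfl, rfl⟩ | ⟨s, h1, h2, rfl, rfl⟩ | ⟨h1, h2⟩
      · have hy := (edgeW s h1 h2).1 hx
        have := nn_e1 τ s
        exact .trans _ _ _ (hnb _ hx _ _ (Or.inl rfl) this.1)
          (hnb _ hy _ _ this.2.2.1 (Or.inl rfl))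
      · exact absurd (hW _ hx).2 ((par_compl _ _).1 (par_e1 _ _))
      · exact absurd (hW _ hx).1 h1
    | refl x => exact fun _ => .refl _
    | symm x y h ih => exact fun hy => (ih (.trans _ _ _ hy h.symm)).symm
    | trans x y z h1 h2 ih1 ih2 =>
      exact fun hx => .trans _ _ _ (ih1 hx) (ih2 (.trans _ _ _ hx h1))
  have hb : kc 0 R (1 - τ) Xᶜ + 1 = kc 0 R (1 - τ) (X \ E)ᶜ +
      (Quot.mk (rel 0 R τ X) '' N).ncard := by
    rw [← rel_swap, ncard_image_relc hNW]
    refine card_collapse _ _ N ⟨(x0.1 + 1, x0.2), x0, x0W, Or.inl rfl⟩ ?_ ?_ ?_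
    · rintro x y (⟨s, h1, h2, rfl, rfl⟩ | h)
      · by_cases hs : s ∈ E
        · have := nn_e1 τ s
          exact Or.inr ⟨⟨_, ⟨_, hs.2.2, this.1⟩, .refl _⟩, ⟨_, ⟨_, hs.2.2, this.2.1⟩, .refl _⟩⟩
        · exact Or.inl (.rel _ _ (Or.inl ⟨s, h1, fun h => h2 ⟨h, hs⟩, rfl, rfl⟩))
      · exact Or.inl (.rel _ _ (Or.inr h))
    · exact fun x y h => .rel _ _ (relc_mono (Set.compl_subset_compl.2 Set.sdiff_subset) h)
    · rintro x ⟨v, hv, hx⟩ y ⟨w, hw, hy⟩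
      exact .trans _ _ _ (hnb v hv _ _ hx (Or.inl rfl)) (.trans _ _ _
        (hconn v w (.trans _ _ _ hv.symm hw) hv) (hnb w hw _ _ (Or.inl rfl) hy))
  obtain ⟨c, hc⟩ := euler R hR h2R τ hτ
  have e1 := hc X
  have e2 := hc (X \ E)
  have e3 : {s | act 0 R s ∧ s ∈ X}.ncard = {s | act 0 R s ∧ s ∈ X \ E}.ncard + E.ncard := by
    rw [← Set.ncard_union_eq ?_ ((finite_act 0 R).subset fun v hv => hv.1)
      ((finite_act 0 R).subset fun v hv => hv.1)]
    · congr 1; ext s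
      simp only [Set.mem_ofPred_eq, Set.mem_union, Set.mem_sdiff, hE]
      tauto
    · rw [Set.disjoint_left]
      exact fun s h1 h2 => h1.2.2 h2
  unfold jc at e1 e2
  omega

noncomputable def domF (z : ℤ × ℤ) (R : ℤ) : Finset (ℤ × ℤ) := (finite_dom z R).toFinset

noncomputable def actF (z : ℤ × ℤ) (R : ℤ) : Finset (ℤ × ℤ) := (finite_act z R).toFinset

@[simp] theorem mem_domF {z : ℤ × ℤ} {R : ℤ} {v : ℤ × ℤ} : v ∈ domF z R ↔ dom z R v := by
  simp [domF]

@[simp] theorem mem_actF {z : ℤ × ℤ} {R : ℤ} {v : ℤ × ℤ} : v ∈ actF z R ↔ act z R v := by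
  simp [actF]

/-- First end of the open diagonal of the square `s`. -/
noncomputable def opn (O : Set (ℤ × ℤ)) (s : ℤ × ℤ) : ℤ × ℤ := if s ∈ O then e1 0 s else e1 1 s

/-- Second end of the open diagonal of the square `s`. -/
noncomputable def opn' (O : Set (ℤ × ℤ)) (s : ℤ × ℤ) : ℤ × ℤ := if s ∈ O then e2 0 s else e2 1 s

theorem rel_opn {R : ℤ} {O : Set (ℤ × ℤ)} {s : ℤ × ℤ} (hs : act 0 R s) :
    rel 0 R 0 O (opn O s) (opn' O s) := by
  unfold opn opn'
  by_cases h : s ∈ O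
  · simp only [h, if_true]; exact Or.inl ⟨s, hs, h, rfl, rfl⟩
  · simp only [h, if_false]; exact Or.inr (Or.inl ⟨s, hs, h, rfl, rfl⟩)

theorem odd_const {R : ℤ} (hR : R % 2 = 0) {O : Set (ℤ × ℤ)} {v w : ℤ × ℤ}
    (h : EqvGen (rel 0 R 0 O) v w) : (dom 0 R v ∧ par 1 v) = (dom 0 R w ∧ par 1 w) := by
  refine eqvGen_const (fun v => dom 0 R v ∧ par 1 v) ?_ h
  have hp : ∀ v, par 1 v ↔ ¬ par 0 v := fun v => par_compl 0 v
  rintro x y (⟨s, h1, h2, rfl, rfl⟩ | ⟨s, h1, h2, rfl, rfl⟩ | ⟨h1, h2⟩)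
  · simp [hp, par_e1, par_e2]
  · have := act_in_other (τ := 0) hR (by simp [par]) h1
    simp only [sub_zero] at *
    simp [this, par_e1, par_e2]
  · simp [h1, h2]

theorem cl_ne_of_nn {R : ℤ} (hR : R % 2 = 0) {O : Set (ℤ × ℤ)} {v w : ℤ × ℤ}
    (h : nn v w) (hv : dom 0 R v) : cl R O v ≠ cl R O w := by
  intro he
  have := odd_const hR ((mk_eq_iff _).1 he)
  have h2 := iff_of_eq this
  clear this he
  unfold dom par at *
  rcases h with rfl | rfl | rfl | rfl <;> simp only [Prod.fst_zero, Prod.snd_zero] at * <;> omega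

theorem dom_of_cl_ne {R : ℤ} {O : Set (ℤ × ℤ)} {v : ℤ × ℤ} (h : cl R O v ≠ clRoot R O) :
    dom 0 R v := by
  by_contra hv; exact h (cl_eq_root hv)

/-- The degree formula in the tree of classes. -/
theorem degree_cl {R : ℤ} (hR : R % 2 = 0) (h2R : 2 ≤ R) (O : Set (ℤ × ℤ)) (c : Cl R O)
    (hc : c ≠ clRoot R O) :
    {v | cl R O v = c}.ncard + ((tree R O).neighborSet c).ncard =
      {s | act 0 R s ∧ cl R O (opn O s) = c}.ncard + 2 := by
  obtain ⟨x0, rfl⟩ := Quot.exists_rep c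
  have hdom : ∀ v, EqvGen (rel 0 R 0 O) x0 v → dom 0 R v := fun v hv =>
    dom_of_cl_ne (O := O) fun h => hc (((mk_eq_iff _).2 hv).trans h)
  have hN : ((tree R O).neighborSet (Quot.mk _ x0)) =
      Quot.mk (rel 0 R 0 O) '' {v | ∃ w, EqvGen (rel 0 R 0 O) x0 w ∧ nn w v} := by
    ext d
    simp only [SimpleGraph.mem_neighborSet, tree, Set.mem_image, Set.mem_ofPred_eq]
    constructor
    · rintro ⟨-, v, w, h1, h2, h3⟩
      exact ⟨w, ⟨v, (mk_eq_iff _).1 h2.symm, h1⟩, h3⟩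
    · rintro ⟨v, ⟨w, h1, h2⟩, rfl⟩
      have e := (mk_eq_iff _).2 h1
      exact ⟨by rw [e]; exact cl_ne_of_nn hR h2 (hdom w h1), w, v, h2, e.symm, rfl⟩
  have hV : {v | cl R O v = Quot.mk _ x0} = {v | EqvGen (rel 0 R 0 O) x0 v} := by
    ext v
    rw [Set.mem_ofPred_eq, Set.mem_ofPred_eq, ← mk_eq_iff, eq_comm]
  have hp : ∀ v, par 1 v ↔ ¬ par 0 v := fun v => par_compl 0 v
  by_cases h1 : par 1 x0
  · have hpar : ∀ v, EqvGen (rel 0 R 0 O) x0 v → par 1 v := fun v hv =>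
      ((iff_of_eq (odd_const hR hv)).1 ⟨hdom _ (.refl _), h1⟩).2
    have sw : rel 0 R 1 Oᶜ = rel 0 R 0 O := rel_swap 0 R 0 O
    have key := degree_formula hR h2R (Or.inr rfl) Oᶜ x0 (by
      rw [sw]; exact fun v hv => ⟨hdom v hv, hpar v hv⟩)
    rw [sw] at key
    rw [hN, hV, key]
    congr 2
    ext s
    simp only [Set.mem_ofPred_eq]
    refine and_congr_right fun _ => ?_
    rw [@eq_comm _ (cl R O (opn O s)), mk_eq_iff, opn]
    by_cases hs : s ∈ O
    · simp only [hs, if_true, Set.mem_compl_iff, not_true, false_and, false_iff]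
      intro h; exact (hp _).1 (hpar _ h) (par_e1 _ _)
    · simp [hs]
  · have hpar : ∀ v, EqvGen (rel 0 R 0 O) x0 v → par 0 v := fun v hv => by
      by_contra h
      exact h1 ((iff_of_eq (odd_const hR hv)).2 ⟨hdom _ hv, (hp v).2 h⟩).2
    have key := degree_formula hR h2R (Or.inl rfl) O x0
      fun v hv => ⟨hdom v hv, hpar v hv⟩
    rw [hN, hV, key]
    congr 2
    ext s
    simp only [Set.mem_ofPred_eq]
    refine and_congr_right fun _ => ?_
    rw [@eq_comm _ (cl R O (opn O s)), mk_eq_iff, opn]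
    by_cases hs : s ∈ O
    · simp [hs]
    · simp only [hs, if_false, false_and, false_iff]
      intro h; exact (hp _).1 (par_e1 _ _) (hpar _ h)

noncomputable instance (R : ℤ) (O : Set (ℤ × ℤ)) : Fintype (Cl R O) := Fintype.ofFinite _

/-- Discrete Gauss-Bonnet: the weighted sum over vertices and squares telescopes over the
tree. -/
theorem height_sum {R : ℤ} (hR : R % 2 = 0) (h2R : 2 ≤ R) (O : Set (ℤ × ℤ)) (p : Cl R O → Cl R O)
    (hp1 : ∀ c, c ≠ clRoot R O → (tree R O).Adj c (p c) ∧
      (tree R O).dist (clRoot R O) c = (tree R O).dist (clRoot R O) (p c) + 1)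
    (hp2 : ∀ c d, (tree R O).Adj c d →
      (c ≠ clRoot R O ∧ d = p c) ∨ (d ≠ clRoot R O ∧ c = p d))
    (g : Cl R O → ℤ) (hg : g (clRoot R O) = 0) :
    ∑ v ∈ domF 0 R, g (cl R O v) - ∑ s ∈ actF 0 R, g (cl R O (opn O s)) =
      ∑ c ∈ Finset.univ.erase (clRoot R O), (g c - g (p c)) := by
  set ρ := clRoot R O with hρ
  have hdeg : ∀ c, c ≠ ρ → ((domF 0 R).filter (fun v => cl R O v = c)).card +
      ((Finset.univ.erase ρ).filter (fun d => p d = c)).card =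
      ((actF 0 R).filter (fun s => cl R O (opn O s) = c)).card + 1 := by
    intro c hc
    have key := degree_cl hR h2R O c hc
    have e1 : {v | cl R O v = c} = ((domF 0 R).filter (fun v => cl R O v = c) : Set (ℤ × ℤ)) := by
      ext v
      simp only [Set.mem_ofPred_eq, Finset.coe_filter, mem_domF, iff_and_self]
      rintro rfl
      exact dom_of_cl_ne hc
    have e2 : {s | act 0 R s ∧ cl R O (opn O s) = c} =
        ((actF 0 R).filter (fun s => cl R O (opn O s) = c) : Set (ℤ × ℤ)) := by
      ext v; simp
    have e3 : (tree R O).neighborSet c =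
        (insert (p c) ((Finset.univ.erase ρ).filter (fun d => p d = c)) : Finset (Cl R O)) := by
      ext d
      simp only [SimpleGraph.mem_neighborSet, Finset.coe_insert, Finset.coe_filter,
        Finset.mem_erase, Finset.mem_univ, and_true, Set.mem_insert_iff, Set.mem_ofPred_eq]
      constructor
      · intro h
        rcases hp2 _ _ h with h | h
        · exact Or.inl h.2
        · exact Or.inr ⟨h.1, h.2.symm⟩
      · rintro (rfl | ⟨h, rfl⟩)
        · exact (hp1 c hc).1
        · exact (hp1 d h).1.symm
    rw [e1, e2, e3, Set.ncard_coe_finset, Set.ncard_coe_finset, Set.ncard_coe_finset,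
      Finset.card_insert_of_notMem] at key
    · omega
    · simp only [Finset.mem_filter, Finset.mem_erase, Finset.mem_univ, and_true, not_and]
      intro h h'
      have a1 := (hp1 c hc).2
      have a2 := (hp1 _ h).2
      rw [h'] at a2
      omega
  have fib : ∀ {ι : Type} (T : Finset ι) (f : ι → Cl R O),
      ∑ i ∈ T, g (f i) = ∑ c ∈ Finset.univ.erase ρ, ((T.filter (fun i => f i = c)).card : ℤ) * g c := by
    intro ι T f
    rw [← Finset.sum_fiberwise_of_maps_to (t := Finset.univ) (g := f) (fun _ _ => Finset.mem_univ _),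
      ← Finset.sum_erase_add _ _ (Finset.mem_univ ρ)]
    have h0 : ∀ c, ∑ i ∈ T with f i = c, g (f i) = ((T.filter (fun i => f i = c)).card : ℤ) * g c := by
      intro c
      rw [Finset.sum_congr rfl (fun i hi => by rw [(Finset.mem_filter.1 hi).2]), Finset.sum_const,
        nsmul_eq_mul]
    simp only [h0, hg, mul_zero, add_zero]
  have fp := fib (Finset.univ.erase ρ) p
  rw [fib (domF 0 R) (cl R O), fib (actF 0 R) (fun s => cl R O (opn O s)), Finset.sum_sub_distrib, fp,
    ← Finset.sum_sub_distrib, ← Finset.sum_sub_distrib]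
  refine Finset.sum_congr rfl fun c hc => ?_
  have := hdeg c (Finset.ne_of_mem_erase hc)
  have h2 : (((domF 0 R).filter (fun v => cl R O v = c)).card : ℤ) =
      ((actF 0 R).filter (fun s => cl R O (opn O s) = c)).card + 1 -
      ((Finset.univ.erase ρ).filter (fun d => p d = c)).card := by
    omega
  rw [h2]; ring

section TreeSum

variable {C : Type*} (ρ : C) (p : C → C) (dep : C → ℕ)

/-- Height function on a rooted tree with increments `θ`. -/
def treeHeight (θ : C → ℤ) (c : C) : ℤ := ∑ k ∈ Finset.range (dep c), θ (p^[k] c)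

theorem treeHeight_root (h0 : dep ρ = 0) (θ : C → ℤ) : treeHeight p dep θ ρ = 0 := by
  simp [treeHeight, h0]

theorem treeHeight_succ (θ : C → ℤ) {c : C} (h : dep c = dep (p c) + 1) :
    treeHeight p dep θ c = treeHeight p dep θ (p c) + θ c := by
  simp [treeHeight, h, Finset.sum_range_succ']

variable [Fintype C]

/-- All choices of increments. -/
noncomputable def incr : Finset (C → ℤ) :=
  Fintype.piFinset fun c => if c = ρ then {0} else {1, -1}

theorem mem_incr {θ : C → ℤ} : θ ∈ incr ρ ↔ θ ρ = 0 ∧ ∀ c, c ≠ ρ → |θ c| = 1 := by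
  simp only [incr, Fintype.mem_piFinset]
  constructor
  · intro h
    refine ⟨by simpa using h ρ, fun c hc => ?_⟩
    have := h c
    simp only [hc, if_false, Finset.mem_insert, Finset.mem_singleton] at this
    rcases this with h | h <;> simp [h]
  · rintro ⟨h1, h2⟩ c
    by_cases hc : c = ρ
    · subst hc; simp [h1]
    · simpa only [hc, if_false, Finset.mem_insert, Finset.mem_singleton] using
        eq_or_eq_neg_of_abs_eq (h2 c hc)

theorem incr_sum (l : ℝ) :
    ∑ θ ∈ incr ρ, ∏ c, Real.exp (l * θ c) =
      (Real.exp l + Real.exp (-l)) ^ (Fintype.card C - 1) := by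
  rw [incr, ← Finset.prod_univ_sum (fun c => if c = ρ then {0} else {1, -1})
    (fun _ j => Real.exp (l * (j : ℤ)))]
  rw [← Finset.mul_prod_erase _ _ (Finset.mem_univ ρ)]
  rw [Finset.prod_congr rfl (g := fun _ => Real.exp l + Real.exp (-l))]
  · simp
  · intro c hc
    rw [if_neg (Finset.ne_of_mem_erase hc), Finset.sum_pair (by norm_num)]
    simp

theorem incr_sum_mul (l : ℝ) (c₁ : C) (hc : c₁ ≠ ρ) :
    ∑ θ ∈ incr ρ, (∏ c, Real.exp (l * θ c)) * θ c₁ =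
      (Real.exp l + Real.exp (-l)) ^ (Fintype.card C - 1) * Real.tanh l := by
  have e : ∀ θ : C → ℤ, (∏ c, Real.exp (l * θ c)) * θ c₁ =
      ∏ c, (Real.exp (l * θ c) * if c = c₁ then (θ c : ℝ) else 1) := by
    intro θ; rw [Finset.prod_mul_distrib]; simp
  simp only [e]
  rw [incr, ← Finset.prod_univ_sum (fun c => if c = ρ then {0} else {1, -1})
    (fun c j => Real.exp (l * (j : ℤ)) * if c = c₁ then (j : ℝ) else 1)]
  have hm : c₁ ∈ Finset.univ.erase ρ := by simp [hc]
  have hcard : Fintype.card C - 1 = (Finset.univ.erase ρ).card := by simp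
  rw [hcard, ← Finset.prod_const,
    ← Finset.mul_prod_erase _ _ (Finset.mem_univ ρ), ← Finset.mul_prod_erase _ _ hm,
    ← Finset.mul_prod_erase _ _ hm]
  rw [Finset.prod_congr rfl (g := fun _ => Real.exp l + Real.exp (-l))]
  · rw [if_neg hc]
    simp only [if_true, Finset.sum_singleton]
    rw [Finset.sum_pair (by norm_num), Real.tanh_eq_sinh_div_cosh, Real.sinh_eq, Real.cosh_eq]
    have : Real.exp l + Real.exp (-l) ≠ 0 := by positivity
    simp [hc.symm]
    field_simp
    ring
  · intro c hc
    rw [Finset.mem_erase, Finset.mem_erase] at hc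
    rw [if_neg hc.2.1, Finset.sum_pair (by norm_num)]
    simp [hc.1]

theorem incr_sum_height (l : ℝ) (h0 : dep ρ = 0) (hd : ∀ c, c ≠ ρ → dep c = dep (p c) + 1) (v : C) :
    ∑ θ ∈ incr ρ, (∏ c, Real.exp (l * θ c)) * treeHeight p dep θ v =
      (Real.exp l + Real.exp (-l)) ^ (Fintype.card C - 1) * Real.tanh l * dep v := by
  have key : ∀ n v, dep v = n → ∑ θ ∈ incr ρ, (∏ c, Real.exp (l * θ c)) * treeHeight p dep θ v =
      (Real.exp l + Real.exp (-l)) ^ (Fintype.card C - 1) * Real.tanh l * dep v := by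
    intro n
    induction n with
    | zero => intro v hv; simp [treeHeight, hv]
    | succ n ih =>
      intro v hv
      have hv' : v ≠ ρ := by rintro rfl; omega
      have h1 := hd v hv'
      have h2 := ih (p v) (by omega)
      simp only [treeHeight_succ p dep _ h1, Int.cast_add, mul_add, Finset.sum_add_distrib, h2,
        incr_sum_mul ρ l v hv', h1]
      push_cast
      ring
  exact key _ v rfl

end TreeSum

/-- Height functions on the tilted square with zero boundary values. -/
def IsHeight (R : ℤ) (h : ℤ × ℤ → ℤ) : Prop :=
  (∀ v, ¬ dom 0 R v → h v = 0) ∧ ∀ v w, nn v w → dom 0 R v → |h v - h w| = 1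

theorem IsHeight.abs_le {R : ℤ} {h : ℤ × ℤ → ℤ} (hh : IsHeight R h) (v : ℤ × ℤ) : |h v| ≤ 2 * |R| := by
  have key : ∀ n : ℕ, ∀ v : ℤ × ℤ, R - v.1 - v.2 ≤ n → |h v| ≤ n := by
    intro n
    induction n with
    | zero =>
      intro v hv
      rw [hh.1 v (by unfold dom; simp only [Prod.fst_zero, Prod.snd_zero]; push_cast at hv; omega)]
      simp
    | succ n ih =>
      intro v hv
      by_cases hd : dom 0 R v
      · have h1 := hh.2 v (v.1 + 1, v.2) (Or.inl rfl) hd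
        have h2 := ih (v.1 + 1, v.2) (by push_cast at hv; simp only; omega)
        push_cast
        have h3 := abs_sub_abs_le_abs_sub (h v) (h (v.1 + 1, v.2))
        omega
      · rw [hh.1 v hd]; simp; omega
  by_cases hd : dom 0 R v
  · have h1 := key (2 * |R|).toNat v (by
      have := le_abs_self R
      unfold dom at hd; simp only [Prod.fst_zero, Prod.snd_zero] at hd; omega)
    have : 0 ≤ |R| := abs_nonneg R
    omega
  · rw [hh.1 v hd]; simp

theorem finite_isHeight (R : ℤ) : {h | IsHeight R h}.Finite := by
  have key : (Set.univ : Set (domF 0 R → Finset.Icc (-(2 * |R|)) (2 * |R|))).Finite :=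
    Set.finite_univ
  refine (key.image fun f v => if hv : v ∈ domF 0 R then (f ⟨v, hv⟩ : ℤ) else 0).subset ?_
  intro h hh
  refine ⟨fun v => ⟨h v, Finset.mem_Icc.2 (abs_le.1 (IsHeight.abs_le hh v))⟩, trivial, ?_⟩
  funext v
  by_cases hv : v ∈ domF 0 R
  · simp [hv]
  · simp [hv, hh.1 v (by simpa using hv)]

/-- The finite set of height functions. -/
noncomputable def heights (R : ℤ) : Finset (ℤ × ℤ → ℤ) := (finite_isHeight R).toFinset

@[simp] theorem mem_heights {R : ℤ} {h : ℤ × ℤ → ℤ} : h ∈ heights R ↔ IsHeight R h := by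
  simp [heights]

/-- Height functions constant along open diagonals. -/
def Compat (R : ℤ) (O : Set (ℤ × ℤ)) (h : ℤ × ℤ → ℤ) : Prop :=
  ∀ s, act 0 R s → h (opn O s) = h (opn' O s)

/-- The depth of the class of a vertex. -/
noncomputable def depth (R : ℤ) (O : Set (ℤ × ℤ)) (v : ℤ × ℤ) : ℕ :=
  (tree R O).dist (clRoot R O) (cl R O v)

/-- The (integer) energy of a height function. -/
noncomputable def energy (R : ℤ) (O : Set (ℤ × ℤ)) (h : ℤ × ℤ → ℤ) : ℤ :=
  ∑ v ∈ domF 0 R, h v - ∑ s ∈ actF 0 R, h (opn O s)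

theorem sum_heights {R : ℤ} (hR : R % 2 = 0) (h2R : 2 ≤ R) (O : Set (ℤ × ℤ)) (l : ℝ) (v : ℤ × ℤ) :
    ∑ h ∈ heights R with Compat R O h, Real.exp (l * energy R O h) =
      (Real.exp l + Real.exp (-l)) ^ (Fintype.card (Cl R O) - 1) ∧
    ∑ h ∈ heights R with Compat R O h, Real.exp (l * energy R O h) * h v =
      (Real.exp l + Real.exp (-l)) ^ (Fintype.card (Cl R O) - 1) * Real.tanh l * depth R O v := by
  obtain ⟨p, hpρ, hp1, hp2⟩ := tree_parent (tree_isTree hR O) (clRoot R O)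
  set ρ := clRoot R O with hρ
  let dep : Cl R O → ℕ := fun c => (tree R O).dist ρ c
  have hd0 : dep ρ = 0 := SimpleGraph.dist_self
  have hd : ∀ c, c ≠ ρ → dep c = dep (p c) + 1 := fun c hc => (hp1 c hc).2
  let Φ : (Cl R O → ℤ) → (ℤ × ℤ → ℤ) := fun θ v => treeHeight p dep θ (cl R O v)
  have hE : ∀ θ ∈ incr ρ, Real.exp (l * energy R O (Φ θ)) = ∏ c, Real.exp (l * θ c) := by
    intro θ hθ
    rw [mem_incr] at hθ
    have := height_sum hR h2R O p hp1 hp2 (treeHeight p dep θ) (treeHeight_root ρ p dep hd0 θ)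
    rw [energy, this, ← Real.exp_sum, ← Finset.mul_sum, ← Finset.add_sum_erase _ _ (Finset.mem_univ ρ),
      hθ.1, Int.cast_sum]
    congr 2
    rw [Int.cast_zero, zero_add]
    refine Finset.sum_congr rfl fun c hc => ?_
    rw [treeHeight_succ p dep θ (hd c (Finset.ne_of_mem_erase hc)), add_sub_cancel_left]
  have hmem : ∀ θ ∈ incr ρ, Φ θ ∈ (heights R).filter (Compat R O) := by
    intro θ hθ
    rw [mem_incr] at hθ
    rw [Finset.mem_filter, mem_heights]
    refine ⟨⟨fun v hv => ?_, fun v w hvw hv => ?_⟩, fun s hs => ?_⟩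
    · simp only [Φ]; rw [cl_eq_root hv]; exact treeHeight_root ρ p dep hd0 θ
    · rcases hp2 _ _ ⟨cl_ne_of_nn hR hvw hv, v, w, hvw, rfl, rfl⟩ with ⟨h1, h2⟩ | ⟨h1, h2⟩
      · simp only [Φ]
        rw [h2, treeHeight_succ p dep θ (hd _ h1), add_sub_cancel_left]
        exact hθ.2 _ h1
      · simp only [Φ]
        rw [h2, treeHeight_succ p dep θ (hd _ h1), abs_sub_comm, add_sub_cancel_left]
        exact hθ.2 _ h1
    · simp only [Φ]; congr 1; exact Quot.sound (rel_opn hs)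
  have hinj : Set.InjOn Φ (incr ρ) := by
    intro θ hθ θ' hθ' h
    rw [Finset.mem_coe, mem_incr] at hθ hθ'
    have hc : ∀ c, treeHeight p dep θ c = treeHeight p dep θ' c := by
      rintro ⟨v⟩; exact congrFun h v
    funext c
    by_cases h1 : c = ρ
    · rw [h1, hθ.1, hθ'.1]
    · have a1 := treeHeight_succ p dep θ (hd c h1)
      have a2 := treeHeight_succ p dep θ' (hd c h1)
      rw [hc c, hc (p c)] at a1
      omega
  have hsurj : Set.SurjOn Φ (incr ρ) ((heights R).filter (Compat R O)) := by
    intro h hh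
    rw [Finset.mem_coe, Finset.mem_filter, mem_heights] at hh
    obtain ⟨⟨h1, h2⟩, h3⟩ := hh
    let g : Cl R O → ℤ := Quot.lift h (by
      rintro x y (⟨s, a1, a2, rfl, rfl⟩ | ⟨s, a1, a2, rfl, rfl⟩ | ⟨a1, a2⟩)
      · have := h3 s a1; simpa only [opn, opn', a2, if_true] using this
      · have := h3 s a1; simpa only [opn, opn', a2, if_false, sub_zero] using this
      · rw [h1 _ a1, h1 _ a2])
    have g0 : g ρ = 0 := h1 _ (not_dom_out _ _)
    have gstep : ∀ c, c ≠ ρ → |g c - g (p c)| = 1 := by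
      intro c hc
      obtain ⟨-, v, w, a1, a2, a3⟩ := (hp1 c hc).1
      have hv : dom 0 R v := dom_of_cl_ne (O := O) (by rw [a2]; exact hc)
      have := h2 v w a1 hv
      rw [← a2] at *
      rw [← a3]
      exact this
    have hg : ∀ n c, dep c = n → treeHeight p dep (fun c => g c - g (p c)) c = g c := by
      intro n
      induction n with
      | zero =>
        intro c hc
        by_cases h : c = ρ
        · rw [h, g0]; exact treeHeight_root ρ p dep hd0 _
        · have := hd c h; omega
      | succ n ih =>
        intro c hc
        have h : c ≠ ρ := by rintro rfl; omega
        rw [treeHeight_succ p dep _ (hd c h), ih _ (by have := hd c h; omega)]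
        ring
    refine ⟨fun c => g c - g (p c), ?_, ?_⟩
    · rw [Finset.mem_coe, mem_incr]
      exact ⟨by rw [hpρ, sub_self], gstep⟩
    · funext v; exact hg _ _ rfl
  constructor
  · rw [← incr_sum ρ l]
    symm
    exact Finset.sum_nbij Φ hmem hinj hsurj fun θ hθ => (hE θ hθ).symm
  · rw [← show _ = _ * _ * ((depth R O v : ℕ) : ℝ) from incr_sum_height ρ p dep l hd0 hd (cl R O v)]
    symm
    exact Finset.sum_nbij Φ hmem hinj hsurj fun θ hθ => by rw [hE θ hθ]

/-- Indicator that both diagonals of a square are flat. -/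
noncomputable def flat (s : ℤ × ℤ) (h : ℤ × ℤ → ℤ) : ℕ :=
  if h (e1 0 s) = h (e2 0 s) ∧ h (e1 1 s) = h (e2 1 s) then 1 else 0

/-- The linear part of the averaged energy. -/
noncomputable def lin (R : ℤ) (h : ℤ × ℤ → ℤ) : ℝ :=
  ∑ v ∈ domF 0 R, (h v : ℝ) -
    ∑ s ∈ actF 0 R, ((h (e1 0 s) : ℝ) + h (e2 0 s) + h (e1 1 s) + h (e2 1 s)) / 4

theorem IsHeight.square {R : ℤ} (hR : R % 2 = 0) {h : ℤ × ℤ → ℤ} (hh : IsHeight R h) {s : ℤ × ℤ}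
    (hs : act 0 R s) : |h (e1 0 s) - h (e1 1 s)| = 1 ∧ |h (e1 0 s) - h (e2 1 s)| = 1 ∧
      |h (e2 0 s) - h (e1 1 s)| = 1 ∧ |h (e2 0 s) - h (e2 1 s)| = 1 := by
  have h1 := act_in_other (τ := 0) hR (by simp [par]) hs
  have h2 := nn_e1 0 s
  simp only [sub_zero] at *
  refine ⟨?_, ?_, ?_, ?_⟩ <;> rw [abs_sub_comm]
  · exact hh.2 _ _ (nn_symm h2.1) h1.1
  · exact hh.2 _ _ (nn_symm h2.2.1) h1.2
  · exact hh.2 _ _ (nn_symm h2.2.2.1) h1.1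
  · exact hh.2 _ _ (nn_symm h2.2.2.2) h1.2

theorem square_weight (l : ℝ) {x y u w : ℤ} (h1 : |x - u| = 1) (h2 : |x - w| = 1)
    (h3 : |y - u| = 1) (h4 : |y - w| = 1) :
    (if x = y then Real.exp (-(l * x)) else 0) + (if u = w then Real.exp (-(l * u)) else 0) =
      Real.exp (-(l * (((x : ℝ) + y + u + w) / 4))) *
        (Real.exp (l / 2) + Real.exp (-(l / 2))) ^ (if x = y ∧ u = w then 1 else 0) := by
  have h1' := eq_or_eq_neg_of_abs_eq h1
  have h2' := eq_or_eq_neg_of_abs_eq h2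
  have h3' := eq_or_eq_neg_of_abs_eq h3
  have h4' := eq_or_eq_neg_of_abs_eq h4
  by_cases hx : x = y
  · subst hx
    by_cases hu : u = w
    · subst hu
      simp only [if_true, and_self, pow_one, mul_add, ← Real.exp_add]
      rcases h1' with h | h
      · obtain rfl : u = x - 1 := by omega
        rw [add_comm]
        push_cast
        congr 2 <;> ring
      · obtain rfl : u = x + 1 := by omega
        push_cast
        congr 2 <;> ring
    · have e : (u : ℝ) + w = 2 * x := by
        have : u + w = 2 * x := by omega
        exact_mod_cast this
      simp only [if_true, hu, if_false, and_false, pow_zero, mul_one, add_zero]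
      congr 2
      linear_combination -(l / 4) * e
  · have hu : u = w := by omega
    subst hu
    have e : (x : ℝ) + y = 2 * u := by
      have : x + y = 2 * u := by omega
      exact_mod_cast this
    simp only [hx, if_false, false_and, pow_zero, mul_one, zero_add, if_true]
    congr 2
    linear_combination -(l / 4) * e

theorem sum_compat {R : ℤ} (hR : R % 2 = 0) {h : ℤ × ℤ → ℤ} (hh : IsHeight R h) (l : ℝ) :
    ∑ O ∈ (actF 0 R).powerset with Compat R (O : Finset (ℤ × ℤ)) h,
      Real.exp (l * energy R (O : Finset (ℤ × ℤ)) h) =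
    Real.exp (l * lin R h) *
      (Real.exp (l / 2) + Real.exp (-(l / 2))) ^ (∑ s ∈ actF 0 R, flat s h) := by
  set S := actF 0 R with hS
  let a : ℤ × ℤ → ℝ := fun s => if h (e1 0 s) = h (e2 0 s) then Real.exp (-(l * h (e1 0 s))) else 0
  let b : ℤ × ℤ → ℝ := fun s => if h (e1 1 s) = h (e2 1 s) then Real.exp (-(l * h (e1 1 s))) else 0
  have h1 : ∀ O ∈ S.powerset, (if Compat R (O : Finset (ℤ × ℤ)) h then
      Real.exp (l * energy R (O : Finset (ℤ × ℤ)) h) else 0) =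
      Real.exp (l * ∑ v ∈ domF 0 R, (h v : ℝ)) * ((∏ s ∈ O, a s) * ∏ s ∈ S \ O, b s) := by
    intro O hO
    rw [Finset.mem_powerset] at hO
    have e : (∏ s ∈ O, a s) * ∏ s ∈ S \ O, b s = ∏ s ∈ S, if s ∈ O then a s else b s := by
      rw [← Finset.prod_sdiff hO, mul_comm]
      congr 1
      · exact Finset.prod_congr rfl fun s hs => by rw [if_neg (Finset.mem_sdiff.1 hs).2]
      · exact Finset.prod_congr rfl fun s hs => by rw [if_pos hs]
    rw [e]
    have e2 : ∀ s, (if s ∈ O then a s else b s) = if h (opn O s) = h (opn' O s) then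
        Real.exp (-(l * h (opn O s))) else 0 := by
      intro s
      by_cases hs : s ∈ O <;> simp [hs, opn, opn', a, b]
    simp only [e2]
    by_cases hc : Compat R (O : Finset (ℤ × ℤ)) h
    · rw [if_pos hc, Finset.prod_congr rfl (fun s hs => if_pos (hc s (mem_actF.1 hs))),
        ← Real.exp_sum, ← Real.exp_add]
      congr 1
      simp only [energy, Int.cast_sub, Int.cast_sum, Finset.sum_neg_distrib, ← Finset.mul_sum]
      ring
    · rw [if_neg hc]
      unfold Compat at hc
      push Not at hc
      obtain ⟨s, hs, hs'⟩ := hc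
      rw [Finset.prod_eq_zero (mem_actF.2 hs) (if_neg hs'), mul_zero]
  rw [Finset.sum_filter, Finset.sum_congr rfl h1, ← Finset.mul_sum, ← Finset.prod_add]
  have h2 : ∀ s ∈ S, a s + b s =
      Real.exp (-(l * (((h (e1 0 s) : ℝ) + h (e2 0 s) + h (e1 1 s) + h (e2 1 s)) / 4))) *
        (Real.exp (l / 2) + Real.exp (-(l / 2))) ^ flat s h := by
    intro s hs
    obtain ⟨g1, g2, g3, g4⟩ := hh.square hR (mem_actF.1 hs)
    exact square_weight l g1 g2 g3 g4
  rw [Finset.prod_congr rfl h2, Finset.prod_mul_distrib, Finset.prod_pow_eq_pow_sum, ← Real.exp_sum,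
    ← mul_assoc, ← Real.exp_add]
  congr 2
  rw [lin, Finset.sum_neg_distrib, ← Finset.mul_sum]
  ring

theorem IsHeight.parity {R : ℤ} (hR : R % 2 = 0) {h : ℤ × ℤ → ℤ} (hh : IsHeight R h) (v : ℤ × ℤ)
    (hv : dom 0 R v ∨ par 0 v) : (h v - v.1 - v.2) % 2 = 0 := by
  have key : ∀ n : ℕ, ∀ v : ℤ × ℤ, R - v.1 - v.2 ≤ n → dom 0 R v ∨ par 0 v →
      (h v - v.1 - v.2) % 2 = 0 := by
    intro n
    induction n with
    | zero =>
      intro v hv hv'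
      have hd : ¬ dom 0 R v := by
        unfold dom; simp only [Prod.fst_zero, Prod.snd_zero]; push_cast at hv; omega
      rw [hh.1 v hd]
      have := hv'.resolve_left hd
      unfold par at this
      omega
    | succ n ih =>
      intro v hv hv'
      by_cases hd : dom 0 R v
      · have h1 := hh.2 v (v.1 + 1, v.2) (Or.inl rfl) hd
        have h2 := ih (v.1 + 1, v.2) (by push_cast at hv; simp only; omega) (by
          unfold dom par at *; simp only [Prod.fst_zero, Prod.snd_zero] at *; omega)
        have h3 := eq_or_eq_neg_of_abs_eq h1
        simp only at h2
        omega
      · rw [hh.1 v hd]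
        have := hv'.resolve_left hd
        unfold par at this
        omega
  exact key (R - v.1 - v.2).toNat v (by omega) hv

theorem IsHeight.nn_parity {R : ℤ} (hR : R % 2 = 0) {a b : ℤ × ℤ → ℤ} (ha : IsHeight R a)
    (hb : IsHeight R b) (v : ℤ × ℤ) : (a v - b v) % 2 = 0 := by
  by_cases hd : dom 0 R v
  · have h1 := ha.parity hR v (Or.inl hd)
    have h2 := hb.parity hR v (Or.inl hd)
    omega
  · rw [ha.1 v hd, hb.1 v hd]; simp

theorem IsHeight.inf {R : ℤ} (hR : R % 2 = 0) {a b : ℤ × ℤ → ℤ} (ha : IsHeight R a)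
    (hb : IsHeight R b) : IsHeight R (a ⊓ b) := by
  refine ⟨fun v hv => by simp [ha.1 v hv, hb.1 v hv], fun v w h hv => ?_⟩
  have h1 := ha.nn_parity hR hb v
  have h2 := ha.nn_parity hR hb w
  have h3 := eq_or_eq_neg_of_abs_eq (ha.2 v w h hv)
  have h4 := eq_or_eq_neg_of_abs_eq (hb.2 v w h hv)
  rw [abs_eq (by norm_num)]
  simp only [Pi.inf_apply]
  omega

theorem IsHeight.sup {R : ℤ} (hR : R % 2 = 0) {a b : ℤ × ℤ → ℤ} (ha : IsHeight R a)
    (hb : IsHeight R b) : IsHeight R (a ⊔ b) := by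
  refine ⟨fun v hv => by simp [ha.1 v hv, hb.1 v hv], fun v w h hv => ?_⟩
  have h1 := ha.nn_parity hR hb v
  have h2 := ha.nn_parity hR hb w
  have h3 := eq_or_eq_neg_of_abs_eq (ha.2 v w h hv)
  have h4 := eq_or_eq_neg_of_abs_eq (hb.2 v w h hv)
  rw [abs_eq (by norm_num)]
  simp only [Pi.sup_apply]
  omega

theorem flat_supermodular_aux {x y u w x' y' u' w' : ℤ} (a1 : |x - u| = 1) (a2 : |x - w| = 1)
    (b1 : |x' - u'| = 1) (b2 : |x' - w'| = 1) (b3 : |y' - u'| = 1) (b4 : |y' - w'| = 1)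
    (a3 : |y - u| = 1) (a4 : |y - w| = 1) (c1 : (x - x') % 2 = 0) (c3 : (u - u') % 2 = 0) :
    (if x = y ∧ u = w then 1 else 0) + (if x' = y' ∧ u' = w' then 1 else 0) ≤
      (if x ⊓ x' = y ⊓ y' ∧ u ⊓ u' = w ⊓ w' then 1 else 0) +
        (if x ⊔ x' = y ⊔ y' ∧ u ⊔ u' = w ⊔ w' then 1 else 0) := by
  replace a1 := eq_or_eq_neg_of_abs_eq a1
  replace a2 := eq_or_eq_neg_of_abs_eq a2
  replace a3 := eq_or_eq_neg_of_abs_eq a3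
  replace a4 := eq_or_eq_neg_of_abs_eq a4
  replace b1 := eq_or_eq_neg_of_abs_eq b1
  replace b2 := eq_or_eq_neg_of_abs_eq b2
  replace b3 := eq_or_eq_neg_of_abs_eq b3
  replace b4 := eq_or_eq_neg_of_abs_eq b4
  by_cases hA : x = y ∧ u = w
  · by_cases hB : x' = y' ∧ u' = w'
    · obtain ⟨rfl, rfl⟩ := hA
      obtain ⟨rfl, rfl⟩ := hB
      simp
    · rw [if_pos hA, if_neg hB]
      obtain ⟨rfl, rfl⟩ := hA
      have : (x ⊓ x' = x ⊓ y' ∧ u ⊓ u' = u ⊓ w') ∨ (x ⊔ x' = x ⊔ y' ∧ u ⊔ u' = u ⊔ w') := by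
        omega
      rcases this with h | h <;> rw [if_pos h] <;> omega
  · by_cases hB : x' = y' ∧ u' = w'
    · rw [if_neg hA, if_pos hB]
      obtain ⟨rfl, rfl⟩ := hB
      have : (x ⊓ x' = y ⊓ x' ∧ u ⊓ u' = w ⊓ u') ∨ (x ⊔ x' = y ⊔ x' ∧ u ⊔ u' = w ⊔ u') := by
        omega
      rcases this with h | h <;> rw [if_pos h] <;> omega
    · rw [if_neg hA, if_neg hB]; omega

theorem flat_supermodular {R : ℤ} (hR : R % 2 = 0) {a b : ℤ × ℤ → ℤ} (ha : IsHeight R a)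
    (hb : IsHeight R b) {s : ℤ × ℤ} (hs : act 0 R s) :
    flat s a + flat s b ≤ flat s (a ⊓ b) + flat s (a ⊔ b) := by
  obtain ⟨a1, a2, a3, a4⟩ := ha.square hR hs
  obtain ⟨b1, b2, b3, b4⟩ := hb.square hR hs
  have c1 := ha.nn_parity hR hb (e1 0 s)
  have c3 := ha.nn_parity hR hb (e1 1 s)
  exact flat_supermodular_aux a1 a2 b1 b2 b3 b4 a3 a4 c1 c3

/-- The four functions theorem on a finite sublattice. -/
theorem four_functions_on {α : Type*} [DistribLattice α] (L : Finset α)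
    (hinf : ∀ a ∈ L, ∀ b ∈ L, a ⊓ b ∈ L) (hsup : ∀ a ∈ L, ∀ b ∈ L, a ⊔ b ∈ L)
    (f₁ f₂ f₃ f₄ : α → ℝ) (h₁ : ∀ a ∈ L, 0 ≤ f₁ a) (h₂ : ∀ a ∈ L, 0 ≤ f₂ a)
    (h₃ : ∀ a ∈ L, 0 ≤ f₃ a) (h₄ : ∀ a ∈ L, 0 ≤ f₄ a)
    (h : ∀ a ∈ L, ∀ b ∈ L, f₁ a * f₂ b ≤ f₃ (a ⊓ b) * f₄ (a ⊔ b)) :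
    (∑ a ∈ L, f₁ a) * ∑ a ∈ L, f₂ a ≤ (∑ a ∈ L, f₃ a) * ∑ a ∈ L, f₄ a := by
  let e : (α → ℝ) → α → ℝ := fun f a => if a ∈ L then f a else 0
  have he : ∀ f : α → ℝ, (∀ a ∈ L, 0 ≤ f a) → 0 ≤ e f := by
    intro f hf a
    by_cases ha : a ∈ L
    · simpa [e, ha] using hf a ha
    · simp [e, ha]
  have hs : ∀ f, ∑ a ∈ L, f a = ∑ a ∈ L, e f a := fun f =>
    Finset.sum_congr rfl fun a ha => by simp [e, ha]
  rw [hs f₁, hs f₂, hs f₃, hs f₄]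
  refine (four_functions_theorem (e f₁) (e f₂) (e f₃) (e f₄) (he _ h₁) (he _ h₂) (he _ h₃) (he _ h₄)
    ?_ L L).trans ?_
  · intro a b
    by_cases ha : a ∈ L
    · by_cases hb : b ∈ L
      · simpa only [e, ha, hb, hinf a ha b hb, hsup a ha b hb, if_true] using h a ha b hb
      · have e0 : e f₂ b = 0 := by simp [e, hb]
        rw [e0, mul_zero]; exact mul_nonneg (he _ h₃ _) (he _ h₄ _)
    · have e0 : e f₁ a = 0 := by simp [e, ha]
      rw [e0, zero_mul]; exact mul_nonneg (he _ h₃ _) (he _ h₄ _)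
  · refine mul_le_mul (Finset.sum_le_sum_of_subset_of_nonneg ?_ fun a _ _ => he _ h₃ a)
      (Finset.sum_le_sum_of_subset_of_nonneg ?_ fun a _ _ => he _ h₄ a)
      (Finset.sum_nonneg fun a _ => he _ h₄ a) (Finset.sum_nonneg fun a _ => he _ h₃ a)
    · exact Finset.infs_subset_iff.2 fun a ha b hb => hinf a ha b hb
    · exact Finset.sups_subset_iff.2 fun a ha b hb => hsup a ha b hb

theorem lin_sup_inf (R : ℤ) (a b : ℤ × ℤ → ℤ) :
    lin R a + lin R b = lin R (a ⊓ b) + lin R (a ⊔ b) := by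
  have key : ∀ v, (a v : ℝ) + b v = ((a ⊓ b) v : ℤ) + ((a ⊔ b) v : ℤ) := by
    intro v
    have : a v + b v = (a ⊓ b) v + (a ⊔ b) v := by
      simp only [Pi.inf_apply, Pi.sup_apply]; omega
    exact_mod_cast this
  simp only [lin]
  have h1 : ∑ v ∈ domF 0 R, (a v : ℝ) + ∑ v ∈ domF 0 R, (b v : ℝ) =
      ∑ v ∈ domF 0 R, ((a ⊓ b) v : ℝ) + ∑ v ∈ domF 0 R, ((a ⊔ b) v : ℝ) := by
    rw [← Finset.sum_add_distrib, ← Finset.sum_add_distrib]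
    exact Finset.sum_congr rfl fun v _ => key v
  have h2 : ∀ s, ((a (e1 0 s) : ℝ) + a (e2 0 s) + a (e1 1 s) + a (e2 1 s)) / 4 +
      ((b (e1 0 s) : ℝ) + b (e2 0 s) + b (e1 1 s) + b (e2 1 s)) / 4 =
      (((a ⊓ b) (e1 0 s) : ℝ) + (a ⊓ b) (e2 0 s) + (a ⊓ b) (e1 1 s) + (a ⊓ b) (e2 1 s)) / 4 +
      (((a ⊔ b) (e1 0 s) : ℝ) + (a ⊔ b) (e2 0 s) + (a ⊔ b) (e1 1 s) + (a ⊔ b) (e2 1 s)) / 4 := by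
    intro s
    linear_combination (key (e1 0 s) + key (e2 0 s) + key (e1 1 s) + key (e2 1 s)) / 4
  have h3 := Finset.sum_congr (Eq.refl (actF 0 R)) fun s _ => h2 s
  rw [Finset.sum_add_distrib, Finset.sum_add_distrib] at h3
  linear_combination h1 - h3

/-- The linear part does not see functions vanishing near the boundary. -/
theorem lin_interior {R : ℤ} (f : ℤ × ℤ → ℤ) (hf : ∀ v, ¬ dom 0 (R - 1) v → f v = 0) :
    lin R f = 0 := by
  have key : ∀ e : ℤ × ℤ, e = (0, 0) ∨ e = (1, 0) ∨ e = (0, 1) ∨ e = (1, 1) →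
      ∑ s ∈ actF 0 R, (f (s + e) : ℝ) = ∑ v ∈ domF 0 R, (f v : ℝ) := by
    intro e he
    have hi : Function.Injective fun s : ℤ × ℤ => s + e := add_left_injective e
    rw [← Finset.sum_image (f := fun v => (f v : ℝ)) (g := fun s => s + e) (s := actF 0 R)
      (fun x _ y _ h => hi h)]
    have hz : ∀ v, ¬ dom 0 (R - 1) v → (f v : ℝ) = 0 := fun v hv => by simp [hf v hv]
    have hA : ∑ v ∈ domF 0 (R - 1), (f v : ℝ) = ∑ v ∈ domF 0 R, (f v : ℝ) := by
      refine Finset.sum_subset ?_ fun v _ h => hz v (by simpa using h)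
      intro v; simp only [mem_domF, dom]; omega
    rw [← hA]
    symm
    refine Finset.sum_subset ?_ fun v _ h => hz v (by simpa using h)
    intro v hv
    rw [mem_domF] at hv
    refine Finset.mem_image.2 ⟨v - e, ?_, by simp⟩
    rw [mem_actF]
    unfold dom at hv
    unfold act
    rcases he with rfl | rfl | rfl | rfl <;>
      simp only [Prod.fst_zero, Prod.snd_zero, Prod.fst_sub, Prod.snd_sub] at * <;> omega
  have h1 : ∀ s, ((f (e1 0 s) : ℝ) + f (e2 0 s) + f (e1 1 s) + f (e2 1 s)) / 4 =
      ((f (s + (0, 0)) : ℝ) + f (s + (1, 0)) + f (s + (0, 1)) + f (s + (1, 1))) / 4 := by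
    intro s
    have a1 : s + (0, 0) = s := by simp
    have a2 : s + (1, 0) = (s.1 + 1, s.2) := by ext <;> simp
    have a3 : s + (0, 1) = (s.1, s.2 + 1) := by ext <;> simp
    have a4 : s + (1, 1) = (s.1 + 1, s.2 + 1) := by ext <;> simp
    rw [a1, a2, a3, a4]
    unfold e1 e2
    split_ifs <;> first | omega | ring
  rw [lin]
  simp only [h1]
  rw [← Finset.sum_div, Finset.sum_add_distrib, Finset.sum_add_distrib, Finset.sum_add_distrib,
    key _ (Or.inl rfl), key _ (Or.inr (Or.inl rfl)), key _ (Or.inr (Or.inr (Or.inl rfl))),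
    key _ (Or.inr (Or.inr (Or.inr rfl)))]
  ring

/-- Height functions equal to one along the boundary. -/
def RingOne (R : ℤ) (h : ℤ × ℤ → ℤ) : Prop := ∀ v, dom 0 R v → ¬ dom 0 (R - 1) v → h v = 1

/-- Squares all of whose corners are inside. -/
noncomputable def innerF (R : ℤ) : Finset (ℤ × ℤ) :=
  (actF 0 R).filter fun s => dom 0 R (e1 0 s) ∧ dom 0 R (e2 0 s)

theorem IsHeight.ring {R : ℤ} (hR : R % 2 = 0) {h : ℤ × ℤ → ℤ} (hh : IsHeight R h) {v : ℤ × ℤ}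
    (h1 : dom 0 R v) (h2 : ¬ dom 0 (R - 1) v) : |h v| = 1 := by
  have : ∃ w, nn v w ∧ ¬ dom 0 R w := by
    unfold dom nn at *
    simp only [Prod.fst_zero, Prod.snd_zero] at *
    by_cases a1 : R - 1 ≤ v.1 + v.2
    · exact ⟨_, Or.inl rfl, by simp only; omega⟩
    by_cases a2 : R - 1 ≤ v.1 - v.2
    · exact ⟨_, Or.inl rfl, by simp only; omega⟩
    · exact ⟨_, Or.inr (Or.inl rfl), by simp only; omega⟩
  obtain ⟨w, hw, hw'⟩ := this
  have := hh.2 v w hw h1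
  rwa [hh.1 w hw', sub_zero] at this

/-- Reflection of a height function about height one. -/
noncomputable def reflect (R : ℤ) (h : ℤ × ℤ → ℤ) (v : ℤ × ℤ) : ℤ :=
  if dom 0 R v then 2 - h v else h v

theorem reflect_ring {R : ℤ} {h : ℤ × ℤ → ℤ} (h1 : RingOne R h) : RingOne R (reflect R h) := by
  intro v hv hv'
  rw [reflect, if_pos hv, h1 v hv hv']; rfl

theorem reflect_reflect (R : ℤ) (h : ℤ × ℤ → ℤ) : reflect R (reflect R h) = h := by
  funext v
  unfold reflect
  split_ifs <;> ring

theorem reflect_isHeight {R : ℤ} {h : ℤ × ℤ → ℤ} (hh : IsHeight R h) (h1 : RingOne R h) :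
    IsHeight R (reflect R h) := by
  refine ⟨fun v hv => by rw [reflect, if_neg hv, hh.1 v hv], fun v w hvw hv => ?_⟩
  have h2 := hh.2 v w hvw hv
  rw [reflect, reflect, if_pos hv]
  by_cases hw : dom 0 R w
  · rw [if_pos hw, ← h2, abs_sub_comm]; congr 1; ring
  · rw [if_neg hw]
    have hv' : ¬ dom 0 (R - 1) v := by
      unfold dom at *
      simp only [Prod.fst_zero, Prod.snd_zero] at *
      rcases hvw with rfl | rfl | rfl | rfl <;> simp only at hw <;> omega
    rw [h1 v hv hv'] at *
    exact h2

theorem reflect_flat {R : ℤ} (hR : R % 2 = 0) {h : ℤ × ℤ → ℤ} {s : ℤ × ℤ} (hs : s ∈ innerF R) :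
    flat s (reflect R h) = flat s h := by
  rw [innerF, Finset.mem_filter, mem_actF] at hs
  have h1 := act_in_other (τ := 0) hR (by simp [par]) hs.1
  simp only [sub_zero] at h1
  simp only [flat, reflect, if_pos hs.2.1, if_pos hs.2.2, if_pos h1.1, if_pos h1.2, sub_right_inj]

theorem reflect_lin {R : ℤ} {h : ℤ × ℤ → ℤ} (h1 : RingOne R h) : lin R (reflect R h) = lin R h := by
  let f : ℤ × ℤ → ℤ := fun v => if dom 0 R v then 1 - h v else 0
  have e : ∀ v, (reflect R h v : ℝ) = h v + 2 * f v := by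
    intro v
    simp only [reflect, f]
    split_ifs <;> push_cast <;> ring
  have hf := lin_interior (R := R) f (by
    intro v hv
    by_cases hd : dom 0 R v
    · simp [f, h1 v hd hv]
    · simp [f, hd])
  simp only [lin, e] at *
  rw [Finset.sum_add_distrib, ← Finset.mul_sum]
  have h2 : ∀ s, ((h (e1 0 s) : ℝ) + 2 * f (e1 0 s) + (h (e2 0 s) + 2 * f (e2 0 s)) +
      (h (e1 1 s) + 2 * f (e1 1 s)) + (h (e2 1 s) + 2 * f (e2 1 s))) / 4 =
      ((h (e1 0 s) : ℝ) + h (e2 0 s) + h (e1 1 s) + h (e2 1 s)) / 4 +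
      2 * (((f (e1 0 s) : ℝ) + f (e2 0 s) + f (e1 1 s) + f (e2 1 s)) / 4) := by
    intro s; ring
  simp only [h2, Finset.sum_add_distrib, ← Finset.mul_sum]
  linear_combination 2 * hf

theorem flat_le_inf {R : ℤ} (hR : R % 2 = 0) {a b : ℤ × ℤ → ℤ} (ha : IsHeight R a)
    (hb : IsHeight R b) (hb1 : RingOne R b) {s : ℤ × ℤ} (hs : act 0 R s) (hs' : s ∉ innerF R) :
    flat s a ≤ flat s (a ⊓ b) := by
  have hi : ¬ (dom 0 R (e1 0 s) ∧ dom 0 R (e2 0 s)) := fun h =>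
    hs' (Finset.mem_filter.2 ⟨mem_actF.2 hs, h⟩)
  obtain ⟨a1, a2, a3, a4⟩ := ha.square hR hs
  obtain ⟨b1, b2, b3, b4⟩ := hb.square hR hs
  have d := act_in_other (τ := 0) hR (by simp [par]) hs
  simp only [sub_zero] at d
  have r1 : ¬ dom 0 (R - 1) (e1 1 s) := by
    unfold act dom e1 e2 at *
    simp only [Prod.fst_zero, Prod.snd_zero] at *
    split_ifs at * <;> simp only at * <;> omega
  have r2 : ¬ dom 0 (R - 1) (e2 1 s) := by
    unfold act dom e1 e2 at *
    simp only [Prod.fst_zero, Prod.snd_zero] at *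
    split_ifs at * <;> simp only at * <;> omega
  have c1 := hb1 _ d.1 r1
  have c2 := hb1 _ d.2 r2
  have a5 : a (e1 0 s) = 0 ∨ a (e2 0 s) = 0 := by
    by_contra hcon
    push Not at hcon
    exact hi ⟨by_contra fun h => hcon.1 (ha.1 _ h), by_contra fun h => hcon.2 (ha.1 _ h)⟩
  by_cases hA : a (e1 0 s) = a (e2 0 s) ∧ a (e1 1 s) = a (e2 1 s)
  · have : (a ⊓ b) (e1 0 s) = (a ⊓ b) (e2 0 s) ∧ (a ⊓ b) (e1 1 s) = (a ⊓ b) (e2 1 s) := by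
      simp only [Pi.inf_apply]
      have b1' := eq_or_eq_neg_of_abs_eq b1
      have b3' := eq_or_eq_neg_of_abs_eq b3
      omega
    unfold flat
    rw [if_pos hA, if_pos this]
  · unfold flat
    rw [if_neg hA]
    exact Nat.zero_le _

/-- The mean height at the origin is at most one. -/
theorem mean_height_le {R : ℤ} (hR : R % 2 = 0) (h2R : 2 ≤ R) (l K : ℝ) (hK : 1 ≤ K) :
    ∑ h ∈ heights R, Real.exp (l * lin R h) * K ^ (∑ s ∈ actF 0 R, flat s h) * h 0 ≤
      ∑ h ∈ heights R, Real.exp (l * lin R h) * K ^ (∑ s ∈ actF 0 R, flat s h) := by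
  have hK0 : 0 < K := by linarith
  set W : (ℤ × ℤ → ℤ) → ℝ := fun h => Real.exp (l * lin R h) * K ^ (∑ s ∈ actF 0 R, flat s h) with hW
  set W' : (ℤ × ℤ → ℤ) → ℝ := fun h => if RingOne R h then
    Real.exp (l * lin R h) * K ^ (∑ s ∈ innerF R, flat s h) else 0 with hW'
  set M : ℝ := 2 * |R| with hM
  have hWpos : ∀ h, 0 < W h := fun h => by simp only [hW]; positivity
  have hW'nn : ∀ h, 0 ≤ W' h := fun h => by simp only [hW']; split_ifs <;> positivity
  have hMh : ∀ h ∈ heights R, 0 ≤ (h 0 : ℝ) + M := by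
    intro h hh
    have h1 := abs_le.1 ((mem_heights.1 hh).abs_le 0)
    have : (0 : ℤ) ≤ h 0 + 2 * |R| := by omega
    simp only [hM]
    exact_mod_cast this
  have h00 : dom 0 R 0 := by unfold dom; simp only [Prod.fst_zero, Prod.snd_zero]; omega
  have four := four_functions_on (heights R)
    (fun a ha b hb => by
      rw [mem_heights] at *; exact ha.inf hR hb)
    (fun a ha b hb => by
      rw [mem_heights] at *; exact ha.sup hR hb)
    (fun h => W h * (h 0 + M)) W' W (fun h => W' h * (h 0 + M))
    (fun h hh => mul_nonneg (hWpos h).le (hMh h hh)) (fun h _ => hW'nn h) (fun h _ => (hWpos h).le)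
    (fun h hh => mul_nonneg (hW'nn h) (hMh h hh)) (by
      intro a ha b hb
      have hsupH : a ⊔ b ∈ heights R := mem_heights.2
        ((mem_heights.1 ha).sup hR (mem_heights.1 hb))
      rw [mem_heights] at ha hb
      by_cases hb1 : RingOne R b
      · have hs1 : RingOne R (a ⊔ b) := by
          intro v hv hv'
          have h1 := abs_le.1 (ha.ring hR hv hv').le
          have h2 := hb1 v hv hv'
          simp only [Pi.sup_apply]
          omega
        simp only [hW, hW', if_pos hb1, if_pos hs1]
        have hlin := lin_sup_inf R a b
        have hfl : ∑ s ∈ actF 0 R, flat s a + ∑ s ∈ innerF R, flat s b ≤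
            ∑ s ∈ actF 0 R, flat s (a ⊓ b) + ∑ s ∈ innerF R, flat s (a ⊔ b) := by
          have hsub : innerF R ⊆ actF 0 R := Finset.filter_subset _ _
          rw [← Finset.sum_sdiff hsub, ← Finset.sum_sdiff (f := fun s => flat s (a ⊓ b)) hsub,
            add_assoc, add_assoc, ← Finset.sum_add_distrib, ← Finset.sum_add_distrib]
          refine add_le_add (Finset.sum_le_sum fun s hs => ?_) (Finset.sum_le_sum fun s hs => ?_)
          · rw [Finset.mem_sdiff, mem_actF] at hs
            exact flat_le_inf hR ha hb hb1 hs.1 hs.2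
          · exact flat_supermodular hR ha hb (mem_actF.1 (hsub hs))
        have hpow := pow_le_pow_right₀ hK hfl
        rw [pow_add, pow_add] at hpow
        have hexp : Real.exp (l * lin R a) * Real.exp (l * lin R b) =
            Real.exp (l * lin R (a ⊓ b)) * Real.exp (l * lin R (a ⊔ b)) := by
          rw [← Real.exp_add, ← Real.exp_add]
          congr 1
          linear_combination l * hlin
        have h0 : (a 0 : ℝ) + M ≤ ((a ⊔ b) 0 : ℤ) + M := by
          have : a 0 ≤ (a ⊔ b) 0 := by simp
          have : (a 0 : ℝ) ≤ ((a ⊔ b) 0 : ℤ) := by exact_mod_cast this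
          linarith
        calc _ = (Real.exp (l * lin R a) * Real.exp (l * lin R b)) *
              ((K ^ (∑ s ∈ actF 0 R, flat s a) * K ^ (∑ s ∈ innerF R, flat s b)) * (a 0 + M)) := by ring
          _ ≤ (Real.exp (l * lin R a) * Real.exp (l * lin R b)) *
              ((K ^ (∑ s ∈ actF 0 R, flat s (a ⊓ b)) * K ^ (∑ s ∈ innerF R, flat s (a ⊔ b))) *
                (((a ⊔ b) 0 : ℤ) + M)) := by
            refine mul_le_mul_of_nonneg_left ?_ (by positivity)
            exact mul_le_mul hpow h0 (hMh a (mem_heights.2 ha)) (by positivity)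
          _ = _ := by rw [hexp]; ring
      · have e0 : W' b = 0 := by simp only [hW', if_neg hb1]
        rw [e0, mul_zero]
        exact mul_nonneg (hWpos _).le (mul_nonneg (hW'nn _) (hMh _ hsupH)))
  have hrefl : ∑ h ∈ heights R, W' h * (h 0 - 1) = 0 := by
    have hsum : ∑ h ∈ heights R, W' h * ((h 0 : ℝ) - 1) =
        ∑ h ∈ heights R with RingOne R h,
          Real.exp (l * lin R h) * K ^ (∑ s ∈ innerF R, flat s h) * ((h 0 : ℝ) - 1) := by
      rw [Finset.sum_filter]
      refine Finset.sum_congr rfl fun h _ => ?_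
      simp only [hW', ite_mul, zero_mul]
    rw [hsum]
    have : ∀ x : ℝ, x = -x → x = 0 := fun x h => by linarith
    apply this
    rw [← Finset.sum_neg_distrib]
    have hmem : ∀ h ∈ (heights R).filter (RingOne R), reflect R h ∈ (heights R).filter (RingOne R) := by
      intro h hh
      rw [Finset.mem_filter, mem_heights] at *
      exact ⟨reflect_isHeight hh.1 hh.2, reflect_ring hh.2⟩
    refine Finset.sum_nbij' (reflect R) (reflect R) hmem hmem (fun h _ => reflect_reflect R h)
      (fun h _ => reflect_reflect R h) ?_
    intro h hh
    rw [Finset.mem_filter] at hh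
    rw [reflect_lin hh.2, Finset.sum_congr rfl fun s hs => reflect_flat hR hs, reflect, if_pos h00]
    push_cast
    ring
  have hpos : 0 < ∑ h ∈ heights R, W' h := by
    refine Finset.sum_pos' (fun h _ => hW'nn h)
      ⟨fun v => if dom 0 R v ∧ par 1 v then 1 else 0, ?_, ?_⟩
    · rw [mem_heights]
      refine ⟨fun v hv => by simp [hv], fun v w hvw hv => ?_⟩
      have hx : (dom 0 R v ∧ par 1 v) ↔ ¬ (dom 0 R w ∧ par 1 w) := by
        unfold dom par at *
        simp only [Prod.fst_zero, Prod.snd_zero] at *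
        rcases hvw with rfl | rfl | rfl | rfl <;> simp only <;> omega
      by_cases hw : dom 0 R w ∧ par 1 w
      · simp [hx, hw]
      · simp [hx, hw]
    · have : RingOne R fun v => if dom 0 R v ∧ par 1 v then 1 else 0 := by
        intro v hv hv'
        have : par 1 v := by
          unfold dom par at *
          simp only [Prod.fst_zero, Prod.snd_zero] at *
          omega
        simp [hv, this]
      simp only [hW', if_pos this]
      positivity
  have e1 : ∑ h ∈ heights R, W h * (h 0 + M) = ∑ h ∈ heights R, W h * h 0 + M * ∑ h ∈ heights R, W h := by
    rw [Finset.mul_sum, ← Finset.sum_add_distrib]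
    exact Finset.sum_congr rfl fun h _ => by ring
  have e2 : ∑ h ∈ heights R, W' h * (h 0 + M) = (1 + M) * ∑ h ∈ heights R, W' h := by
    rw [← sub_eq_zero, Finset.mul_sum, ← Finset.sum_sub_distrib, ← hrefl]
    exact Finset.sum_congr rfl fun h _ => by ring
  rw [e1, e2] at four
  have : (∑ h ∈ heights R, W h * h 0) * ∑ h ∈ heights R, W' h ≤
      (∑ h ∈ heights R, W h) * ∑ h ∈ heights R, W' h := by linarith
  exact le_of_mul_le_mul_right this hpos

/-- Number of classes of `rel`. -/
noncomputable def kap (z : ℤ × ℤ) (R τ : ℤ) (O : Set (ℤ × ℤ)) : ℕ := Nat.card (Quot (rel z R τ O))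

theorem kap_pos (z : ℤ × ℤ) (R τ : ℤ) (O : Set (ℤ × ℤ)) : 0 < kap z R τ O := by
  have : Nonempty (Quot (rel z R τ O)) := ⟨Quot.mk _ z⟩
  exact Nat.card_pos

/-- The mean depth of the origin is bounded. -/
theorem mean_depth_le {R : ℤ} (hR : R % 2 = 0) (h2R : 2 ≤ R) (l : ℝ) :
    Real.tanh l * ∑ O ∈ (actF 0 R).powerset, (Real.exp l + Real.exp (-l)) ^ kap 0 R 0 (O : Finset (ℤ × ℤ)) *
        depth R (O : Finset (ℤ × ℤ)) 0 ≤
      ∑ O ∈ (actF 0 R).powerset, (Real.exp l + Real.exp (-l)) ^ kap 0 R 0 (O : Finset (ℤ × ℤ)) := by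
  set x := Real.exp l + Real.exp (-l) with hx
  have hx0 : 0 < x := by positivity
  set K := Real.exp (l / 2) + Real.exp (-(l / 2)) with hK
  have hK1 : 1 ≤ K := by
    have h1 := Real.add_one_le_exp (l / 2)
    have h2 := Real.add_one_le_exp (-(l / 2))
    linarith
  have main := mean_height_le hR h2R l K hK1
  have swap : ∀ f : (ℤ × ℤ → ℤ) → ℝ, ∑ h ∈ heights R,
      Real.exp (l * lin R h) * K ^ (∑ s ∈ actF 0 R, flat s h) * f h =
      ∑ O ∈ (actF 0 R).powerset, ∑ h ∈ heights R with Compat R (O : Finset (ℤ × ℤ)) h,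
        Real.exp (l * energy R (O : Finset (ℤ × ℤ)) h) * f h := by
    intro f
    simp only [Finset.sum_filter]
    rw [Finset.sum_comm]
    refine Finset.sum_congr rfl fun h hh => ?_
    rw [← sum_compat hR (mem_heights.1 hh), Finset.sum_mul, Finset.sum_filter]
  have hk : ∀ O : Finset (ℤ × ℤ), x ^ kap 0 R 0 (O : Set (ℤ × ℤ)) =
      x * x ^ (Fintype.card (Cl R O) - 1) := by
    intro O
    have h1 := kap_pos 0 R 0 (O : Set (ℤ × ℤ))
    have h2 : kap 0 R 0 (O : Set (ℤ × ℤ)) = Fintype.card (Cl R O) := Nat.card_eq_fintype_card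
    rw [← h2, ← pow_succ']
    congr 1
    omega
  have s1 := swap fun h => (h 0 : ℝ)
  have s2 := swap fun _ => 1
  simp only [mul_one] at s2
  rw [s1, s2, Finset.sum_congr rfl fun O _ => (sum_heights hR h2R (O : Finset (ℤ × ℤ)) l 0).2,
    Finset.sum_congr rfl fun O _ => (sum_heights hR h2R (O : Finset (ℤ × ℤ)) l 0).1] at main
  have := mul_le_mul_of_nonneg_left main hx0.le
  rw [Finset.mul_sum, Finset.mul_sum] at this
  rw [Finset.mul_sum, Finset.sum_congr rfl fun O _ => hk O]
  refine le_trans (le_of_eq (Finset.sum_congr rfl fun O _ => ?_)) this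
  rw [hk]
  ring

/-- The tilted square of radius `n` around `v` lies in the one of radius `R` around the origin. -/
def Inside (v : ℤ × ℤ) (n R : ℤ) : Prop := |v.1 + v.2| + n ≤ R ∧ |v.1 - v.2| + n ≤ R

theorem Inside.dom {v : ℤ × ℤ} {n R : ℤ} (h : Inside v n R) {w : ℤ × ℤ} (hw : dom v n w) :
    dom 0 R w := by
  have h1 := abs_le.1 (show |v.1 + v.2| ≤ R - n by have := h.1; omega)
  have h2 := abs_le.1 (show |v.1 - v.2| ≤ R - n by have := h.2; omega)
  unfold Potts.dom at *
  simp only [Prod.fst_zero, Prod.snd_zero]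
  omega

theorem Inside.act {v : ℤ × ℤ} {n R : ℤ} (h : Inside v n R) {w : ℤ × ℤ} (hw : act v n w) :
    act 0 R w := by
  have h1 := abs_le.1 (show |v.1 + v.2| ≤ R - n by have := h.1; omega)
  have h2 := abs_le.1 (show |v.1 - v.2| ≤ R - n by have := h.2; omega)
  unfold Potts.act at *
  simp only [Prod.fst_zero, Prod.snd_zero]
  omega

theorem relc_shrink {v : ℤ × ℤ} {n R τ : ℤ} (hn : n % 2 = 0) (hv : par τ v) (h : Inside v n R)
    {A C : Set (ℤ × ℤ)} (hAC : A ⊆ C) {x y : ℤ × ℤ} (hxy : EqvGen (relc 0 R τ A) x y) :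
    EqvGen (relc v n τ C) x y := by
  refine eqvGen_le ?_ hxy
  rintro x y (⟨s, h1, h2, rfl, rfl⟩ | ⟨h1, h2⟩)
  · by_cases hs : act v n s
    · exact .rel _ _ (Or.inl ⟨s, hs, hAC h2, rfl, rfl⟩)
    · have := not_act_out hn hv hs
      exact .rel _ _ (Or.inr ⟨fun h' => this.1 h'.1, fun h' => this.2 h'.1⟩)
  · exact .rel _ _ (Or.inr ⟨fun h' => h1 ⟨h.dom h'.1, h'.2⟩, fun h' => h2 ⟨h.dom h'.1, h'.2⟩⟩)

theorem relc_grow {v : ℤ × ℤ} {n R τ : ℤ} (hn : n % 2 = 0) (hv : par τ v) (h : Inside v n R)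
    {A C : Set (ℤ × ℤ)} (hAC : C ⊆ A) {x y : ℤ × ℤ} (hx : dom v n x ∧ par (1 - τ) x)
    (hxy : EqvGen (relc v n (1 - τ) C) x y) : EqvGen (relc 0 R (1 - τ) A) x y := by
  have key : ((dom v n x ∧ par (1 - τ) x) ↔ (dom v n y ∧ par (1 - τ) y)) ∧
      ((dom v n x ∧ par (1 - τ) x) → EqvGen (relc 0 R (1 - τ) A) x y) := by
    clear hx
    induction hxy with
    | rel x y h' =>
      rcases h' with ⟨s, h1, h2, rfl, rfl⟩ | ⟨h1, h2⟩
      · have := act_in_other hn hv h1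
        exact ⟨iff_of_true ⟨this.1, par_e1 _ _⟩ ⟨this.2, par_e2 _ _⟩,
          fun _ => .rel _ _ (Or.inl ⟨s, h.act h1, hAC h2, rfl, rfl⟩)⟩
      · exact ⟨iff_of_false h1 h2, fun h3 => absurd h3 h1⟩
    | refl x => exact ⟨Iff.rfl, fun _ => .refl _⟩
    | symm x y _ ih => exact ⟨ih.1.symm, fun h3 => .symm _ _ (ih.2 (ih.1.2 h3))⟩
    | trans x y z _ _ ih1 ih2 =>
      exact ⟨ih1.1.trans ih2.1, fun h3 => .trans _ _ _ (ih1.2 h3) (ih2.2 (ih1.1.1 h3))⟩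
  exact key.2 hx

theorem kap_insert {z : ℤ × ℤ} {R τ : ℤ} {X : Set (ℤ × ℤ)} {s : ℤ × ℤ} (hs : act z R s)
    (hX : s ∉ X) : kap z R τ (insert s X) +
      (if EqvGen (relc z R τ X) (e1 τ s) (e2 τ s) then 0 else 1) = kap z R τ X +
      (if EqvGen (relc z R (1 - τ) (insert s X)ᶜ) (e1 (1 - τ) s) (e2 (1 - τ) s) then 0 else 1) := by
  have a1 := kappa_add_one z R τ X
  have a2 := kappa_add_one z R τ (insert s X)
  have b1 := kc_insert (τ := τ) X hs
  have b2 := kc_insert (τ := 1 - τ) (insert s X)ᶜ hs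
  have e : insert s (insert s X)ᶜ = Xᶜ := by
    ext t
    by_cases ht : t = s
    · subst ht; simp [hX]
    · simp [ht]
  rw [e] at b2
  unfold kap
  omega

theorem kap_union {v : ℤ × ℤ} {n R τ : ℤ} (hn : n % 2 = 0) (hv : par τ v) (h : Inside v n R)
    {A C : Set (ℤ × ℤ)} (hAC : A ⊆ C) (B : Finset (ℤ × ℤ)) (hB : ∀ s ∈ B, act v n s ∧ s ∉ C) :
    kap 0 R τ (A ∪ B) + kap v n τ C ≤ kap 0 R τ A + kap v n τ (C ∪ B) := by
  induction B using Finset.induction_on with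
  | empty => simp
  | insert s B hs ih =>
    have ih := ih fun t ht => hB t (Finset.mem_insert_of_mem ht)
    obtain ⟨h1, h2⟩ := hB s (Finset.mem_insert_self _ _)
    have hA : s ∉ A ∪ (B : Set (ℤ × ℤ)) := by
      rintro (h' | h')
      · exact h2 (hAC h')
      · exact hs h'
    have hC : s ∉ C ∪ (B : Set (ℤ × ℤ)) := by
      rintro (h' | h')
      · exact h2 h'
      · exact hs h'
    have i1 := kap_insert (τ := τ) (h.act h1) hA
    have i2 := kap_insert (τ := τ) h1 hC
    have hsub : A ∪ (B : Set (ℤ × ℤ)) ⊆ C ∪ B := Set.union_subset_union_left _ hAC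
    have m1 : EqvGen (relc 0 R τ (A ∪ B)) (e1 τ s) (e2 τ s) →
        EqvGen (relc v n τ (C ∪ B)) (e1 τ s) (e2 τ s) := relc_shrink hn hv h hsub
    have m2 : EqvGen (relc v n (1 - τ) (insert s (C ∪ B))ᶜ) (e1 (1 - τ) s) (e2 (1 - τ) s) →
        EqvGen (relc 0 R (1 - τ) (insert s (A ∪ B))ᶜ) (e1 (1 - τ) s) (e2 (1 - τ) s) :=
      relc_grow hn hv h (Set.compl_subset_compl.2 (Set.insert_subset_insert hsub))
        ⟨(act_in_other hn hv h1).1, par_e1 _ _⟩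
    rw [Finset.coe_insert, Set.union_insert, Set.union_insert]
    split_ifs at i1 i2 <;> first | omega | (exfalso; tauto)

theorem rel_congr {z : ℤ × ℤ} {R τ : ℤ} {X Y : Set (ℤ × ℤ)}
    (h : ∀ s, act z R s → (s ∈ X ↔ s ∈ Y)) : rel z R τ X = rel z R τ Y := by
  funext v w
  refine propext ⟨?_, ?_⟩
  · rintro (⟨s, h1, h2, h3⟩ | ⟨s, h1, h2, h3⟩ | h')
    · exact Or.inl ⟨s, h1, (h s h1).1 h2, h3⟩
    · exact Or.inr (Or.inl ⟨s, h1, fun h4 => h2 ((h s h1).2 h4), h3⟩)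
    · exact Or.inr (Or.inr h')
  · rintro (⟨s, h1, h2, h3⟩ | ⟨s, h1, h2, h3⟩ | h')
    · exact Or.inl ⟨s, h1, (h s h1).2 h2, h3⟩
    · exact Or.inr (Or.inl ⟨s, h1, fun h4 => h2 ((h s h1).1 h4), h3⟩)
    · exact Or.inr (Or.inr h')

/-- Weighted sum of an event in the random-cluster model. -/
noncomputable def fk (x : ℝ) (z : ℤ × ℤ) (R τ : ℤ) (E : Finset (ℤ × ℤ) → Prop) : ℝ :=
  ∑ O ∈ (actF z R).powerset, if E O then x ^ kap z R τ (O : Finset (ℤ × ℤ)) else 0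

theorem fk_compare {x : ℝ} (hx : 1 ≤ x) {v : ℤ × ℤ} {n R τ : ℤ} (hn : n % 2 = 0) (hv : par τ v)
    (h : Inside v n R) :
    fk x 0 R τ (fun X => ∃ w, ¬ dom v n w ∧ EqvGen (rel 0 R τ X) v w) *
      fk x v n τ (fun _ => True) ≤
    fk x 0 R τ (fun _ => True) * fk x v n τ (fun Y => EqvGen (rel v n τ Y) v (out v n)) := by
  have hx0 : 0 < x := by linarith
  set S := actF 0 R with hS
  set T := actF v n with hT
  have hTS : T ⊆ S := fun s hs => mem_actF.2 (h.act (mem_actF.1 hs))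
  have ext : ∀ E : Finset (ℤ × ℤ) → Prop, (∀ Y, E (Y ∪ (S \ T)) ↔ E Y) →
      fk x v n τ E = ∑ Y ∈ S.powerset, if S \ T ⊆ Y ∧ E Y then
        x ^ kap v n τ (Y : Finset (ℤ × ℤ)) else 0 := by
    intro E hE
    simp only [ite_and, ← Finset.sum_filter (p := fun Y => S \ T ⊆ Y)]
    refine Finset.sum_nbij' (fun Y => Y ∪ (S \ T)) (fun Y => Y ∩ T) ?_ ?_ ?_ ?_ ?_
    · intro Y hY
      rw [Finset.mem_powerset] at hY
      rw [Finset.mem_filter, Finset.mem_powerset]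
      exact ⟨Finset.union_subset (hY.trans hTS) Finset.sdiff_subset, Finset.subset_union_right⟩
    · intro Y _
      exact Finset.mem_powerset.2 Finset.inter_subset_right
    · intro Y hY
      rw [Finset.mem_powerset] at hY
      ext s
      simp only [Finset.mem_inter, Finset.mem_union, Finset.mem_sdiff]
      constructor
      · rintro ⟨h1 | h1, h2⟩
        · exact h1
        · exact absurd h2 h1.2
      · exact fun h1 => ⟨Or.inl h1, hY h1⟩
    · intro Y hY
      rw [Finset.mem_filter, Finset.mem_powerset] at hY
      ext s
      simp only [Finset.mem_inter, Finset.mem_union, Finset.mem_sdiff]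
      constructor
      · rintro (h1 | h1)
        · exact h1.1
        · exact hY.2 (Finset.mem_sdiff.2 h1)
      · intro h1
        by_cases h2 : s ∈ T
        · exact Or.inl ⟨h1, h2⟩
        · exact Or.inr ⟨hY.1 h1, h2⟩
    · intro Y _
      have e : rel v n τ ((Y ∪ (S \ T) : Finset (ℤ × ℤ)) : Set (ℤ × ℤ)) = rel v n τ (Y : Set (ℤ × ℤ)) :=
        rel_congr fun s hs => by
          have := mem_actF.2 hs
          rw [← hT] at this
          simp [this]
      simp only [hE, kap, e]
  have relext : ∀ Y : Finset (ℤ × ℤ), rel v n τ ((Y ∪ (S \ T) : Finset (ℤ × ℤ)) : Set (ℤ × ℤ)) =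
      rel v n τ (Y : Set (ℤ × ℤ)) := fun Y =>
    rel_congr fun s hs => by
      have := mem_actF.2 hs
      rw [← hT] at this
      simp [this]
  rw [ext _ (fun _ => Iff.rfl), ext _ (fun Y => by rw [relext])]
  unfold fk
  rw [← hS]
  have nn : ∀ {p : Prop} {i : Decidable p} {k : ℕ}, 0 ≤ @ite ℝ p i (x ^ k) 0 := by
    intro p _ k; split_ifs <;> positivity
  refine four_functions_on S.powerset
    (fun a ha b _ => Finset.mem_powerset.2 (Finset.inter_subset_left.trans (Finset.mem_powerset.1 ha)))
    (fun a ha b hb => Finset.mem_powerset.2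
      (Finset.union_subset (Finset.mem_powerset.1 ha) (Finset.mem_powerset.1 hb)))
    _ _ _ _ (fun _ _ => nn) (fun _ _ => nn) (fun _ _ => nn) (fun _ _ => nn) ?_
  intro X hX Y hY
  by_cases hE : ∃ w, ¬ dom v n w ∧ EqvGen (rel 0 R τ X) v w
  swap
  · rw [if_neg hE, zero_mul]; exact mul_nonneg (nn) (nn)
  by_cases hYT : S \ T ⊆ Y
  swap
  · rw [if_neg (c := S \ T ⊆ Y ∧ True) (fun h' => hYT h'.1), mul_zero]; exact mul_nonneg (nn) (nn)
  have hE' : EqvGen (rel v n τ ((X ∪ Y : Finset (ℤ × ℤ)) : Set (ℤ × ℤ))) v (out v n) := by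
    obtain ⟨w, hw, hvw⟩ := hE
    refine relc_lift (fun _ => hv) (fun h => absurd h (not_dom_out _ _)) ?_
    refine .trans _ _ _ (relc_shrink hn hv h (A := X) ?_
      (eqvGen_le (fun _ _ h => .rel _ _ (rel_le_relc h)) hvw))
      (.rel _ _ (Or.inr ⟨fun h => hw h.1, fun h => not_dom_out _ _ h.1⟩))
    simp
  rw [if_pos hE, if_pos ⟨hYT, trivial⟩, if_pos trivial, Finset.sup_eq_union, Finset.inf_eq_inter,
    if_pos ⟨hYT.trans Finset.subset_union_right, hE'⟩, ← pow_add, ← pow_add]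
  refine pow_le_pow_right₀ hx ?_
  have key := kap_union hn hv h (A := (X ∩ Y : Finset (ℤ × ℤ))) (C := Y) (by simp) (X \ Y) (by
    intro s hs
    rw [Finset.mem_sdiff] at hs
    refine ⟨?_, by simpa using hs.2⟩
    by_contra hcon
    exact hs.2 (hYT (Finset.mem_sdiff.2 ⟨Finset.mem_powerset.1 hX hs.1, fun h' => hcon (mem_actF.1 h')⟩)))
  rw [← Finset.coe_union, ← Finset.coe_union] at key
  have u1 : X ∩ Y ∪ X \ Y = X := by
    ext s; simp only [Finset.mem_union, Finset.mem_inter, Finset.mem_sdiff]; tauto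
  have u2 : Y ∪ X \ Y = X ∪ Y := by
    ext s; simp only [Finset.mem_union, Finset.mem_sdiff]; tauto
  rwa [u1, u2] at key

theorem rel_swap_sdiff {z : ℤ × ℤ} {R : ℤ} (O : Finset (ℤ × ℤ)) :
    rel z R 1 ((actF z R \ O : Finset (ℤ × ℤ)) : Set (ℤ × ℤ)) = rel z R 0 O := by
  rw [← rel_swap z R 0 O, sub_zero]
  refine rel_congr fun s hs => ?_
  simp [hs]

theorem fk_swap (x : ℝ) (z : ℤ × ℤ) (R : ℤ) (E : Finset (ℤ × ℤ) → Prop) :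
    fk x z R 1 E = fk x z R 0 fun O => E (actF z R \ O) := by
  unfold fk
  refine Finset.sum_nbij' (fun O => actF z R \ O) (fun O => actF z R \ O) ?_ ?_ ?_ ?_ ?_
  · intro O _; exact Finset.mem_powerset.2 Finset.sdiff_subset
  · intro O _; exact Finset.mem_powerset.2 Finset.sdiff_subset
  · intro O hO; exact Finset.sdiff_sdiff_eq_self (Finset.mem_powerset.1 hO)
  · intro O hO; exact Finset.sdiff_sdiff_eq_self (Finset.mem_powerset.1 hO)
  · intro O hO
    have : kap z R 1 (O : Set (ℤ × ℤ)) = kap z R 0 (actF z R \ O : Finset (ℤ × ℤ)) := by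
      unfold kap
      rw [← rel_swap_sdiff, Finset.sdiff_sdiff_eq_self (Finset.mem_powerset.1 hO)]
    simp only [Finset.sdiff_sdiff_eq_self (Finset.mem_powerset.1 hO), this]

theorem dom_add {v : ℤ × ℤ} {n : ℤ} (a : ℤ × ℤ) : dom v n (a + v) ↔ dom 0 n a := by
  unfold dom
  simp only [Prod.fst_add, Prod.snd_add, Prod.fst_zero, Prod.snd_zero]
  omega

theorem act_add {v : ℤ × ℤ} {n : ℤ} (a : ℤ × ℤ) : act v n (a + v) ↔ act 0 n a := by
  unfold act
  simp only [Prod.fst_add, Prod.snd_add, Prod.fst_zero, Prod.snd_zero]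
  omega

theorem e1_add {v : ℤ × ℤ} {τ ρ : ℤ} (h : (v.1 + v.2 + τ - ρ) % 2 = 0) (s : ℤ × ℤ) :
    e1 τ (s + v) = e1 ρ s + v := by
  unfold e1
  have : ((s + v).1 + (s + v).2 + τ) % 2 = 0 ↔ (s.1 + s.2 + ρ) % 2 = 0 := by
    simp only [Prod.fst_add, Prod.snd_add]; omega
  simp only [this]
  split_ifs
  · rfl
  · ext <;> simp only [Prod.fst_add, Prod.snd_add]; ring

theorem e2_add {v : ℤ × ℤ} {τ ρ : ℤ} (h : (v.1 + v.2 + τ - ρ) % 2 = 0) (s : ℤ × ℤ) :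
    e2 τ (s + v) = e2 ρ s + v := by
  unfold e2
  have : ((s + v).1 + (s + v).2 + τ) % 2 = 0 ↔ (s.1 + s.2 + ρ) % 2 = 0 := by
    simp only [Prod.fst_add, Prod.snd_add]; omega
  simp only [this]
  split_ifs <;> ext <;> simp only [Prod.fst_add, Prod.snd_add] <;> ring

theorem rel_add {v : ℤ × ℤ} {n τ : ℤ} (hv : par τ v) (O : Finset (ℤ × ℤ)) (a b : ℤ × ℤ) :
    rel 0 n 0 O a b ↔
      rel v n τ (O.map (Equiv.addRight v).toEmbedding : Finset (ℤ × ℤ)) (a + v) (b + v) := by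
  have h0 : (v.1 + v.2 + τ - 0) % 2 = 0 := by unfold par at hv; omega
  have h1 : (v.1 + v.2 + (1 - τ) - (1 - 0)) % 2 = 0 := by unfold par at hv; omega
  have hex : ∀ P : ℤ × ℤ → Prop, (∃ s, P s) ↔ ∃ s, P (s + v) := fun P =>
    ⟨fun ⟨s, hs⟩ => ⟨s - v, by simpa using hs⟩, fun ⟨s, hs⟩ => ⟨_, hs⟩⟩
  have hm : ∀ s, s + v ∈ ((O.map (Equiv.addRight v).toEmbedding : Finset (ℤ × ℤ)) : Set (ℤ × ℤ)) ↔
      s ∈ (O : Set (ℤ × ℤ)) := by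
    intro s
    simp
  unfold rel
  rw [hex fun s => act v n s ∧ s ∈ _ ∧ a + v = e1 τ s ∧ b + v = e2 τ s,
    hex fun s => act v n s ∧ s ∉ _ ∧ a + v = e1 (1 - τ) s ∧ b + v = e2 (1 - τ) s]
  simp only [act_add, dom_add, hm, e1_add h0, e2_add h0, e1_add h1, e2_add h1, add_left_inj]

theorem fk_add {x : ℝ} {v : ℤ × ℤ} {n τ : ℤ} (hv : par τ v) {E E' : Finset (ℤ × ℤ) → Prop}
    (hE : ∀ O, E' O ↔ E (O.map (Equiv.addRight v).toEmbedding)) :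
    fk x v n τ E = fk x 0 n 0 E' := by
  unfold fk
  symm
  refine Finset.sum_nbij' (fun O => O.map (Equiv.addRight v).toEmbedding)
    (fun O => O.map (Equiv.addRight v).symm.toEmbedding) ?_ ?_ ?_ ?_ ?_
  · intro O hO
    refine Finset.mem_powerset.2 fun s hs => ?_
    obtain ⟨t, ht, rfl⟩ := Finset.mem_map.1 hs
    exact mem_actF.2 ((act_add t).2 (mem_actF.1 (Finset.mem_powerset.1 hO ht)))
  · intro O hO
    refine Finset.mem_powerset.2 fun s hs => ?_
    obtain ⟨t, ht, rfl⟩ := Finset.mem_map.1 hs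
    refine mem_actF.2 ((act_add (v := v) _).1 ?_)
    have := mem_actF.1 (Finset.mem_powerset.1 hO ht)
    simpa using this
  · intro O _; ext s; simp
  · intro O _; ext s; simp
  · intro O _
    have : kap 0 n 0 (O : Set (ℤ × ℤ)) =
        kap v n τ (O.map (Equiv.addRight v).toEmbedding : Finset (ℤ × ℤ)) :=
      Nat.card_congr (Quot.congr (Equiv.addRight v) fun a b => rel_add hv O a b)
    simp only [hE, this]

/-- Probability that the origin is connected to the outside of the box of radius `n`. -/
noncomputable def arm (x : ℝ) (n : ℤ) : ℝ :=
  fk x 0 n 0 (fun O => EqvGen (rel 0 n 0 O) 0 (out 0 n)) / fk x 0 n 0 fun _ => True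

theorem fk_pos {x : ℝ} (hx : 0 < x) (z : ℤ × ℤ) (R τ : ℤ) : 0 < fk x z R τ fun _ => True := by
  refine Finset.sum_pos (fun O _ => ?_) ⟨∅, Finset.empty_mem_powerset _⟩
  rw [if_pos trivial]; positivity

theorem fk_mono {x : ℝ} (hx : 0 ≤ x) {z : ℤ × ℤ} {R τ : ℤ} {E E' : Finset (ℤ × ℤ) → Prop}
    (h : ∀ O ∈ (actF z R).powerset, E O → E' O) : fk x z R τ E ≤ fk x z R τ E' := by
  refine Finset.sum_le_sum fun O hO => ?_
  by_cases h1 : E O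
  · rw [if_pos h1, if_pos (h O hO h1)]
  · rw [if_neg h1]; split_ifs <;> positivity

theorem fk_or_le {x : ℝ} (hx : 0 ≤ x) {z : ℤ × ℤ} {R τ : ℤ} (E E' : Finset (ℤ × ℤ) → Prop) :
    fk x z R τ (fun O => E O ∨ E' O) ≤ fk x z R τ E + fk x z R τ E' := by
  unfold fk
  rw [← Finset.sum_add_distrib]
  refine Finset.sum_le_sum fun O hO => ?_
  have : 0 ≤ x ^ kap z R τ (O : Set (ℤ × ℤ)) := by positivity
  split_ifs <;> first | tauto | linarith

theorem fk_exists_le {x : ℝ} (hx : 0 ≤ x) {z : ℤ × ℤ} {R τ : ℤ} {ι : Type*} (s : Finset ι)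
    (E : ι → Finset (ℤ × ℤ) → Prop) :
    fk x z R τ (fun O => ∃ i ∈ s, E i O) ≤ ∑ i ∈ s, fk x z R τ (E i) := by
  induction s using Finset.induction_on with
  | empty => simp [fk]
  | insert i s hi ih =>
    rw [Finset.sum_insert hi]
    refine le_trans ?_ (add_le_add_right ih _)
    refine le_trans (fk_mono hx ?_) (fk_or_le hx _ _)
    rintro O _ ⟨j, hj, h⟩
    rcases Finset.mem_insert.1 hj with rfl | hj
    · exact Or.inl h
    · exact Or.inr ⟨j, hj, h⟩

theorem fk_far_le {x : ℝ} (hx : 1 ≤ x) {v : ℤ × ℤ} {n R : ℤ} (hn : n % 2 = 0)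
    (h : Inside v n R) :
    fk x 0 R 0 (fun O => ∃ w, ¬ dom v n w ∧ EqvGen (rel 0 R 0 O) v w) ≤
      arm x n * fk x 0 R 0 fun _ => True := by
  have hx0 : 0 < x := by linarith
  have hev : ∀ {τ : ℤ}, par τ v → fk x v n τ (fun Y => EqvGen (rel v n τ Y) v (out v n)) =
      fk x 0 n 0 (fun O => EqvGen (rel 0 n 0 O) 0 (out 0 n)) := by
    intro τ hτ
    refine fk_add hτ fun O => ?_
    have h1 := rel_add (n := n) hτ O
    have e : (0 : ℤ × ℤ) + v = v := zero_add v
    have e' : out 0 n + v = out v n := by ext <;> simp [out, add_comm]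
    constructor
    · intro h
      have := eqvGen_lift (· + v) (fun a b hab => .rel _ _ ((h1 a b).1 hab)) h
      simpa only [e, e'] using this
    · intro h
      have := eqvGen_lift (s := rel 0 n 0 (O : Set (ℤ × ℤ))) (· - v) (fun a b hab => .rel _ _ ((h1 _ _).2 (by simpa using hab))) h
      simpa [← e'] using this
  rw [arm, div_mul_eq_mul_div, le_div_iff₀ (fk_pos hx0 _ _ _)]
  rw [mul_comm (fk x 0 n 0 _)]
  have hτ : par 0 v ∨ par 1 v := by unfold par; omega
  rcases hτ with hτ | hτ
  · have := fk_compare hx hn hτ h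
    rwa [hev hτ, fk_add hτ (E' := fun _ => True) fun _ => Iff.rfl] at this
  · have := fk_compare hx hn hτ h
    rw [hev hτ, fk_add hτ (E' := fun _ => True) fun _ => Iff.rfl, fk_swap, fk_swap] at this
    simpa only [rel_swap_sdiff] using this

theorem rel_out_of_depth {R : ℤ} {O : Set (ℤ × ℤ)} {v : ℤ × ℤ} (h : depth R O v = 0) :
    EqvGen (rel 0 R 0 O) v (out 0 R) := by
  have := ((tree_connected R O).dist_eq_zero_iff.1 h)
  exact ((mk_eq_iff _).1 this).symm

theorem exists_depth_pred {R : ℤ} (hR : R % 2 = 0) {O : Set (ℤ × ℤ)} {v : ℤ × ℤ} {k : ℕ}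
    (h : depth R O v = k + 1) :
    ∃ a b, EqvGen (rel 0 R 0 O) v a ∧ nn a b ∧ depth R O b = k := by
  obtain ⟨p, _, hp, _⟩ := tree_parent (tree_isTree hR O) (clRoot R O)
  have hne : cl R O v ≠ clRoot R O := by
    intro e
    rw [depth, e, SimpleGraph.dist_self] at h
    omega
  obtain ⟨⟨_, a, b, hab, ha, hb⟩, hd⟩ := hp _ hne
  refine ⟨a, b, ((mk_eq_iff _).1 ha).symm, hab, ?_⟩
  unfold depth at *
  rw [hb]
  omega

theorem card_domF (v : ℤ × ℤ) (n : ℤ) : (domF v n).card = (domF 0 n).card := by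
  symm
  refine Finset.card_bij (fun a _ => a + v) ?_ ?_ ?_
  · intro a ha; simpa [dom_add] using ha
  · intro a _ b _ h; simpa using h
  · intro b hb
    refine ⟨b - v, ?_, by simp⟩
    have := dom_add (v := v) (n := n) (b - v)
    rw [sub_add_cancel] at this
    simpa [← this] using hb

theorem depth_le_succ {R n : ℤ} (hR : R % 2 = 0) {O : Set (ℤ × ℤ)} {v : ℤ × ℤ} {j : ℕ}
    (hin : Inside v n R) (h : depth R O v ≤ j + 1) :
    (∃ w, ¬ dom v n w ∧ EqvGen (rel 0 R 0 O) v w) ∨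
      ∃ w ∈ domF v (n + 1), depth R O w ≤ j := by
  by_cases hfar : ∃ w, ¬ dom v n w ∧ EqvGen (rel 0 R 0 O) v w
  · exact Or.inl hfar
  right
  rcases hd : depth R O v with - | k
  · exact absurd ⟨_, fun h' => not_dom_out 0 R (hin.dom h'), rel_out_of_depth hd⟩ hfar
  obtain ⟨a, b, h1, h2, h3⟩ := exists_depth_pred hR hd
  have ha : dom v n a := by
    by_contra hcon
    exact hfar ⟨a, hcon, h1⟩
  refine ⟨b, mem_domF.2 ?_, by omega⟩
  unfold dom at *
  rcases h2 with rfl | rfl | rfl | rfl <;> simp only <;> omega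

theorem Inside.of_dom {v w : ℤ × ℤ} {n d R : ℤ} (h : Inside v (n + d) R) (hw : Potts.dom v n w) :
    Inside w d R := by
  have h1 := abs_le.1 (show |v.1 + v.2| ≤ R - (n + d) by have := h.1; omega)
  have h2 := abs_le.1 (show |v.1 - v.2| ≤ R - (n + d) by have := h.2; omega)
  have h3 : |w.1 + w.2| ≤ R - d := abs_le.2 (by unfold Potts.dom at hw; omega)
  have h4 : |w.1 - w.2| ≤ R - d := abs_le.2 (by unfold Potts.dom at hw; omega)
  exact ⟨by omega, by omega⟩

theorem Inside.mono {v : ℤ × ℤ} {n d R : ℤ} (h : Inside v d R) (hn : n ≤ d) : Inside v n R :=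
  ⟨by have := h.1; omega, by have := h.2; omega⟩

theorem depth_tail {x : ℝ} (hx : 1 ≤ x) (harm : ∀ δ > 0, ∃ n : ℤ, n % 2 = 0 ∧ arm x n ≤ δ)
    (j : ℕ) : ∀ δ > 0, ∃ d : ℤ, ∀ R v, R % 2 = 0 → Inside v d R →
      fk x 0 R 0 (fun O => depth R O v ≤ j) ≤ δ * fk x 0 R 0 fun _ => True := by
  have hx0 : 0 < x := by linarith
  induction j with
  | zero =>
    intro δ hδ
    obtain ⟨n, hn, han⟩ := harm δ hδ
    refine ⟨n, fun R v hR hv => ?_⟩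
    refine (fk_mono hx0.le (fun O _ h => ?_)).trans ((fk_far_le hx hn hv).trans
      (mul_le_mul_of_nonneg_right han (fk_pos hx0 _ _ _).le))
    exact ⟨_, fun h' => not_dom_out 0 R (hv.dom h'), rel_out_of_depth (Nat.le_zero.1 h)⟩
  | succ j ih =>
    intro δ hδ
    obtain ⟨n, hn, han⟩ := harm (δ / 2) (by positivity)
    set K := (domF 0 (n + 1)).card with hK
    obtain ⟨d, hd⟩ := ih (δ / (2 * (K + 1))) (by positivity)
    refine ⟨max n (n + 1 + d), fun R v hR hv => ?_⟩
    have hv1 : Inside v n R := hv.mono (le_max_left _ _)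
    have hZ := fk_pos hx0 0 R 0
    set Z := fk x 0 R 0 fun _ => True
    calc fk x 0 R 0 (fun O => depth R O v ≤ j + 1)
        ≤ fk x 0 R 0 (fun O => (∃ w, ¬ dom v n w ∧ EqvGen (rel 0 R 0 O) v w) ∨
            ∃ w ∈ domF v (n + 1), depth R O w ≤ j) :=
          fk_mono hx0.le fun O _ h => depth_le_succ hR hv1 h
      _ ≤ δ / 2 * Z + ∑ w ∈ domF v (n + 1), δ / (2 * (K + 1)) * Z := by
          refine (fk_or_le hx0.le _ _).trans (add_le_add ?_ ?_)
          · exact (fk_far_le hx hn hv1).trans (mul_le_mul_of_nonneg_right han hZ.le)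
          · refine (fk_exists_le hx0.le _ fun w (O : Finset (ℤ × ℤ)) => depth R O w ≤ j).trans
              (Finset.sum_le_sum fun w hw => hd R w hR ?_)
            exact (hv.mono (le_max_right _ _)).of_dom (mem_domF.1 hw)
      _ ≤ δ * Z := by
          rw [Finset.sum_const, card_domF, ← hK, nsmul_eq_mul]
          have : (K : ℝ) * (δ / (2 * (K + 1))) ≤ δ / 2 := by
            rw [← mul_div_assoc, div_le_div_iff₀ (by positivity) (by positivity)]
            nlinarith
          nlinarith

/-- The arm probability does not tend to zero along even radii. -/
theorem exists_arm_gt {l : ℝ} (hl : 0 < l) :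
    ∃ δ > 0, ∀ n : ℤ, n % 2 = 0 → δ < arm (Real.exp l + Real.exp (-l)) n := by
  by_contra! hcon
  set x := Real.exp l + Real.exp (-l) with hx
  have hx1 : 1 ≤ x := by
    have h1 := Real.add_one_le_exp l
    have h2 := Real.exp_pos (-l)
    linarith
  have hx0 : 0 < x := by linarith
  have ht : 0 < Real.tanh l := by
    rw [Real.tanh_eq_sinh_div_cosh]
    exact div_pos (Real.sinh_pos_iff.2 hl) (Real.cosh_pos _)
  obtain ⟨j, hj⟩ := exists_nat_gt (2 / Real.tanh l)
  obtain ⟨d, hd⟩ := depth_tail hx1 hcon j (1 / 2) (by norm_num)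
  set R : ℤ := 2 * (|d| + 1) with hR
  have hR2 : R % 2 = 0 := by omega
  have hdR : Inside 0 d R := by
    have := le_abs_self d
    have := abs_nonneg d
    constructor <;> simp <;> omega
  have h1 := hd R 0 hR2 hdR
  have h2 := mean_depth_le hR2 (by have := abs_nonneg d; omega) l
  rw [← hx] at h2
  have h3 : ((j : ℝ) + 1) * (fk x 0 R 0 (fun _ => True) - fk x 0 R 0 fun O => depth R O 0 ≤ j) ≤
      ∑ O ∈ (actF 0 R).powerset, x ^ kap 0 R 0 (O : Finset (ℤ × ℤ)) *
        depth R (O : Finset (ℤ × ℤ)) 0 := by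
    unfold fk
    rw [← Finset.sum_sub_distrib, Finset.mul_sum]
    refine Finset.sum_le_sum fun O _ => ?_
    have hp : 0 < x ^ kap 0 R 0 (O : Set (ℤ × ℤ)) := by positivity
    by_cases h : depth R (O : Set (ℤ × ℤ)) 0 ≤ j
    · rw [if_pos trivial, if_pos h, sub_self, mul_zero]; positivity
    · rw [if_pos trivial, if_neg h, sub_zero, mul_comm]
      refine mul_le_mul_of_nonneg_left ?_ hp.le
      have : j + 1 ≤ depth R (O : Set (ℤ × ℤ)) 0 := by omega
      exact_mod_cast this
  have hZ := fk_pos hx0 0 R 0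
  have h4 : fk x 0 R 0 (fun _ => True) = ∑ O ∈ (actF 0 R).powerset, x ^ kap 0 R 0 (O : Finset (ℤ × ℤ)) := by
    unfold fk; simp
  rw [← h4] at h2
  set Z := fk x 0 R 0 fun _ => True
  rw [div_lt_iff₀ ht] at hj
  have h5 : ((j : ℝ) + 1) * (Z / 2) ≤ ((j : ℝ) + 1) * (Z - fk x 0 R 0 fun O => depth R O 0 ≤ j) :=
    mul_le_mul_of_nonneg_left (by linarith) (by positivity)
  have h6 := mul_le_mul_of_nonneg_left (h5.trans h3) ht.le
  have h7 : Real.tanh l * (((j : ℝ) + 1) * (Z / 2)) = (j * Real.tanh l + Real.tanh l) * (Z / 2) := by ring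
  nlinarith

/-- Even vertices correspond to the sites of the Potts model. -/
def site (v : ℤ × ℤ) : Fin 2 → ℤ := ![(v.1 + v.2) / 2, (v.1 - v.2) / 2]

/-- The even vertex of a site. -/
def vert (u : Fin 2 → ℤ) : ℤ × ℤ := (u 0 + u 1, u 0 - u 1)

theorem site_vert (u : Fin 2 → ℤ) : site (vert u) = u := by
  funext i
  fin_cases i <;> simp [site, vert] <;> omega

theorem vert_site {v : ℤ × ℤ} (h : par 0 v) : vert (site v) = v := by
  unfold par at h
  ext <;> simp [site, vert] <;> omega

theorem par_vert (u : Fin 2 → ℤ) : par 0 (vert u) := by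
  unfold par vert; simp only; omega

theorem eq_site {u : Fin 2 → ℤ} {v : ℤ × ℤ} (h : par 0 v) : u = site v ↔ vert u = v :=
  ⟨fun e => by rw [e, vert_site h], fun e => by rw [← e, site_vert]⟩

theorem mem_cube {N : ℕ} {u : Fin 2 → ℤ} :
    u ∈ cube N ↔ (-(N : ℤ) ≤ u 0 ∧ u 0 ≤ N) ∧ -(N : ℤ) ≤ u 1 ∧ u 1 ≤ N := by
  simp [cube, Fintype.mem_piFinset, Fin.forall_fin_two]

theorem mem_cube_iff_dom {N : ℕ} {u : Fin 2 → ℤ} : u ∈ cube N ↔ dom 0 (2 * N + 2) (vert u) := by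
  rw [mem_cube]
  unfold dom vert
  simp only [Prod.fst_zero, Prod.snd_zero]
  omega

theorem mem_nbrs {u v : Fin 2 → ℤ} : v ∈ nbrs u ↔ dist1 u v = 1 := by
  simp only [nbrs, Finset.mem_filter, Fintype.mem_piFinset, Finset.mem_Icc, Fin.forall_fin_two,
    and_iff_right_iff_imp, dist1, Fin.sum_univ_two]
  intro h
  have h0 := abs_nonneg (u 0 - v 0)
  have h1 := abs_nonneg (u 1 - v 1)
  have h2 := abs_le.1 (show |u 0 - v 0| ≤ 1 by omega)
  have h3 := abs_le.1 (show |u 1 - v 1| ≤ 1 by omega)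
  omega

theorem dist1_eq_one {u v : Fin 2 → ℤ} : dist1 u v = 1 ↔
    (v 0 = u 0 + 1 ∧ v 1 = u 1) ∨ (v 0 = u 0 - 1 ∧ v 1 = u 1) ∨
    (v 0 = u 0 ∧ v 1 = u 1 + 1) ∨ (v 0 = u 0 ∧ v 1 = u 1 - 1) := by
  simp only [dist1, Fin.sum_univ_two]
  rcases abs_cases (u 0 - v 0) with h | h <;> rcases abs_cases (u 1 - v 1) with h' | h' <;> omega

theorem inf_mem_actF {N : ℕ} {u v : Fin 2 → ℤ} (hu : u ∈ cube N) (h : v ∈ nbrs u) :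
    vert u ⊓ vert v ∈ actF 0 (2 * N + 2) := by
  rw [mem_nbrs, dist1_eq_one] at h
  rw [mem_cube] at hu
  rw [mem_actF]
  unfold act vert
  simp only [Prod.fst_inf, Prod.snd_inf, Prod.fst_zero, Prod.snd_zero]
  omega

theorem nbrs_inf_iff {u v : Fin 2 → ℤ} {s : ℤ × ℤ} : v ∈ nbrs u ∧ vert u ⊓ vert v = s ↔
    (u = site (e1 0 s) ∧ v = site (e2 0 s)) ∨ (u = site (e2 0 s) ∧ v = site (e1 0 s)) := by
  rw [eq_site (par_e1 0 s), eq_site (par_e2 0 s), eq_site (par_e1 0 s), eq_site (par_e2 0 s),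
    mem_nbrs, dist1_eq_one]
  unfold e1 e2 vert
  split_ifs <;> simp only [Prod.ext_iff, Prod.fst_inf, Prod.snd_inf] <;> omega

variable {q N : ℕ}

/-- Extension of a spin configuration by the boundary colour. -/
noncomputable def spin (σ : {x // x ∈ cube N} → Fin q) (c : Fin q) (u : Fin 2 → ℤ) : Fin q :=
  if h : u ∈ cube N then σ ⟨u, h⟩ else c

theorem spin_coe (σ : {x // x ∈ cube N} → Fin q) (c : Fin q) (u : {x // x ∈ cube N}) :
    spin σ c u = σ u := by
  simp [spin]

theorem spin_of_notMem (σ : {x // x ∈ cube N} → Fin q) (c : Fin q) {u : Fin 2 → ℤ}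
    (h : u ∉ cube N) : spin σ c u = c := by
  simp [spin, h]

theorem mem_cube_of_act {s : ℤ × ℤ} (hs : act 0 (2 * N + 2) s) :
    site (e1 0 s) ∈ cube N ∨ site (e2 0 s) ∈ cube N := by
  rw [mem_cube_iff_dom, mem_cube_iff_dom, vert_site (par_e1 0 s), vert_site (par_e2 0 s)]
  exact act_in (by omega) (by simp [par]) hs

theorem site_e1_ne (s : ℤ × ℤ) : site (e1 0 s) ≠ site (e2 0 s) := by
  intro h
  have := congrArg vert h
  rw [vert_site (par_e1 0 s), vert_site (par_e2 0 s)] at this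
  unfold e1 e2 at this
  split_ifs at this <;> simp [Prod.ext_iff] at this

/-- The number of satisfied edges, as a sum over squares. -/
theorem edge_sum (c : Fin q) (σ : {x // x ∈ cube N} → Fin q) :
    (1 / 2) * (∑ u ∈ (cube N).attach, ∑ v ∈ (cube N).attach,
      if dist1 (u : Fin 2 → ℤ) (v : Fin 2 → ℤ) = 1 then
        (if σ u = σ v then (1 : ℝ) else 0) else 0) +
    ∑ u ∈ (cube N).attach,
      (bCount N (u : Fin 2 → ℤ) : ℝ) * (if σ u = c then (1 : ℝ) else 0) =
    ∑ s ∈ actF 0 (2 * N + 2),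
      if spin σ c (site (e1 0 s)) = spin σ c (site (e2 0 s)) then (1 : ℝ) else 0 := by
  set f : (Fin 2 → ℤ) → (Fin 2 → ℤ) → ℝ := fun u v => if spin σ c u = spin σ c v then 1 else 0
    with hf
  have hA : (∑ u ∈ (cube N).attach, ∑ v ∈ (cube N).attach,
      if dist1 (u : Fin 2 → ℤ) (v : Fin 2 → ℤ) = 1 then
        (if σ u = σ v then (1 : ℝ) else 0) else 0) =
      ∑ u ∈ cube N, ∑ v ∈ nbrs u, if v ∈ cube N then f u v else 0 := by
    rw [← Finset.sum_attach (cube N)]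
    refine Finset.sum_congr rfl fun u _ => ?_
    have e : (∑ v ∈ nbrs u, if v ∈ cube N then f u v else 0) =
        ∑ v ∈ cube N, if v ∈ nbrs u then f u v else 0 := by
      rw [Finset.sum_ite_mem, Finset.sum_ite_mem, Finset.inter_comm]
    rw [e, ← Finset.sum_attach (cube N)]
    refine Finset.sum_congr rfl fun v _ => ?_
    simp only [mem_nbrs, hf, spin_coe]
  have hB : (∑ u ∈ (cube N).attach,
      (bCount N (u : Fin 2 → ℤ) : ℝ) * (if σ u = c then (1 : ℝ) else 0)) =
      ∑ u ∈ cube N, ∑ v ∈ nbrs u, if v ∈ cube N then 0 else f u v := by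
    rw [← Finset.sum_attach (cube N)]
    refine Finset.sum_congr rfl fun u _ => ?_
    have : ∀ v ∈ nbrs (u : Fin 2 → ℤ), (if v ∈ cube N then 0 else f u v) =
        if v ∈ cube N then 0 else if σ u = c then (1 : ℝ) else 0 := by
      intro v _
      by_cases h : v ∈ cube N
      · simp [h]
      · simp only [h, hf, spin_coe, spin_of_notMem σ c h]
    rw [Finset.sum_congr rfl this, Finset.sum_ite, Finset.sum_const_zero, zero_add,
      Finset.sum_const, nsmul_eq_mul, bCount, Finset.filter_notMem_eq_sdiff]
  rw [hA, hB, Finset.mul_sum, ← Finset.sum_add_distrib]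
  have hC : ∀ u ∈ cube N, ((1 / 2) * (∑ v ∈ nbrs u, if v ∈ cube N then f u v else 0) +
      ∑ v ∈ nbrs u, if v ∈ cube N then 0 else f u v) =
      ∑ v ∈ nbrs u, (if v ∈ cube N then 1 / 2 else 1) * f u v := by
    intro u _
    rw [Finset.mul_sum, ← Finset.sum_add_distrib]
    refine Finset.sum_congr rfl fun v _ => ?_
    split_ifs <;> ring
  rw [Finset.sum_congr rfl hC, Finset.sum_sigma',
    ← Finset.sum_fiberwise_of_maps_to (t := actF 0 (2 * N + 2))
      (g := fun p : Σ _ : Fin 2 → ℤ, Fin 2 → ℤ => vert p.1 ⊓ vert p.2) (fun p hp =>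
        inf_mem_actF (Finset.mem_sigma.1 hp).1 (Finset.mem_sigma.1 hp).2)]
  refine Finset.sum_congr rfl fun s hs => ?_
  set x := site (e1 0 s) with hx
  set y := site (e2 0 s) with hy
  have hfib : ((cube N).sigma nbrs).filter (fun p => vert p.1 ⊓ vert p.2 = s) =
      ({⟨x, y⟩, ⟨y, x⟩} : Finset (Σ _ : Fin 2 → ℤ, Fin 2 → ℤ)).filter fun p => p.1 ∈ cube N := by
    ext ⟨u, v⟩
    have := nbrs_inf_iff (u := u) (v := v) (s := s)
    rw [← hx, ← hy] at this
    simp only [Finset.mem_filter, Finset.mem_sigma, Finset.mem_insert, Finset.mem_singleton,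
      Sigma.mk.injEq, heq_eq_eq]
    rw [and_assoc, this, and_comm]
  have hne : x ≠ y := site_e1_ne s
  have hfxy : f y x = f x y := by simp only [hf, eq_comm]
  rw [hfib, Finset.sum_filter, Finset.sum_pair (by simp [hne])]
  simp only [hfxy]
  change _ = f x y
  have hxy : x ∈ cube N ∨ y ∈ cube N := mem_cube_of_act (mem_actF.1 hs)
  generalize f x y = t
  clear_value x y
  by_cases h1 : x ∈ cube N <;> by_cases h2 : y ∈ cube N <;> simp only [h1, h2, if_true, if_false]
  · ring
  · ring
  · ring
  · tauto

/-- The spins are constant along the open diagonals of the even class. -/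
def Compatible (σ : {x // x ∈ cube N} → Fin q) (c : Fin q) (O : Finset (ℤ × ℤ)) : Prop :=
  ∀ s ∈ O, spin σ c (site (e1 0 s)) = spin σ c (site (e2 0 s))

theorem pottsWeight_eq (c : Fin q) {y : ℝ} (hy : 0 ≤ y) (σ : {x // x ∈ cube N} → Fin q) :
    pottsWeight q N c (Real.log (1 + y)) σ =
      ∑ O ∈ (actF 0 (2 * N + 2)).powerset, if Compatible σ c O then y ^ O.card else 0 := by
  have hw : pottsWeight q N c (Real.log (1 + y)) σ = ∏ s ∈ actF 0 (2 * N + 2),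
      (1 + if spin σ c (site (e1 0 s)) = spin σ c (site (e2 0 s)) then y else 0) := by
    rw [pottsWeight, edge_sum, Finset.mul_sum, Real.exp_sum]
    refine Finset.prod_congr rfl fun s _ => ?_
    split_ifs
    · rw [mul_one, Real.exp_log (by positivity)]
    · simp
  rw [hw, Finset.prod_one_add]
  refine Finset.sum_congr rfl fun O _ => ?_
  rw [Finset.prod_ite_zero, Finset.prod_const]
  exact if_congr Iff.rfl rfl rfl

/-- Spins on all vertices, odd and outer vertices having the boundary colour. -/
noncomputable def spinAll (σ : {x // x ∈ cube N} → Fin q) (c : Fin q) (v : ℤ × ℤ) : Fin q :=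
  if par 0 v then spin σ c (site v) else c

theorem spinAll_outer (σ : {x // x ∈ cube N} → Fin q) (c : Fin q) {v : ℤ × ℤ}
    (hv : ¬ (dom 0 (2 * N + 2) v ∧ par 0 v)) : spinAll σ c v = c := by
  unfold spinAll
  split_ifs with h
  · refine spin_of_notMem _ _ fun h' => hv ⟨?_, h⟩
    rwa [mem_cube_iff_dom, vert_site h] at h'
  · rfl

theorem spinAll_relc {σ : {x // x ∈ cube N} → Fin q} {c : Fin q} {O : Finset (ℤ × ℤ)}
    (h : Compatible σ c O) {v w : ℤ × ℤ} (hvw : relc 0 (2 * N + 2) 0 O v w) :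
    spinAll σ c v = spinAll σ c w := by
  rcases hvw with ⟨s, _, h2, rfl, rfl⟩ | ⟨h1, h2⟩
  · unfold spinAll
    rw [if_pos (par_e1 0 s), if_pos (par_e2 0 s), h s h2]
  · rw [spinAll_outer σ c h1, spinAll_outer σ c h2]

theorem mk_relc_outer {O : Set (ℤ × ℤ)} {R : ℤ} {v : ℤ × ℤ} (hv : ¬ (dom 0 R v ∧ par 0 v)) :
    Quot.mk (relc 0 R 0 O) v = Quot.mk (relc 0 R 0 O) (out 0 R) :=
  Quot.sound (Or.inr ⟨hv, fun h => not_dom_out _ _ h.1⟩)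

theorem spinAll_comp {c : Fin q} {O : Set (ℤ × ℤ)} (F : Quot (relc 0 (2 * N + 2) 0 O) → Fin q)
    (hF : F (Quot.mk _ (out 0 (2 * N + 2))) = c) (v : ℤ × ℤ) :
    spinAll (N := N) (fun u => F (Quot.mk _ (vert u))) c v = F (Quot.mk _ v) := by
  by_cases hv : dom 0 (2 * N + 2) v ∧ par 0 v
  · have h : site v ∈ cube N := by rw [mem_cube_iff_dom, vert_site hv.2]; exact hv.1
    rw [spinAll, if_pos hv.2, spin, dif_pos h]
    simp only [vert_site hv.2]
  · rw [spinAll_outer _ _ hv, mk_relc_outer hv, hF]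

theorem card_compatible (c : Fin q) {O : Finset (ℤ × ℤ)} (hO : O ⊆ actF 0 (2 * N + 2))
    (w : ℤ × ℤ) :
    (Finset.univ.filter fun σ : {x // x ∈ cube N} → Fin q =>
      Compatible σ c O ∧ spinAll σ c w = c).card =
    q ^ (kc 0 (2 * N + 2) 0 O -
      if EqvGen (relc 0 (2 * N + 2) 0 O) w (out 0 (2 * N + 2)) then 1 else 2) := by
  set R : ℤ := 2 * N + 2 with hR
  set K := Quot (relc 0 R 0 (O : Set (ℤ × ℤ)))
  let _ : Fintype K := Fintype.ofFinite K
  set r : K := Quot.mk _ (out 0 R) with hr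
  set k : K := Quot.mk _ w with hk
  have hcard : (Fintype.piFinset fun a : K => if a ∈ ({k, r} : Finset K) then ({c} : Finset (Fin q))
      else Finset.univ).card = q ^ (kc 0 R 0 O -
        if EqvGen (relc 0 R 0 O) w (out 0 R) then 1 else 2) := by
    rw [Fintype.card_piFinset]
    simp only [apply_ite Finset.card, Finset.card_singleton, Finset.card_univ, Fintype.card_fin]
    rw [Finset.prod_ite, Finset.prod_const_one, one_mul, Finset.prod_const,
      Finset.filter_notMem_eq_sdiff, ← Finset.compl_eq_univ_sdiff, Finset.card_compl, kc,
      Nat.card_eq_fintype_card]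
    congr 2
    by_cases h : k = r
    · rw [if_pos ((mk_eq_iff _).1 h), h]; simp
    · rw [if_neg fun h' => h ((mk_eq_iff _).2 h'), Finset.card_pair h]
  rw [← hcard]
  symm
  have mem : ∀ F : K → Fin q, F ∈ (Fintype.piFinset fun a : K => if a ∈ ({k, r} : Finset K) then
      ({c} : Finset (Fin q)) else Finset.univ) ↔ F k = c ∧ F r = c := by
    intro F
    rw [Fintype.mem_piFinset]
    constructor
    · intro h
      have h1 := h k
      have h2 := h r
      simp only [Finset.mem_insert, true_or, or_true, Finset.mem_singleton, if_true] at h1 h2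
      exact ⟨h1, h2⟩
    · rintro ⟨h1, h2⟩ a
      split_ifs with h
      · rcases Finset.mem_insert.1 h with rfl | h
        · simpa using h1
        · rw [Finset.mem_singleton.1 h]; simpa using h2
      · simp
  refine Finset.card_bij (fun F _ u => F (Quot.mk _ (vert u))) ?_ ?_ ?_
  · intro F hF
    obtain ⟨h1, h2⟩ := (mem F).1 hF
    have hs := spinAll_comp (N := N) F h2
    refine Finset.mem_filter.2 ⟨Finset.mem_univ _, fun s hsO => ?_, by rw [hs]; exact h1⟩
    have e : spinAll (N := N) (fun u => F (Quot.mk _ (vert u))) c (e1 0 s) =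
        spinAll (N := N) (fun u => F (Quot.mk _ (vert u))) c (e2 0 s) := by
      rw [hs, hs]
      exact congrArg F (Quot.sound (Or.inl ⟨s, mem_actF.1 (hO hsO), hsO, rfl, rfl⟩))
    simpa only [spinAll, par_e1, par_e2, if_true] using e
  · intro F hF F' hF' h
    funext a
    induction a using Quot.ind with
    | mk v =>
      have h := congrArg (fun σ => spinAll σ c v) h
      exact (spinAll_comp (N := N) F ((mem F).1 hF).2 v).symm.trans
        (h.trans (spinAll_comp (N := N) F' ((mem F').1 hF').2 v))
  · intro σ hσ
    obtain ⟨-, h1, h2⟩ := Finset.mem_filter.1 hσ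
    refine ⟨Quot.lift (spinAll σ c) fun _ _ => spinAll_relc h1, (mem _).2 ⟨h2, ?_⟩, ?_⟩
    · exact spinAll_outer _ _ fun h => not_dom_out _ _ h.1
    · funext u
      change spinAll σ c (vert u) = σ u
      rw [spinAll, if_pos (par_vert _), site_vert, spin_coe]

theorem sum_pottsWeight (c : Fin q) {y : ℝ} (hy : 0 ≤ y) (w : ℤ × ℤ) :
    ∑ σ : {x // x ∈ cube N} → Fin q, pottsWeight q N c (Real.log (1 + y)) σ *
      (if spinAll σ c w = c then (1 : ℝ) else 0) =
    ∑ O ∈ (actF 0 (2 * N + 2)).powerset, y ^ O.card * (q : ℝ) ^ (kc 0 (2 * N + 2) 0 O -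
      if EqvGen (relc 0 (2 * N + 2) 0 O) w (out 0 (2 * N + 2)) then 1 else 2) := by
  simp only [pottsWeight_eq c hy, Finset.sum_mul]
  rw [Finset.sum_comm]
  refine Finset.sum_congr rfl fun O hO => ?_
  have := card_compatible (N := N) c (Finset.mem_powerset.1 hO) w
  rw [← Nat.cast_pow, ← this, Finset.card_filter, Nat.cast_sum, Finset.mul_sum]
  refine Finset.sum_congr rfl fun σ _ => ?_
  by_cases h1 : Compatible σ c O <;> by_cases h2 : spinAll σ c w = c <;> simp [h1, h2]

/-- The self-dual point: the weight of a configuration in terms of the number of loops. -/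
theorem weight_eq {y : ℝ} (hy : 0 < y) {R : ℤ} (hR : R % 2 = 0) (h2R : 2 ≤ R) :
    ∃ C : ℝ, 0 < C ∧ ∀ O ∈ (actF 0 R).powerset,
      y ^ O.card * (y ^ 2) ^ (kc 0 R 0 O - 1) = C * y ^ kap 0 R 0 (O : Set (ℤ × ℤ)) := by
  refine ⟨y ^ (-1 - jc 0 R 0 ∅), by positivity, fun O hO => ?_⟩
  have h1 := euler_zero R hR h2R (O : Set (ℤ × ℤ))
  have h2 := kappa_add_one 0 R 0 (O : Set (ℤ × ℤ))
  have h3 : {s | act 0 R s ∧ s ∈ (O : Set (ℤ × ℤ))}.ncard = O.card := by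
    rw [← Set.ncard_coe_finset]
    congr 1
    ext s
    exact ⟨fun h => h.2, fun h => ⟨mem_actF.1 (Finset.mem_powerset.1 hO h), h⟩⟩
  have h4 : 1 ≤ kc 0 R 0 (O : Set (ℤ × ℤ)) := Nat.card_pos (α := Quot _)
  rw [h3] at h1
  have h5 : jc 0 R 0 (O : Set (ℤ × ℤ)) = (kc 0 R (1 - 0) (O : Set (ℤ × ℤ))ᶜ : ℤ) - kc 0 R 0 O := rfl
  rw [h5] at h1
  rw [← pow_mul, ← pow_add, ← zpow_natCast, ← zpow_natCast, ← zpow_add₀ hy.ne']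
  congr 1
  unfold kap
  push_cast [Nat.cast_sub h4]
  omega

theorem pottsMag_eq (hq : 1 ≤ q) (c : Fin q) :
    pottsMag q N c (Real.log (1 + Real.sqrt q)) =
      (1 - 1 / q) * arm (Real.sqrt q) (2 * N + 2) := by
  set y := Real.sqrt q with hy
  have hq0 : (0 : ℝ) < q := by exact_mod_cast hq
  have hy0 : 0 < y := Real.sqrt_pos.2 hq0
  have hyq : y ^ 2 = q := Real.sq_sqrt hq0.le
  obtain ⟨C, hC, hw⟩ := weight_eq hy0 (R := 2 * N + 2) (by omega) (by omega)
  have hden : ∑ σ : {x // x ∈ cube N} → Fin q, pottsWeight q N c (Real.log (1 + y)) σ =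
      C * fk y 0 (2 * N + 2) 0 fun _ => True := by
    have h := sum_pottsWeight (N := N) c hy0.le (out 0 (2 * N + 2))
    have e : ∀ σ : {x // x ∈ cube N} → Fin q, spinAll σ c (out 0 (2 * N + 2)) = c := fun σ =>
      spinAll_outer _ _ fun h => not_dom_out _ _ h.1
    simp only [e, if_true, mul_one, EqvGen.refl] at h
    rw [h, fk, Finset.mul_sum]
    refine Finset.sum_congr rfl fun O hO => ?_
    rw [if_pos trivial, ← hw O hO, hyq]
  have hnum : ∑ σ : {x // x ∈ cube N} → Fin q, pottsWeight q N c (Real.log (1 + y)) σ *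
      (if σ ⟨fun _ => 0, origin_mem_cube N⟩ = c then (1 : ℝ) else 0) =
      C * ((1 - 1 / q) * fk y 0 (2 * N + 2) 0 (fun O => EqvGen (rel 0 (2 * N + 2) 0 O) 0
        (out 0 (2 * N + 2))) + 1 / q * fk y 0 (2 * N + 2) 0 fun _ => True) := by
    have h := sum_pottsWeight (N := N) c hy0.le 0
    have e : ∀ σ : {x // x ∈ cube N} → Fin q,
        spinAll σ c 0 = σ ⟨fun _ => 0, origin_mem_cube N⟩ := fun σ => by
      have h0 : (0 : ℤ × ℤ) = vert (fun _ => 0) := rfl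
      rw [h0, spinAll, if_pos (par_vert _), site_vert]
      exact spin_coe σ c ⟨_, origin_mem_cube N⟩
    simp only [e] at h
    rw [h, fk, fk, Finset.mul_sum, Finset.mul_sum, ← Finset.sum_add_distrib, Finset.mul_sum]
    refine Finset.sum_congr rfl fun O hO => ?_
    have hiff : EqvGen (rel 0 (2 * N + 2) 0 (O : Set (ℤ × ℤ))) 0 (out 0 (2 * N + 2)) ↔
        EqvGen (relc 0 (2 * N + 2) 0 (O : Set (ℤ × ℤ))) 0 (out 0 (2 * N + 2)) :=
      rel_iff_relc (fun _ => by simp [par]) fun h => absurd h (not_dom_out _ _)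
    simp only [hiff, if_true]
    have hwO := hw O hO
    rw [hyq] at hwO
    split_ifs with hE
    · rw [hwO]; ring
    · have h2 : 2 ≤ kc 0 (2 * N + 2) 0 (O : Set (ℤ × ℤ)) := by
        have : Nontrivial (Quot (relc 0 (2 * N + 2) 0 (O : Set (ℤ × ℤ)))) :=
          ⟨⟨_, _, fun h => hE ((mk_eq_iff _).1 h)⟩⟩
        exact Finite.one_lt_card
      have h3 : kc 0 (2 * N + 2) 0 (O : Set (ℤ × ℤ)) - 1 =
          kc 0 (2 * N + 2) 0 (O : Set (ℤ × ℤ)) - 2 + 1 := by omega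
      rw [h3, pow_succ] at hwO
      rw [mul_zero, zero_add]
      field_simp
      linarith
  have hZ := fk_pos hy0 0 (2 * N + 2) 0
  rw [pottsMag, hnum, hden, arm]
  set Z := fk y 0 (2 * N + 2) 0 fun _ => True
  field_simp
  ring

theorem arm_le_one {x : ℝ} (hx : 0 < x) (n : ℤ) : arm x n ≤ 1 := by
  rw [arm, div_le_one (fk_pos hx _ _ _)]
  exact fk_mono hx.le fun _ _ _ => trivial

theorem exists_exp_add_exp_neg {y : ℝ} (hy : 2 < y) :
    ∃ l > 0, Real.exp l + Real.exp (-l) = y := by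
  refine ⟨Real.arcosh (y / 2), Real.arcosh_pos (by linarith), ?_⟩
  have := Real.cosh_arcosh (x := y / 2) (by linarith)
  rw [Real.cosh_eq] at this
  linarith

end Potts


/-- discontinuity of the phase transition for the planar Potts model with
`q ≥ 5`: at the critical point `β_c(q) = log(1+√q)` the spontaneous magnetisation (with
boundary condition given by the first colour) is positive. -/
theorem potts_discontinuous (q : ℕ) (hq : 5 ≤ q) :
    0 < pottsMstar q ⟨0, by omega⟩ (Real.log (1 + Real.sqrt q)) := by
  have hq5 : (5 : ℝ) ≤ q := by exact_mod_cast hq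
  have hy : 2 < Real.sqrt q := by
    rw [Real.lt_sqrt (by norm_num)]; linarith
  obtain ⟨l, hl, hly⟩ := Potts.exists_exp_add_exp_neg hy
  obtain ⟨δ, hδ, harm⟩ := Potts.exists_arm_gt hl
  rw [hly] at harm
  have hc : 0 < 1 - 1 / (q : ℝ) := by
    have : 1 / (q : ℝ) < 1 := by rw [div_lt_one (by linarith)]; linarith
    linarith
  refine lt_of_lt_of_le (mul_pos hc hδ) ?_
  refine le_limsup_of_frequently_le (Frequently.of_forall fun N => ?_)
    (isBoundedUnder_of ⟨1 - 1 / q, fun N => ?_⟩)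
  · rw [Potts.pottsMag_eq (by omega)]
    exact mul_le_mul_of_nonneg_left (harm _ (by omega)).le hc.le
  · rw [Potts.pottsMag_eq (by omega)]
    exact mul_le_of_le_one_right hc.le (Potts.arm_le_one (by linarith) _)
end
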